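/- For any 0 < α < β < 1 and χ > 1/2, and any ε > 0, there exists N₀ such that for all N ≥ N₀ the following holds: for every connected set C ⊆ V_{βN} of ℓ¹-diameter at least αN, every subset A ⊆ C with |A| ≤ N·exp(−(log N)^χ), and every v ∈ ∂V_{(1+β)N/2}, the harmonic measure satisfies Hm(v, A; C ∪ ∂V_N) ≤ ε·(log N)^{−10}. -/

import Mathlib

open MeasureTheory ProbabilityTheory Set

attribute [local instance] Classical.propDecidable

noncomputable section

/-! ### The lattice boxes `V_N`, adjacency, boundary -/

/-- The `N × N` box `V_N ⊆ ℤ²`, centered at the origin or at `(1/2,1/2)` according to the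
parity of `N`. -/
def box (N : ℕ) : Finset (ℤ × ℤ) :=
  Finset.Icc (-(((N : ℤ) - 1) / 2)) ((N : ℤ) / 2) ×ˢ
    Finset.Icc (-(((N : ℤ) - 1) / 2)) ((N : ℤ) / 2)

/-- `V_x = V_{⌊x⌋}` for real `x`. -/
def boxR (x : ℝ) : Finset (ℤ × ℤ) := box ⌊x⌋₊

/-- Nearest-neighbour adjacency on `ℤ²`. -/
def adj (u v : ℤ × ℤ) : Prop := |u.1 - v.1| + |u.2 - v.2| = 1

/-- The four lattice neighbours of a point. -/
def nbrs (u : ℤ × ℤ) : Finset (ℤ × ℤ) :=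
  {(u.1 + 1, u.2), (u.1 - 1, u.2), (u.1, u.2 + 1), (u.1, u.2 - 1)}

/-- The (inner) boundary `∂V_N`. -/
def bdry (N : ℕ) : Finset (ℤ × ℤ) :=
  (box N).filter fun v => ∃ u ∈ nbrs v, u ∉ box N

/-- `∂V_x = ∂V_{⌊x⌋}` for real `x`. -/
def bdryR (x : ℝ) : Finset (ℤ × ℤ) := bdry ⌊x⌋₊

/-! ### Simple random walk: killed transition kernel, Green's function, harmonic measure -/

/-- `killedStep K n u v` is the probability that simple random walk started at `u` is at `v`
at time `n` without having visited the killing set `K` at any time `≤ n`. -/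
def killedStep (K : Set (ℤ × ℤ)) : ℕ → (ℤ × ℤ) → (ℤ × ℤ) → ℝ
  | 0, u, v => if u = v ∧ u ∉ K then 1 else 0
  | n + 1, u, v => if u ∈ K then 0 else (1 / 4) * ∑ w ∈ nbrs u, killedStep K n w v

/-- Green's function of simple random walk killed on the set `K`: the expected number of
visits to `v` strictly before hitting `K`, for the walk started at `u`. -/
def greenK (K : Set (ℤ × ℤ)) (u v : ℤ × ℤ) : ℝ := ∑' n, killedStep K n u v

/-- `G_{V_N}(u,v)`: Green's function of simple random walk killed at `∂V_N`. -/
def green (N : ℕ) (u v : ℤ × ℤ) : ℝ := greenK (↑(bdry N)) u v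

/-- `hitStep A n v u` is the probability that simple random walk started at `v` first hits
the set `A` at time `n`, and does so at the point `u`. -/
def hitStep (A : Set (ℤ × ℤ)) : ℕ → (ℤ × ℤ) → (ℤ × ℤ) → ℝ
  | 0, v, u => if v = u ∧ v ∈ A then 1 else 0
  | n + 1, v, u => if v ∈ A then 0 else (1 / 4) * ∑ w ∈ nbrs v, hitStep A n w u

/-- Harmonic measure `Hm(v, u; A) = ℙ_v(S_{τ_A} = u)`. -/
def hm (v u : ℤ × ℤ) (A : Set (ℤ × ℤ)) : ℝ := ∑' n, hitStep A n v u

/-- `Hm(v, B; A) = ∑_{u ∈ B} Hm(v, u; A)`. -/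
def hmSet (v : ℤ × ℤ) (B A : Set (ℤ × ℤ)) : ℝ := ∑' u : B, hm v (↑u) A

/-! ### Centered Gaussian families and the discrete GFF -/

/-- `f` is a centered Gaussian family (over the indices in `S`) with covariance `K`:
every finite linear combination of the `f i`, `i ∈ S`, is a centered Gaussian variable whose
variance is the corresponding quadratic form of `K`. -/
def IsGaussFam {Ω ι : Type*} [MeasurableSpace Ω] (P : Measure Ω)
    (f : ι → Ω → ℝ) (K : ι → ι → ℝ) (S : Set ι) : Prop :=
  (∀ i, Measurable (f i)) ∧
  ∀ l : ι →₀ ℝ, ↑l.support ⊆ S →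
    P.map (fun ω => ∑ i ∈ l.support, l i * f i ω) =
      gaussianReal 0 (∑ i ∈ l.support, ∑ j ∈ l.support, l i * l j * K i j).toNNReal

/-- Covariance of the discrete GFF on `V_N` with Dirichlet boundary conditions:
`(1/4) G_{V_N}(u,v)`. -/
def gffCov (N : ℕ) (u v : ℤ × ℤ) : ℝ :=
  if u ∈ box N ∧ v ∈ box N then (1 / 4) * green N u v else 0

/-- `η` is a discrete Gaussian free field on `V_N` with Dirichlet boundary conditions. -/
def IsGFF {Ω : Type*} [MeasurableSpace Ω] (N : ℕ) (P : Measure Ω)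
    (η : ℤ × ℤ → Ω → ℝ) : Prop :=
  IsGaussFam P η (gffCov N) Set.univ

/-! ### Paths and chemical distances in lattice subgraphs -/

/-- `p` is a nearest-neighbour path of `n` steps from `u` to `v` staying in `H`. -/
def IsPath (H : Set (ℤ × ℤ)) (u v : ℤ × ℤ) (n : ℕ) (p : ℕ → ℤ × ℤ) : Prop :=
  p 0 = u ∧ p n = v ∧ (∀ i ≤ n, p i ∈ H) ∧ ∀ i < n, adj (p i) (p (i + 1))

/-- The chemical distance (graph distance) between `A` and `B` inside `H` is `≤ t`. -/
def ConnLe (H : Set (ℤ × ℤ)) (A B : Set (ℤ × ℤ)) (t : ℝ) : Prop :=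
  ∃ n : ℕ, (n : ℝ) ≤ t ∧ ∃ u ∈ A, ∃ v ∈ B, ∃ p, IsPath H u v n p

/-- The chemical distance (graph distance) between `A` and `B` inside `H` is `≥ t`
(in particular this holds when `A` and `B` are not connected inside `H`). -/
def DistGe (H : Set (ℤ × ℤ)) (A B : Set (ℤ × ℤ)) (t : ℝ) : Prop :=
  ∀ n : ℕ, ∀ u ∈ A, ∀ v ∈ B, ∀ p, IsPath H u v n p → t ≤ (n : ℝ)

/-- A set `C ⊆ ℤ²` is connected (as an induced subgraph of `ℤ²`). -/
def LatticeConnected (C : Set (ℤ × ℤ)) : Prop :=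
  ∀ u ∈ C, ∀ v ∈ C, ∃ n p, IsPath C u v n p

def mob (a z : ℂ) : ℂ := (z - a) / (1 - (starRingEnd ℂ) a * z)

lemma mob_den_ne {a z : ℂ} (ha : ‖a‖ < 1) (hz : ‖z‖ < 1) : 1 - (starRingEnd ℂ) a * z ≠ 0 := by
  intro h
  have h1 : (starRingEnd ℂ) a * z = 1 := (sub_eq_zero.1 h).symm
  have h2 : ‖a‖ * ‖z‖ = 1 := by
    have := congrArg norm h1
    simpa using this
  nlinarith [norm_nonneg a, norm_nonneg z]

lemma mob_norm_sq {a z : ℂ} (ha : ‖a‖ < 1) (hz : ‖z‖ < 1) :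
    1 - ‖mob a z‖ ^ 2 = (1 - ‖a‖ ^ 2) * (1 - ‖z‖ ^ 2) / ‖1 - (starRingEnd ℂ) a * z‖ ^ 2 := by
  have h := mob_den_ne ha hz
  have h' : ‖1 - (starRingEnd ℂ) a * z‖ ^ 2 ≠ 0 := by positivity
  rw [mob, norm_div, div_pow, eq_div_iff h', sub_mul, div_mul_cancel₀ _ h', one_mul]
  rw [← Complex.normSq_eq_norm_sq, ← Complex.normSq_eq_norm_sq, ← Complex.normSq_eq_norm_sq,
    ← Complex.normSq_eq_norm_sq]
  simp only [Complex.normSq_apply, Complex.sub_re, Complex.sub_im, Complex.mul_re, Complex.mul_im,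
    Complex.conj_re, Complex.conj_im, Complex.one_re, Complex.one_im]
  ring

lemma mob_norm_lt {a z : ℂ} (ha : ‖a‖ < 1) (hz : ‖z‖ < 1) : ‖mob a z‖ < 1 := by
  have h := mob_norm_sq ha hz
  have h' := mob_den_ne ha hz
  have h1 : 0 < (1 - ‖a‖ ^ 2) * (1 - ‖z‖ ^ 2) / ‖1 - (starRingEnd ℂ) a * z‖ ^ 2 := by
    have : 0 < ‖1 - (starRingEnd ℂ) a * z‖ := norm_pos_iff.2 h'
    have h1 : 0 < 1 - ‖a‖ ^ 2 := by nlinarith [norm_nonneg a]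
    have h2 : 0 < 1 - ‖z‖ ^ 2 := by nlinarith [norm_nonneg z]
    positivity
  nlinarith [norm_nonneg (mob a z)]

lemma mob_self (a : ℂ) : mob a a = 0 := by simp [mob]
lemma mob_zero (a : ℂ) : mob a 0 = -a := by simp [mob]

lemma mob_neg_mob {a z : ℂ} (ha : ‖a‖ < 1) (hz : ‖z‖ < 1) : mob (-a) (mob a z) = z := by
  have h := mob_den_ne ha hz
  have h2 : 1 - (starRingEnd ℂ) a * a ≠ 0 := mob_den_ne ha ha
  have h3 := mob_den_ne (a := -a) (by simpa using ha) (mob_norm_lt ha hz)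
  rw [mob, div_eq_iff h3, map_neg]
  have hq : mob a z * (1 - (starRingEnd ℂ) a * z) = z - a := div_mul_cancel₀ _ h
  linear_combination hq

lemma mob_injOn {a : ℂ} (ha : ‖a‖ < 1) : InjOn (mob a) (Metric.ball 0 1) := by
  intro x hx y hy h
  rw [← mob_neg_mob ha (mem_ball_zero_iff.1 hx), h, mob_neg_mob ha (mem_ball_zero_iff.1 hy)]

lemma mob_hasDerivAt {a z : ℂ} (ha : ‖a‖ < 1) (hz : ‖z‖ < 1) :
    HasDerivAt (mob a) ((1 - (starRingEnd ℂ) a * a) / (1 - (starRingEnd ℂ) a * z) ^ 2) z := by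
  have h := mob_den_ne ha hz
  have h1 : HasDerivAt (fun z => z - a) 1 z := (hasDerivAt_id z).sub_const a
  have h2 : HasDerivAt (fun z => 1 - (starRingEnd ℂ) a * z) (-(starRingEnd ℂ) a) z := by
    simpa using ((hasDerivAt_id z).const_mul ((starRingEnd ℂ) a)).const_sub 1
  refine (h1.div h2 h).congr_deriv ?_
  congr 1
  ring

lemma norm_one_sub_conj (a : ℂ) (ha : ‖a‖ < 1) : ‖1 - (starRingEnd ℂ) a * a‖ = 1 - ‖a‖ ^ 2 := by
  rw [Complex.conj_mul', ← Complex.ofReal_pow, ← Complex.ofReal_one, ← Complex.ofReal_sub, Complex.norm_real,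
    Real.norm_of_nonneg]
  nlinarith [norm_nonneg a]

lemma mob_deriv_norm {a z : ℂ} (ha : ‖a‖ < 1) (hz : ‖z‖ < 1) :
    ‖deriv (mob a) z‖ = (1 - ‖a‖ ^ 2) / ‖1 - (starRingEnd ℂ) a * z‖ ^ 2 := by
  rw [(mob_hasDerivAt ha hz).deriv, norm_div, norm_one_sub_conj a ha, norm_pow]

lemma mob_deriv_ne {a z : ℂ} (ha : ‖a‖ < 1) (hz : ‖z‖ < 1) : deriv (mob a) z ≠ 0 := by
  rw [← norm_pos_iff, mob_deriv_norm ha hz]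
  have := norm_pos_iff.2 (mob_den_ne ha hz)
  have h1 : 0 < 1 - ‖a‖ ^ 2 := by nlinarith [norm_nonneg a]
  positivity

lemma mob_differentiableOn {a : ℂ} (ha : ‖a‖ < 1) :
    DifferentiableOn ℂ (mob a) (Metric.ball 0 1) := fun _ hz =>
  (mob_hasDerivAt ha (mem_ball_zero_iff.1 hz)).differentiableAt.differentiableWithinAt

lemma mob_mapsTo {a : ℂ} (ha : ‖a‖ < 1) :
    MapsTo (mob a) (Metric.ball 0 1) (Metric.ball 0 1) := fun _ hz =>
  mem_ball_zero_iff.2 (mob_norm_lt ha (mem_ball_zero_iff.1 hz))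

/-- Schwarz-Pick from a ball into the unit disc: derivative at centre. -/
lemma schwarz_pick_ball {f : ℂ → ℂ} {c : ℂ} {R : ℝ} (hR : 0 < R)
    (hd : DifferentiableOn ℂ f (Metric.ball c R)) (hm : MapsTo f (Metric.ball c R) (Metric.ball 0 1)) :
    ‖deriv f c‖ ≤ (1 - ‖f c‖ ^ 2) / R := by
  have hc : c ∈ Metric.ball c R := Metric.mem_ball_self hR
  have hfc : ‖f c‖ < 1 := mem_ball_zero_iff.1 (hm hc)
  have hd' : DifferentiableOn ℂ (mob (f c) ∘ f) (Metric.ball c R) :=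
    (mob_differentiableOn hfc).comp hd hm
  have h := Complex.norm_deriv_le_div_of_mapsTo_ball (R₂ := 1) hd' (by
    intro z hz
    have := mob_mapsTo hfc (hm hz)
    simpa [mob_self] using (mem_ball_zero_iff.1 this).le) hR
  have hfd : DifferentiableAt ℂ f c := hd.differentiableAt (Metric.ball_mem_nhds c hR)
  rw [deriv_comp c (mob_hasDerivAt hfc hfc).differentiableAt hfd, norm_mul, mob_deriv_norm hfc hfc,
    norm_one_sub_conj _ hfc] at h
  have h1 : 0 < 1 - ‖f c‖ ^ 2 := by nlinarith [norm_nonneg (f c)]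
  have h2 : (1 - ‖f c‖ ^ 2) / (1 - ‖f c‖ ^ 2) ^ 2 = 1 / (1 - ‖f c‖ ^ 2) := by field_simp
  rw [h2, one_div_mul_eq_div, div_le_iff₀ h1] at h
  calc _ ≤ _ := h
    _ = _ := by ring

/-- Schwarz-Pick in the disc. -/
lemma schwarz_pick_disc {φ : ℂ → ℂ} (hd : DifferentiableOn ℂ φ (Metric.ball 0 1))
    (hm : MapsTo φ (Metric.ball 0 1) (Metric.ball 0 1)) {w : ℂ} (hw : ‖w‖ < 1) :
    ‖deriv φ w‖ ≤ (1 - ‖φ w‖ ^ 2) / (1 - ‖w‖ ^ 2) := by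
  have hw' : ‖-w‖ < 1 := by simpa using hw
  have h0 : mob (-w) 0 = w := by simp [mob_zero]
  have h := schwarz_pick_ball (f := φ ∘ mob (-w)) (c := 0) one_pos
    (hd.comp (mob_differentiableOn hw') (mob_mapsTo hw')) (hm.comp (mob_mapsTo hw'))
  have hφ : DifferentiableAt ℂ φ w :=
    hd.differentiableAt (Metric.isOpen_ball.mem_nhds (mem_ball_zero_iff.2 hw))
  rw [deriv_comp 0 (by rw [h0]; exact hφ) (mob_hasDerivAt hw' (by simp)).differentiableAt,
    norm_mul, mob_deriv_norm hw' (by simp), Function.comp, h0] at h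
  have h1 : 0 < 1 - ‖w‖ ^ 2 := by nlinarith [norm_nonneg w]
  rw [le_div_iff₀ h1]
  simpa using h

/-- Hurwitz -/
lemma hurwitz {ι : Type*} {l : Filter ι} [l.NeBot] {U : Set ℂ} (hU : IsOpen U)
    (hUc : IsPreconnected U) {f : ι → ℂ → ℂ} {F : ℂ → ℂ}
    (hf : ∀ n, DifferentiableOn ℂ (f n) U) (hn : ∀ n, ∀ z ∈ U, f n z ≠ 0)
    (hl : TendstoLocallyUniformlyOn f F l U) {b : ℂ} (hb : b ∈ U) (hFb : F b = 0) :
    ∀ z ∈ U, F z = 0 := by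
  have hF : DifferentiableOn ℂ F U := hl.differentiableOn (Filter.Eventually.of_forall hf) hU
  have hFa : AnalyticOnNhd ℂ F U := hF.analyticOnNhd hU
  rcases (hFa b hb).eventually_eq_zero_or_eventually_ne_zero with h | h
  · exact fun z hz => hFa.eqOn_zero_of_preconnected_of_eventuallyEq_zero hUc hb h hz
  exfalso
  rw [eventually_nhdsWithin_iff] at h
  obtain ⟨r0, hr0, hr⟩ := Metric.eventually_nhds_iff_ball.1 (h.and (hU.eventually_mem hb))
  set r := r0 / 2
  have hrp : 0 < r := by positivity
  have hcb : Metric.closedBall b r ⊆ Metric.ball b r0 := Metric.closedBall_subset_ball (by simp [r, hr0])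
  have hcbU : Metric.closedBall b r ⊆ U := fun z hz => (hr z (hcb hz)).2
  have hcpt : IsCompact (Metric.sphere b r) := isCompact_sphere b r
  have hne : (Metric.sphere b r).Nonempty := NormedSpace.sphere_nonempty.2 hrp.le
  obtain ⟨z1, hz1, hmin⟩ := hcpt.exists_isMinOn hne
    ((hF.continuousOn.mono (Metric.sphere_subset_closedBall.trans hcbU)).norm)
  set δ := ‖F z1‖
  have hδ : 0 < δ := norm_pos_iff.2 ((hr z1 (hcb (Metric.sphere_subset_closedBall hz1))).1 (by
    rintro rfl
    simp at hz1; exact hrp.ne hz1))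
  have hu : TendstoUniformlyOn f F l (Metric.closedBall b r) :=
    (tendstoLocallyUniformlyOn_iff_forall_isCompact hU).1 hl _ hcbU (isCompact_closedBall b r)
  obtain ⟨n, hn'⟩ := ((Metric.tendstoUniformlyOn_iff.1 hu) (δ / 3) (by positivity)).exists
  have hg : DiffContOnCl ℂ (fun z => (f n z)⁻¹) (Metric.ball b r) := by
    apply DifferentiableOn.diffContOnCl
    rw [closure_ball b hrp.ne']
    exact ((hf n).mono hcbU).inv fun z hz => hn n z (hcbU hz)
  have h1 := Complex.norm_le_of_forall_mem_frontier_norm_le (C := 3 / (2 * δ)) Metric.isBounded_ball hg (by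
    intro z hz
    rw [frontier_ball b hrp.ne'] at hz
    have h1 := hn' z (Metric.sphere_subset_closedBall hz)
    have h2 : δ ≤ ‖F z‖ := hmin hz
    rw [dist_eq_norm] at h1
    have h3 : 2 * δ / 3 ≤ ‖f n z‖ := by
      have := norm_sub_norm_le (F z) (f n z)
      linarith
    rw [norm_inv]
    calc ‖f n z‖⁻¹ ≤ (2 * δ / 3)⁻¹ := inv_anti₀ (by positivity) h3
      _ = _ := by field_simp) (subset_closure (Metric.mem_ball_self hrp))
  have h2 := hn' b (Metric.mem_closedBall_self hrp.le)
  rw [hFb, dist_zero_left] at h2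
  have h3 : 0 < ‖f n b‖ := norm_pos_iff.2 (hn n b hb)
  rw [norm_inv, inv_le_comm₀ h3 (by positivity)] at h1
  have : (3 / (2 * δ))⁻¹ = 2 * δ / 3 := by field_simp
  linarith

/-- Montel along the hyperfilter -/
lemma montel {U : Set ℂ} (hU : IsOpen U) {f : ℕ → ℂ → ℂ}
    (hf : ∀ n, DifferentiableOn ℂ (f n) U) (hm : ∀ n, MapsTo (f n) U (Metric.ball 0 1)) :
    ∃ F : ℂ → ℂ, TendstoLocallyUniformlyOn f F (Filter.hyperfilter ℕ : Filter ℕ) U := by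
  have hlim : ∀ z ∈ U, ∃ y, Filter.Tendsto (fun n => f n z) (Filter.hyperfilter ℕ : Filter ℕ) (nhds y) := by
    intro z hz
    have hc : IsCompact (Metric.closedBall (0 : ℂ) 1) := isCompact_closedBall 0 1
    obtain ⟨y, -, hy⟩ := hc.ultrafilter_le_nhds ((Filter.hyperfilter ℕ).map (fun n => f n z)) (by
      rw [Filter.le_principal_iff]
      exact Filter.mem_map.2 (Filter.univ_mem' fun n => Metric.ball_subset_closedBall (hm n hz)))
    exact ⟨y, hy⟩
  choose! F hF using hlim
  refine ⟨F, ?_⟩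
  rw [Metric.tendstoLocallyUniformlyOn_iff]
  intro ε hε z hz
  obtain ⟨r, hr, hrU⟩ := Metric.isOpen_iff.1 hU z hz
  have hlip : ∀ n, ∀ y ∈ Metric.ball z r, dist (f n y) (f n z) ≤ 2 / r * dist y z := by
    intro n y hy
    refine Complex.dist_le_div_mul_dist_of_mapsTo_ball ((hf n).mono hrU) ?_ hy
    intro x hx
    have h1 := mem_ball_zero_iff.1 (hm n (hrU hx))
    have h2 := mem_ball_zero_iff.1 (hm n hz)
    rw [mem_closedBall_iff_norm]
    exact (norm_sub_le _ _).trans (by linarith)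
  have hlipF : ∀ y ∈ Metric.ball z r, dist (F y) (F z) ≤ 2 / r * dist y z := by
    intro y hy
    exact le_of_tendsto ((hF y (hrU hy)).dist (hF z hz)) (Filter.Eventually.of_forall fun n => hlip n y hy)
  set ρ := min r (r * ε / 6)
  have hρ : 0 < ρ := by positivity
  refine ⟨Metric.ball z ρ, mem_nhdsWithin_of_mem_nhds (Metric.ball_mem_nhds z hρ), ?_⟩
  have h3 : ∀ᶠ n in (Filter.hyperfilter ℕ : Filter ℕ), dist (F z) (f n z) < ε / 3 := by
    have := Metric.tendsto_nhds.1 (hF z hz) (ε / 3) (by positivity)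
    simpa only [dist_comm] using this
  filter_upwards [h3] with n hn y hy
  have hy' : y ∈ Metric.ball z r := Metric.ball_subset_ball (min_le_left _ _) hy
  have hd : 2 / r * dist y z < ε / 3 := by
    have : dist y z < r * ε / 6 := lt_of_lt_of_le hy (min_le_right _ _)
    calc 2 / r * dist y z < 2 / r * (r * ε / 6) := by gcongr
      _ = ε / 3 := by field_simp; norm_num
  have h1 := hlip n y hy'
  have h2 := hlipF y hy'
  have h4 := dist_triangle4 (F y) (F z) (f n z) (f n y)
  rw [dist_comm (f n z)] at h4
  linarith

def Fam (U : Set ℂ) (f : ℂ → ℂ) : Prop :=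
  DifferentiableOn ℂ f U ∧ MapsTo f U (Metric.ball 0 1) ∧ InjOn f U ∧ ∀ z ∈ U, deriv f z ≠ 0

lemma Fam.mob_comp {U : Set ℂ} (hU : IsOpen U) {f : ℂ → ℂ} (hf : Fam U f) {z0 : ℂ} (hz0 : z0 ∈ U) :
    Fam U (mob (f z0) ∘ f) ∧ ‖deriv (mob (f z0) ∘ f) z0‖ = ‖deriv f z0‖ / (1 - ‖f z0‖ ^ 2) := by
  obtain ⟨h1, h2, h3, h4⟩ := hf
  have h0 : ‖f z0‖ < 1 := mem_ball_zero_iff.1 (h2 hz0)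
  have hd : ∀ z ∈ U, deriv (mob (f z0) ∘ f) z = deriv (mob (f z0)) (f z) * deriv f z := fun z hz =>
    deriv_comp z (mob_hasDerivAt h0 (mem_ball_zero_iff.1 (h2 hz))).differentiableAt
      (h1.differentiableAt (hU.mem_nhds hz))
  refine ⟨⟨(mob_differentiableOn h0).comp h1 h2, (mob_mapsTo h0).comp h2, (mob_injOn h0).comp h3 h2, ?_⟩, ?_⟩
  · intro z hz
    rw [hd z hz]
    exact mul_ne_zero (mob_deriv_ne h0 (mem_ball_zero_iff.1 (h2 hz))) (h4 z hz)
  · rw [hd z0 hz0, norm_mul, mob_deriv_norm h0 h0, norm_one_sub_conj _ h0]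
    have h1 : 0 < 1 - ‖f z0‖ ^ 2 := by nlinarith [norm_nonneg (f z0)]
    field_simp

theorem riemann_map {U : Set ℂ} (hU : IsOpen U) (hUc : IsPreconnected U) {z0 : ℂ} (hz0 : z0 ∈ U)
    (hsq : ∀ f : ℂ → ℂ, DifferentiableOn ℂ f U → (∀ z ∈ U, f z ≠ 0) →
      ∃ s : ℂ → ℂ, DifferentiableOn ℂ s U ∧ ∀ z ∈ U, s z ^ 2 = f z)
    (hne : ∃ f, Fam U f) :
    ∃ F, Fam U F ∧ F z0 = 0 ∧ SurjOn F U (Metric.ball 0 1) := by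
  obtain ⟨r, hr, hrU⟩ := Metric.isOpen_iff.1 hU z0 hz0
  set S : Set ℝ := (fun f => ‖deriv f z0‖) '' {f | Fam U f ∧ f z0 = 0} with hS
  have hSne : S.Nonempty := by
    obtain ⟨f, hf⟩ := hne
    exact ⟨_, _, ⟨(hf.mob_comp hU hz0).1, by simp [mob_self]⟩, rfl⟩
  have hSb : BddAbove S := by
    refine ⟨1 / r, ?_⟩
    rintro _ ⟨f, ⟨hf, hf0⟩, rfl⟩
    have := schwarz_pick_ball hr (hf.1.mono hrU) (hf.2.1.mono_left hrU)
    simpa [hf0] using this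
  obtain ⟨u, -, hu, huS⟩ := exists_seq_tendsto_sSup hSne hSb
  set M := sSup S with hM
  choose f hf using huS
  have hfd : ∀ n, DifferentiableOn ℂ (f n) U := fun n => (hf n).1.1.1
  obtain ⟨F, hF⟩ := montel hU hfd (fun n => (hf n).1.1.2.1)
  have hFd : DifferentiableOn ℂ F U := hF.differentiableOn (Filter.Eventually.of_forall hfd) hU
  have hF' := hF.deriv (Filter.Eventually.of_forall hfd) hU
  have hMF : ‖deriv F z0‖ = M := by
    have h1 := (hF'.tendsto_at hz0).norm
    have h2 := hu.mono_left Nat.hyperfilter_le_atTop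
    refine tendsto_nhds_unique h1 (h2.congr fun n => ?_)
    exact (hf n).2.symm
  have hM0 : 0 < M := by
    obtain ⟨x, hx⟩ := hSne
    have hxp : 0 < x := by
      obtain ⟨f, ⟨hf, -⟩, rfl⟩ := hx
      exact norm_pos_iff.2 (hf.2.2.2 z0 hz0)
    exact lt_of_lt_of_le hxp (le_csSup hSb hx)
  have hF'ne : ∀ z ∈ U, deriv F z ≠ 0 := by
    intro z hz h
    have := hurwitz hU hUc (fun n => (hfd n).deriv hU) (fun n => (hf n).1.1.2.2.2) hF' hz h z0 hz0
    rw [this, norm_zero] at hMF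
    exact hM0.ne hMF
  have hnc : ∀ z ∈ U, ∀ c, ¬ (∀ᶠ y in nhds z, F y = c) := by
    intro z hz c h
    apply hF'ne z hz
    rw [Filter.EventuallyEq.deriv_eq (f := fun _ => c) h]
    simp
  have hF0 : F z0 = 0 := by
    have h1 := hF.tendsto_at hz0
    refine tendsto_nhds_unique h1 (tendsto_const_nhds.congr fun n => (hf n).1.2.symm)
  have hFm : MapsTo F U (Metric.ball 0 1) := by
    have hle : ∀ z ∈ U, ‖F z‖ ≤ 1 := fun z hz => le_of_tendsto (hF.tendsto_at hz).norm
      (Filter.Eventually.of_forall fun n => (mem_ball_zero_iff.1 ((hf n).1.1.2.1 hz)).le)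
    intro z hz
    rw [mem_ball_zero_iff]
    refine lt_of_le_of_ne (hle z hz) fun h => ?_
    have hmax : IsMaxOn (norm ∘ F) U z := fun y hy => by simpa [h] using hle y hy
    have := Complex.eqOn_of_isPreconnected_of_isMaxOn_norm hUc hU hFd hz hmax
    exact hnc z hz (F z) (Filter.eventually_of_mem (hU.mem_nhds hz) fun y hy => this hy)
  have hFi : InjOn F U := by
    intro z1 hz1 z2 hz2 h
    by_contra hne
    obtain ⟨ρ, hρ, hρU⟩ := Metric.isOpen_iff.1 (hU.inter (isOpen_compl_singleton (x := z1))) z2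
      ⟨hz2, fun h => hne h.symm⟩
    have hsub : Metric.ball z2 ρ ⊆ U := fun y hy => (hρU hy).1
    have hlim : TendstoLocallyUniformlyOn (fun n z => f n z - f n z1) (fun z => F z - F z1)
        (Filter.hyperfilter ℕ : Filter ℕ) (Metric.ball z2 ρ) := by
      have h1 := hF.mono hsub
      rw [Metric.tendstoLocallyUniformlyOn_iff] at h1 ⊢
      intro ε hε z hz
      obtain ⟨t, ht, hh⟩ := h1 (ε / 2) (by positivity) z hz
      refine ⟨t, ht, ?_⟩
      filter_upwards [hh, Metric.tendsto_nhds.1 (hF.tendsto_at hz1) (ε / 2) (by positivity)] with n h1 h2 y hy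
      have := dist_sub_sub_le (F y) (F z1) (f n y) (f n z1)
      have h3 := h1 y hy
      rw [dist_comm] at h2
      linarith
    have h0 := hurwitz Metric.isOpen_ball (convex_ball z2 ρ).isPreconnected
      (fun n => ((hfd n).mono hsub).sub_const (f n z1)) (fun n z hz h0 => by
        have := (hf n).1.1.2.2.1 (hsub hz) hz1 (sub_eq_zero.1 h0)
        exact (hρU hz).2 this) hlim (Metric.mem_ball_self hρ) (by simp [h])
    refine hnc z2 hz2 (F z1) (Filter.eventually_of_mem (Metric.ball_mem_nhds z2 hρ) fun y hy => ?_)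
    exact sub_eq_zero.1 (h0 y hy)
  refine ⟨F, ⟨hFd, hFm, hFi, hF'ne⟩, hF0, ?_⟩
  intro w hw
  by_contra hno
  have hwn : ‖w‖ < 1 := mem_ball_zero_iff.1 hw
  have hFw : ∀ z ∈ U, F z ≠ w := fun z hz h => hno ⟨z, hz, h⟩
  set g := mob w ∘ F with hg
  have hgd : DifferentiableOn ℂ g U := (mob_differentiableOn hwn).comp hFd hFm
  have hgm : MapsTo g U (Metric.ball 0 1) := (mob_mapsTo hwn).comp hFm
  have hg' : ∀ z ∈ U, deriv g z = deriv (mob w) (F z) * deriv F z := fun z hz =>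
    deriv_comp z (mob_hasDerivAt hwn (mem_ball_zero_iff.1 (hFm hz))).differentiableAt
      (hFd.differentiableAt (hU.mem_nhds hz))
  have hgi : InjOn g U := (mob_injOn hwn).comp hFi hFm
  obtain ⟨s, hsd, hs⟩ := hsq g hgd (by
    intro z hz h
    exact hFw z hz (mob_injOn hwn (hFm hz) hw (by rw [mob_self]; exact h)))
  have hsg : ∀ z ∈ U, deriv g z = 2 * s z * deriv s z := by
    intro z hz
    have h1 : g =ᶠ[nhds z] fun y => s y ^ 2 := Filter.eventually_of_mem (hU.mem_nhds hz) fun y hy => (hs y hy).symm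
    rw [h1.deriv_eq]
    have := ((hsd.differentiableAt (hU.mem_nhds hz)).hasDerivAt.fun_pow 2).deriv
    simpa using this
  have hg'ne : ∀ z ∈ U, deriv g z ≠ 0 := fun z hz => by
    rw [hg' z hz]
    exact mul_ne_zero (mob_deriv_ne hwn (mem_ball_zero_iff.1 (hFm hz))) (hF'ne z hz)
  have hsF : Fam U s := by
    refine ⟨hsd, ?_, ?_, ?_⟩
    · intro z hz
      have h1 := mem_ball_zero_iff.1 (hgm hz)
      rw [← hs z hz, norm_pow] at h1
      rw [mem_ball_zero_iff]
      nlinarith [norm_nonneg (s z)]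
    · intro a ha b hb h
      apply hgi ha hb
      rw [← hs a ha, ← hs b hb, h]
    · intro z hz h
      apply hg'ne z hz
      rw [hsg z hz, h, mul_zero]
  obtain ⟨hhF, hh⟩ := hsF.mob_comp hU hz0
  have hle : ‖deriv s z0‖ / (1 - ‖s z0‖ ^ 2) ≤ M := by
    rw [← hh]
    exact le_csSup hSb ⟨_, ⟨hhF, by simp [mob_self]⟩, rfl⟩
  have e1 : ‖s z0‖ ^ 2 = ‖w‖ := by
    rw [← norm_pow, hs z0 hz0, hg, Function.comp, hF0, mob_zero, norm_neg]
  have e2 : 2 * ‖s z0‖ * ‖deriv s z0‖ = (1 - ‖w‖ ^ 2) * M := by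
    have := congrArg norm (hsg z0 hz0)
    rw [hg' z0 hz0, norm_mul, hF0, mob_deriv_norm hwn (by simp), hMF, norm_mul, norm_mul] at this
    simpa using this.symm
  have hs1 : ‖s z0‖ < 1 := mem_ball_zero_iff.1 (hsF.2.1 hz0)
  have hs0 : 0 < ‖s z0‖ := by
    rw [norm_pos_iff]
    intro h
    rw [h, norm_zero] at e1
    apply hFw z0 hz0
    rw [hF0]
    exact (norm_eq_zero.1 (by simpa using e1.symm)).symm
  set t := ‖s z0‖
  rw [← e1] at e2
  rw [div_le_iff₀ (by nlinarith)] at hle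
  have : 2 * t * ‖deriv s z0‖ ≤ 2 * t * (M * (1 - t ^ 2)) := by gcongr
  rw [e2] at this
  have h5 : 0 < M * (1 - t ^ 2) * (1 - t) ^ 2 := by
    have : 0 < 1 - t ^ 2 := by nlinarith
    have : 0 < 1 - t := by linarith
    positivity
  nlinarith

theorem riemann_extremal {U : Set ℂ} (hU : IsOpen U) {F : ℂ → ℂ} (hF : Fam U F)
    (hs : SurjOn F U (Metric.ball 0 1)) {G : ℂ → ℂ} (hG : DifferentiableOn ℂ G U)
    (hGm : MapsTo G U (Metric.ball 0 1)) {z : ℂ} (hz : z ∈ U) :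
    ‖deriv G z‖ / (1 - ‖G z‖ ^ 2) ≤ ‖deriv F z‖ / (1 - ‖F z‖ ^ 2) := by
  obtain ⟨hFd, hFm, hFi, hF'⟩ := hF
  -- inverse
  set I := Function.invFunOn F U with hI
  have hIm : ∀ w ∈ Metric.ball (0 : ℂ) 1, I w ∈ U ∧ F (I w) = w := fun w hw =>
    ⟨Function.invFunOn_mem (hs hw), Function.invFunOn_eq (hs hw)⟩
  have hIF : ∀ y ∈ U, I (F y) = y := fun y hy => hFi (hIm _ (hFm hy)).1 hy (hIm _ (hFm hy)).2
  have hstrict : ∀ y ∈ U, HasStrictDerivAt F (deriv F y) y := fun y hy =>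
    (hFd.analyticAt (hU.mem_nhds hy)).hasStrictDerivAt
  have hId : ∀ y ∈ U, HasDerivAt I (deriv F y)⁻¹ (F y) := by
    intro y hy
    have h1 := (hstrict y hy).to_localInverse (hF' y hy)
    refine h1.hasDerivAt.congr_of_eventuallyEq ?_
    have hloc := (hstrict y hy).hasStrictFDerivAt_equiv (hF' y hy)
    have h2 := hloc.eventually_right_inverse
    have h3 : ∀ᶠ w in nhds (F y), (hstrict y hy).localInverse F (deriv F y) y (hF' y hy) w ∈ U := by
      have := h1.hasDerivAt.continuousAt
      have h4 : (hstrict y hy).localInverse F (deriv F y) y (hF' y hy) (F y) = y :=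
        hloc.localInverse_apply_image
      exact this.eventually_mem (hU.mem_nhds (by rw [h4]; exact hy))
    filter_upwards [h2, h3] with w hw hw3
    have : F ((hstrict y hy).localInverse F (deriv F y) y (hF' y hy) w) = w := hw
    rw [← hIF _ hw3, this]
  have hId' : DifferentiableOn ℂ I (Metric.ball 0 1) := by
    intro w hw
    obtain ⟨y, hy, rfl⟩ := hs hw
    exact (hId y hy).differentiableAt.differentiableWithinAt
  have hIm' : MapsTo I (Metric.ball 0 1) U := fun w hw => (hIm w hw).1
  have hFz : ‖F z‖ < 1 := mem_ball_zero_iff.1 (hFm hz)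
  have h := schwarz_pick_disc (hG.comp hId' hIm') (hGm.comp hIm') hFz
  rw [deriv_comp (F z) (by rw [hIF z hz]; exact hG.differentiableAt (hU.mem_nhds hz)) (hId z hz).differentiableAt,
    (hId z hz).deriv, Function.comp, hIF z hz, norm_mul, norm_inv] at h
  have h1 : 0 < 1 - ‖F z‖ ^ 2 := by nlinarith [norm_nonneg (F z)]
  have hGz : ‖G z‖ < 1 := mem_ball_zero_iff.1 (hGm hz)
  have h2 : 0 < 1 - ‖G z‖ ^ 2 := by nlinarith [norm_nonneg (G z)]
  have h3 : 0 < ‖deriv F z‖ := norm_pos_iff.2 (hF' z hz)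
  rw [le_div_iff₀ h1, ← div_eq_mul_inv, div_mul_eq_mul_div, div_le_iff₀ h3] at h
  rw [div_le_div_iff₀ h2 h1]
  linarith

lemma int_antidiff (g : ℤ → ZMod 2) : ∃ G : ℤ → ZMod 2, G 0 = 0 ∧ ∀ j, G j + G (j - 1) = g j := by
  refine ⟨fun j => (∑ k ∈ Finset.Ioc 0 j, g k) + ∑ k ∈ Finset.Ioc j 0, g k, by simp, ?_⟩
  intro j
  have h2 : ∀ a : ZMod 2, a + a = 0 := CharTwo.add_self_eq_zero
  beta_reduce
  rcases le_or_gt j 0 with hj | hj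
  · have e1 : Finset.Ioc 0 j = ∅ := Finset.Ioc_eq_empty (by omega)
    have e2 : Finset.Ioc 0 (j - 1) = ∅ := Finset.Ioc_eq_empty (by omega)
    have e3 : Finset.Ioc (j - 1) 0 = insert j (Finset.Ioc j 0) := by
      ext k; simp only [Finset.mem_Ioc, Finset.mem_insert]; omega
    rw [e1, e2, e3, Finset.sum_insert (by simp), Finset.sum_empty]
    linear_combination h2 (∑ k ∈ Finset.Ioc j 0, g k)
  · have e1 : Finset.Ioc j 0 = ∅ := Finset.Ioc_eq_empty (by omega)
    have e2 : Finset.Ioc (j - 1) 0 = ∅ := Finset.Ioc_eq_empty (by omega)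
    have e3 : Finset.Ioc 0 j = insert j (Finset.Ioc 0 (j - 1)) := by
      ext k; simp only [Finset.mem_Ioc, Finset.mem_insert]; omega
    rw [e1, e2, e3, Finset.sum_insert (by simp), Finset.sum_empty]
    linear_combination h2 (∑ k ∈ Finset.Ioc 0 (j - 1), g k)

def curl (H V : ℤ × ℤ → ZMod 2) (x : ℤ × ℤ) : ZMod 2 :=
  H x + H (x.1 - 1, x.2) + V x + V (x.1, x.2 - 1)

lemma curl_add (H V H' V' : ℤ × ℤ → ZMod 2) (x : ℤ × ℤ) :
    curl (H + H') (V + V') x = curl H V x + curl H' V' x := by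
  simp only [curl, Pi.add_apply]; ring

lemma exact_of_curl (H V : ℤ × ℤ → ZMod 2) (hc : ∀ x, curl H V x = 0) :
    ∃ ε : ℤ × ℤ → ZMod 2, (∀ i j, ε (i, j) + ε (i, j - 1) = H (i, j)) ∧
      ∀ i j, ε (i, j) + ε (i - 1, j) = V (i, j) := by
  have h2 : ∀ a : ZMod 2, a + a = 0 := CharTwo.add_self_eq_zero
  obtain ⟨a, -, ha⟩ := int_antidiff (fun i => V (i, 0))
  choose b hb0 hb using fun i => int_antidiff (fun j => H (i, j))
  refine ⟨fun x => a x.1 + b x.1 x.2, ?_, ?_⟩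
  · intro i j
    have := hb i j
    simp only
    linear_combination this + h2 (a i)
  · intro i j
    simp only
    induction j using Int.induction_on with
    | zero => rw [hb0, hb0]; linear_combination ha i
    | succ k ih =>
      have h1 := hb i (k + 1)
      have h3 := hb (i - 1) (k + 1)
      have h4 := hc (i, k + 1)
      simp only [curl, add_sub_cancel_right] at h1 h3 h4
      linear_combination h1 + h3 + h4 + ih - h2 (b i k) - h2 (b (i - 1) k) - h2 (V (i, k + 1)) 
    | pred k ih =>
      have h1 := hb i (-k)
      have h3 := hb (i - 1) (-k)
      have h4 := hc (i, -k)
      simp only [curl] at h1 h3 h4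
      linear_combination h1 + h3 + h4 + ih - h2 (b i (-k)) - h2 (b (i - 1) (-k)) - h2 (V (i, -k - 1))

lemma sum_curl (H V : ℤ × ℤ → ZMod 2) (hH : H.support.Finite) (hV : V.support.Finite) :
    ∑ᶠ x, curl H V x = 0 := by
  have h2 : ∀ a : ZMod 2, a + a = 0 := CharTwo.add_self_eq_zero
  let e1 : ℤ × ℤ ≃ ℤ × ℤ := (Equiv.subRight (1 : ℤ)).prodCongr (Equiv.refl ℤ)
  let e2 : ℤ × ℤ ≃ ℤ × ℤ := (Equiv.refl ℤ).prodCongr (Equiv.subRight (1 : ℤ))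
  have hH1 : (Function.support fun x => H (e1 x)).Finite := hH.preimage e1.injective.injOn
  have hV1 : (Function.support fun x => V (e2 x)).Finite := hV.preimage e2.injective.injOn
  have : (fun x => curl H V x) = fun x => (H x + H (e1 x)) + (V x + V (e2 x)) := by
    funext x; simp only [curl, e1, e2, Equiv.prodCongr_apply, Prod.map, Equiv.subRight_apply, Equiv.refl_apply]; ring
  rw [this, finsum_add_distrib, finsum_add_distrib hH hH1, finsum_add_distrib hV hV1,
    finsum_comp_equiv e1, finsum_comp_equiv e2, h2, h2, add_zero]
  · exact (hH.union hH1).subset (Function.support_add _ _)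
  · exact (hV.union hV1).subset (Function.support_add _ _)

/-- one-chain along C-edges. -/
def OnC (C : Set (ℤ × ℤ)) (H V : ℤ × ℤ → ZMod 2) : Prop :=
  (∀ i j, ¬ ((i, j) ∈ C ∧ (i + 1, j) ∈ C) → H (i, j) = 0) ∧
  (∀ i j, ¬ ((i, j) ∈ C ∧ (i, j + 1) ∈ C) → V (i, j) = 0)

def dl (x : ℤ × ℤ) : ℤ × ℤ → ZMod 2 := fun y => if y = x then 1 else 0

lemma edge_chain {C : Set (ℤ × ℤ)} {x y : ℤ × ℤ} (hx : x ∈ C) (hy : y ∈ C) (h : adj x y) :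
    ∃ H V, OnC C H V ∧ ∀ z, curl H V z = dl x z + dl y z := by
  obtain ⟨a, b⟩ := x
  obtain ⟨c, d⟩ := y
  have h' : (c = a + 1 ∧ d = b) ∨ (a = c + 1 ∧ d = b) ∨ (c = a ∧ d = b + 1) ∨ (c = a ∧ b = d + 1) := by
    simp only [adj] at h
    rcases abs_cases (a - c) with h1 | h1 <;> rcases abs_cases (b - d) with h3 | h3 <;> omega
  rcases h' with ⟨rfl, rfl⟩ | ⟨rfl, rfl⟩ | ⟨rfl, rfl⟩ | ⟨rfl, rfl⟩
  · refine ⟨dl (a, d), 0, ⟨fun i j hij => ?_, fun _ _ _ => rfl⟩, fun z => ?_⟩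
    · simp only [dl, Prod.mk.injEq, ite_eq_right_iff]; rintro ⟨rfl, rfl⟩; exact absurd ⟨hx, hy⟩ hij
    · simp only [curl, dl, Prod.ext_iff, sub_eq_iff_eq_add, Pi.zero_apply, add_zero]
  · refine ⟨dl (c, d), 0, ⟨fun i j hij => ?_, fun _ _ _ => rfl⟩, fun z => ?_⟩
    · simp only [dl, Prod.mk.injEq, ite_eq_right_iff]; rintro ⟨rfl, rfl⟩; exact absurd ⟨hy, hx⟩ hij
    · simp only [curl, dl, Prod.ext_iff, sub_eq_iff_eq_add, Pi.zero_apply, add_zero]; ring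
  · refine ⟨0, dl (c, b), ⟨fun _ _ _ => rfl, fun i j hij => ?_⟩, fun z => ?_⟩
    · simp only [dl, Prod.mk.injEq, ite_eq_right_iff]; rintro ⟨rfl, rfl⟩; exact absurd ⟨hx, hy⟩ hij
    · simp only [curl, dl, Prod.ext_iff, sub_eq_iff_eq_add, Pi.zero_apply, zero_add]
  · refine ⟨0, dl (c, d), ⟨fun _ _ _ => rfl, fun i j hij => ?_⟩, fun z => ?_⟩
    · simp only [dl, Prod.mk.injEq, ite_eq_right_iff]; rintro ⟨rfl, rfl⟩; exact absurd ⟨hy, hx⟩ hij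
    · simp only [curl, dl, Prod.ext_iff, sub_eq_iff_eq_add, Pi.zero_apply, zero_add]; ring

lemma OnC.add {C : Set (ℤ × ℤ)} {H V H' V'} (h : OnC C H V) (h' : OnC C H' V') : OnC C (H + H') (V + V') :=
  ⟨fun i j hij => by simp [h.1 i j hij, h'.1 i j hij], fun i j hij => by simp [h.2 i j hij, h'.2 i j hij]⟩

lemma path_chain {C : Set (ℤ × ℤ)} (hC : LatticeConnected C) {x y : ℤ × ℤ} (hx : x ∈ C) (hy : y ∈ C) :
    ∃ H V, OnC C H V ∧ ∀ z, curl H V z = dl x z + dl y z := by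
  have h2 : ∀ a : ZMod 2, a + a = 0 := CharTwo.add_self_eq_zero
  obtain ⟨n, p, hp0, hpn, hpC, hpa⟩ := hC x hx y hy
  have : ∀ k ≤ n, ∃ H V, OnC C H V ∧ ∀ z, curl H V z = dl x z + dl (p k) z := by
    intro k
    induction k with
    | zero => 
      intro _
      refine ⟨0, 0, ⟨fun _ _ _ => rfl, fun _ _ _ => rfl⟩, fun z => ?_⟩
      rw [hp0, h2]; simp [curl]
    | succ k ih =>
      intro hk
      obtain ⟨H, V, h1, h3⟩ := ih (by omega)
      obtain ⟨H', V', h1', h3'⟩ := edge_chain (hpC k (by omega)) (hpC (k + 1) hk) (hpa k (by omega))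
      refine ⟨H + H', V + V', h1.add h1', fun z => ?_⟩
      rw [curl_add, h3, h3']
      linear_combination h2 (dl (p k) z)
  simpa [hpn] using this n le_rfl

lemma potential_off {C : Set (ℤ × ℤ)} (hfin : C.Finite) (hC : LatticeConnected C)
    (H V : ℤ × ℤ → ZMod 2) (hH : H.support.Finite) (hV : V.support.Finite)
    (hc : ∀ x, x ∉ C → curl H V x = 0) :
    ∃ ε : ℤ × ℤ → ZMod 2, (∀ i j, ¬ ((i, j) ∈ C ∧ (i + 1, j) ∈ C) → ε (i, j) + ε (i, j - 1) = H (i, j)) ∧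
      ∀ i j, ¬ ((i, j) ∈ C ∧ (i, j + 1) ∈ C) → ε (i, j) + ε (i - 1, j) = V (i, j) := by
  have h2 : ∀ a : ZMod 2, a + a = 0 := CharTwo.add_self_eq_zero
  suffices h : ∃ H' V', OnC C H' V' ∧ ∀ x, curl H' V' x = curl H V x by
    obtain ⟨H', V', h1, h3⟩ := h
    obtain ⟨ε, e1, e2⟩ := exact_of_curl (H + H') (V + V') (fun x => by rw [curl_add, h3, h2])
    refine ⟨ε, fun i j hij => ?_, fun i j hij => ?_⟩
    · rw [e1]; simp [h1.1 i j hij]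
    · rw [e2]; simp [h1.2 i j hij]
  rcases C.eq_empty_or_nonempty with rfl | ⟨x0, hx0⟩
  · exact ⟨0, 0, ⟨fun _ _ _ => rfl, fun _ _ _ => rfl⟩, fun x => by rw [hc x (by simp)]; simp [curl]⟩
  set K := hfin.toFinset
  have hsum : ∑ x ∈ K, curl H V x = 0 := by
    rw [← sum_curl H V hH hV, finsum_eq_sum_of_support_subset]
    intro x hx
    by_contra h
    exact hx (hc x (by simpa [K] using h))
  have key : ∀ T : Finset (ℤ × ℤ), ↑T ⊆ C → ∃ H' V', OnC C H' V' ∧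
      ∀ z, curl H' V' z = ∑ x ∈ T, curl H V x * (dl x z + dl x0 z) := by
    intro T
    induction T using Finset.induction_on with
    | empty => exact fun _ => ⟨0, 0, ⟨fun _ _ _ => rfl, fun _ _ _ => rfl⟩, fun x => by simp [curl]⟩
    | insert a T ha ih =>
      intro hT
      rw [Finset.coe_insert, Set.insert_subset_iff] at hT
      obtain ⟨H', V', h1, h3⟩ := ih hT.2
      by_cases hca : curl H V a = 0
      · refine ⟨H', V', h1, fun z => ?_⟩
        rw [h3, Finset.sum_insert ha, hca, zero_mul, zero_add]
      · have hca1 : curl H V a = 1 := by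
          revert hca
          generalize curl H V a = t
          revert t; decide
        obtain ⟨H'', V'', g1, g3⟩ := path_chain hC hT.1 hx0
        refine ⟨H'' + H', V'' + V', g1.add h1, fun z => ?_⟩
        rw [curl_add, h3, Finset.sum_insert ha, hca1, one_mul, g3]
  obtain ⟨H', V', h1, h3⟩ := key K (by simp [K])
  refine ⟨H', V', h1, fun z => ?_⟩
  rw [h3]
  simp only [mul_add, Finset.sum_add_distrib, ← Finset.sum_mul, hsum, zero_mul, add_zero]
  by_cases hz : z ∈ C
  · simp [dl, K, hz]
  · simp [dl, K, hz, hc z hz]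

def pt (x : ℤ × ℤ) : ℂ := ⟨x.1, x.2⟩

def Ct (C : Set (ℤ × ℤ)) : Set ℂ := {z | ∃ c ∈ C, (z.re = c.1 ∧ z.im = c.2) ∨
  ((c.1 + 1, c.2) ∈ C ∧ z.im = c.2 ∧ (c.1 : ℝ) ≤ z.re ∧ z.re ≤ c.1 + 1) ∨
  ((c.1, c.2 + 1) ∈ C ∧ z.re = c.1 ∧ (c.2 : ℝ) ≤ z.im ∧ z.im ≤ c.2 + 1)}

lemma Ct_closed {C : Set (ℤ × ℤ)} (hC : C.Finite) : IsClosed (Ct C) := by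
  have : Ct C = ⋃ c ∈ C, {z : ℂ | (z.re = c.1 ∧ z.im = c.2) ∨
    ((c.1 + 1, c.2) ∈ C ∧ z.im = c.2 ∧ (c.1 : ℝ) ≤ z.re ∧ z.re ≤ c.1 + 1) ∨
    ((c.1, c.2 + 1) ∈ C ∧ z.re = c.1 ∧ (c.2 : ℝ) ≤ z.im ∧ z.im ≤ c.2 + 1)} := by
    ext z; simp only [Ct, mem_ofPred_eq, mem_iUnion, exists_prop]
  rw [this]
  refine hC.isClosed_biUnion fun c _ => ?_
  have hr := Complex.continuous_re
  have hi := Complex.continuous_im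
  refine ((isClosed_eq hr continuous_const).inter (isClosed_eq hi continuous_const)).union (IsClosed.union ?_ ?_)
  · by_cases h : (c.1 + 1, c.2) ∈ C
    · simp only [h, true_and]
      exact (isClosed_eq hi continuous_const).inter
        ((isClosed_le continuous_const hr).inter (isClosed_le hr continuous_const))
    · simp only [h, false_and]; exact isClosed_empty
  · by_cases h : (c.1, c.2 + 1) ∈ C
    · simp only [h, true_and]
      exact (isClosed_eq hr continuous_const).inter
        ((isClosed_le continuous_const hi).inter (isClosed_le hi continuous_const))
    · simp only [h, false_and]; exact isClosed_empty

lemma Ct_near {C : Set (ℤ × ℤ)} {z : ℂ} (hz : z ∈ Ct C) : ∃ c ∈ C, ‖z - pt c‖ ≤ 1 / 2 := by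
  have key : ∀ c : ℤ × ℤ, ∀ a b : ℝ, |a| + |b| ≤ 1 / 2 → z.re - c.1 = a → z.im - c.2 = b → ‖z - pt c‖ ≤ 1 / 2 := by
    intro c a b h h1 h2
    refine (Complex.norm_le_abs_re_add_abs_im _).trans ?_
    simpa [pt, h1, h2] using h
  obtain ⟨c, hc, h | ⟨h1, h2, h3, h4⟩ | ⟨h1, h2, h3, h4⟩⟩ := hz
  · exact ⟨c, hc, key c 0 0 (by norm_num) (by linarith [h.1]) (by linarith [h.2])⟩
  · rcases le_total z.re (c.1 + 1 / 2) with h | h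
    · exact ⟨c, hc, key c _ 0 (by rw [abs_of_nonneg] <;> norm_num <;> linarith) rfl (by linarith)⟩
    · refine ⟨_, h1, key _ (z.re - c.1 - 1) 0 (by rw [abs_of_nonpos] <;> norm_num <;> linarith) ?_ (by simp [h2])⟩
      push_cast; ring
  · rcases le_total z.im (c.2 + 1 / 2) with h | h
    · exact ⟨c, hc, key c 0 _ (by rw [abs_of_nonneg (a := z.im - c.2)] <;> norm_num <;> linarith) (by linarith) rfl⟩
    · refine ⟨_, h1, key _ 0 (z.im - c.2 - 1) (by rw [abs_of_nonpos (a := z.im - c.2 - 1)] <;> norm_num <;> linarith) (by simp [h2]) ?_⟩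
      push_cast; ring

lemma pt_mem_Ct {C : Set (ℤ × ℤ)} {c : ℤ × ℤ} (hc : c ∈ C) : pt c ∈ Ct C := ⟨c, hc, Or.inl ⟨rfl, rfl⟩⟩

def rc (a b c d : ℤ) : Set ℂ := {z | (a : ℝ) < z.re ∧ z.re < b ∧ (c : ℝ) < z.im ∧ z.im < d}

lemma rc_eq (a b c d : ℤ) : rc a b c d = (({z : ℂ | (a : ℝ) < z.re} ∩ {z | z.re < b}) ∩
    ({z | (c : ℝ) < z.im} ∩ {z | z.im < d})) := by
  ext z; simp [rc, and_assoc]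

lemma rc_convex (a b c d : ℤ) : Convex ℝ (rc a b c d) := by
  rw [rc_eq]
  exact ((convex_halfSpace_re_gt _).inter (convex_halfSpace_re_lt _)).inter
    ((convex_halfSpace_im_gt _).inter (convex_halfSpace_im_lt _))

lemma rc_open (a b c d : ℤ) : IsOpen (rc a b c d) := by
  rw [rc_eq]
  have hr := Complex.continuous_re
  have hi := Complex.continuous_im
  exact ((isOpen_lt continuous_const hr).inter (isOpen_lt hr continuous_const)).inter
    ((isOpen_lt continuous_const hi).inter (isOpen_lt hi continuous_const))

lemma rc_mono {a b c d a' b' c' d' : ℤ} (h1 : a' ≤ a) (h2 : b ≤ b') (h3 : c' ≤ c) (h4 : d ≤ d') :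
    rc a b c d ⊆ rc a' b' c' d' := by
  intro z ⟨k1, k2, k3, k4⟩
  have g1 : (a' : ℝ) ≤ a := by exact_mod_cast h1
  have g2 : (b : ℝ) ≤ b' := by exact_mod_cast h2
  have g3 : (c' : ℝ) ≤ c := by exact_mod_cast h3
  have g4 : (d : ℝ) ≤ d' := by exact_mod_cast h4
  exact ⟨by linarith, by linarith, by linarith, by linarith⟩

def face (Q : ℤ × ℤ) : Set ℂ := rc Q.1 (Q.1 + 1) Q.2 (Q.2 + 1)

lemma face_nonempty (Q : ℤ × ℤ) : (face Q).Nonempty :=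
  ⟨⟨Q.1 + 1 / 2, Q.2 + 1 / 2⟩, by simp [face, rc]; norm_num⟩

lemma rcH_sub {C : Set (ℤ × ℤ)} {i j : ℤ} (h : ¬ ((i, j) ∈ C ∧ (i + 1, j) ∈ C)) :
    rc i (i + 1) (j - 1) (j + 1) ⊆ (Ct C)ᶜ := by
  rintro z ⟨k1, k2, k3, k4⟩ ⟨⟨a, b⟩, hc, ⟨h1, h2⟩ | ⟨h1, h2, h3, h4⟩ | ⟨h1, h2, h3, h4⟩⟩
  · simp only at h1
    rw [h1] at k1 k2; norm_cast at k1 k2; omega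
  · simp only at h1 h2 h3 h4
    have e1 := h3.trans_lt k2
    have e2 := k1.trans_le h4
    rw [h2] at k3 k4
    norm_cast at k3 k4 e1 e2
    obtain rfl : a = i := by omega
    obtain rfl : b = j := by omega
    exact h ⟨hc, h1⟩
  · simp only at h2
    rw [h2] at k1 k2; norm_cast at k1 k2; omega

lemma rcV_sub {C : Set (ℤ × ℤ)} {i j : ℤ} (h : ¬ ((i, j) ∈ C ∧ (i, j + 1) ∈ C)) :
    rc (i - 1) (i + 1) j (j + 1) ⊆ (Ct C)ᶜ := by
  rintro z ⟨k1, k2, k3, k4⟩ ⟨⟨a, b⟩, hc, ⟨h1, h2⟩ | ⟨h1, h2, h3, h4⟩ | ⟨h1, h2, h3, h4⟩⟩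
  · simp only at h2
    rw [h2] at k3 k4; norm_cast at k3 k4; omega
  · simp only at h2
    rw [h2] at k3 k4; norm_cast at k3 k4; omega
  · simp only at h1 h2 h3 h4
    have e1 := h3.trans_lt k4
    have e2 := k3.trans_le h4
    rw [h2] at k1 k2
    norm_cast at k1 k2 e1 e2
    obtain rfl : a = i := by omega
    obtain rfl : b = j := by omega
    exact h ⟨hc, h1⟩

lemma rcX_sub {C : Set (ℤ × ℤ)} {i j : ℤ} (h : (i, j) ∉ C) :
    rc (i - 1) (i + 1) (j - 1) (j + 1) ⊆ (Ct C)ᶜ := by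
  rintro z ⟨k1, k2, k3, k4⟩ ⟨⟨a, b⟩, hc, ⟨h1, h2⟩ | ⟨h1, h2, h3, h4⟩ | ⟨h1, h2, h3, h4⟩⟩
  · simp only at h1 h2
    rw [h1] at k1 k2; rw [h2] at k3 k4; norm_cast at k1 k2 k3 k4
    obtain rfl : a = i := by omega
    obtain rfl : b = j := by omega
    exact h hc
  · simp only at h1 h2 h3 h4
    have e1 := h3.trans_lt k2
    have e2 := k1.trans_le h4
    rw [h2] at k3 k4
    norm_cast at k3 k4 e1 e2
    obtain rfl : b = j := by omega
    rcases (show a = i ∨ a + 1 = i by omega) with rfl | rfl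
    · exact h hc
    · exact h h1
  · simp only at h1 h2 h3 h4
    have e1 := h3.trans_lt k4
    have e2 := k3.trans_le h4
    rw [h2] at k1 k2
    norm_cast at k1 k2 e1 e2
    obtain rfl : a = i := by omega
    rcases (show b = j ∨ b + 1 = j by omega) with rfl | rfl
    · exact h hc
    · exact h h1

lemma face_sub (C : Set (ℤ × ℤ)) (Q : ℤ × ℤ) : face Q ⊆ (Ct C)ᶜ := by
  rintro z ⟨k1, k2, k3, k4⟩ ⟨⟨a, b⟩, hc, ⟨h1, h2⟩ | ⟨h1, h2, h3, h4⟩ | ⟨h1, h2, h3, h4⟩⟩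
  · simp only at h1
    rw [h1] at k1 k2; norm_cast at k1 k2; omega
  · simp only at h2
    rw [h2] at k3 k4; norm_cast at k3 k4; omega
  · simp only at h2
    rw [h2] at k1 k2; norm_cast at k1 k2; omega

def sg (a : ZMod 2) : ℂ := if a = 0 then 1 else -1

lemma sg_add (a b : ZMod 2) : sg (a + b) = sg a * sg b := by
  have : ∀ a b : ZMod 2, (a + b = 0 ↔ (a = 0 ↔ b = 0)) := by decide
  simp only [sg, this]
  by_cases ha : a = 0 <;> by_cases hb : b = 0 <;> simp [ha, hb]
lemma sg_sq (a : ZMod 2) : sg a ^ 2 = 1 := by unfold sg; split_ifs <;> norm_num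
lemma sg_mul_self (a : ZMod 2) : sg a * sg a = 1 := by rw [← sq, sg_sq]
lemma sg_inj {a b : ZMod 2} (h : sg a = sg b) : a = b := by
  have : ∀ a b : ZMod 2, (a = 0 ↔ b = 0) → a = b := by decide
  apply this
  unfold sg at h
  split_ifs at h <;> simp_all <;> norm_num [Complex.ext_iff] at h

lemma sqrt_convex {O : Set ℂ} (ho : IsOpen O) (hc : Convex ℝ O) {h : ℂ → ℂ} (hh : ContinuousOn h O)
    (h0 : ∀ z ∈ O, h z ≠ 0) : ∃ r : ℂ → ℂ, ContinuousOn r O ∧ ∀ z, r z ^ 2 = h z := by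
  rcases O.eq_empty_or_nonempty with rfl | hne
  · obtain ⟨r, hr⟩ : ∃ r : ℂ → ℂ, ∀ z, r z ^ 2 = h z := by
      choose r hr using fun z => IsAlgClosed.exists_pow_nat_eq (h z) (n := 2) (by norm_num)
      exact ⟨r, hr⟩
    exact ⟨r, continuousOn_empty _, hr⟩
  · have := hc.contractibleSpace hne
    have hs : IsSimplyConnected O := (inferInstance : SimplyConnectedSpace O)
    exact Complex.exists_continuousOn_pow_eq hs ho hh (by rintro ⟨z, hz, h⟩; exact h0 z hz h) two_ne_zero

lemma sqrt_cmp {O : Set ℂ} (hO : IsPreconnected O) {r1 r2 h : ℂ → ℂ} (h1 : ContinuousOn r1 O)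
    (h2 : ContinuousOn r2 O) (e1 : ∀ z ∈ O, r1 z ^ 2 = h z) (e2 : ∀ z ∈ O, r2 z ^ 2 = h z)
    (h0 : ∀ z ∈ O, h z ≠ 0) : ∃ a, ∀ z ∈ O, r1 z = sg a * r2 z := by
  rcases hO.eq_or_eq_neg_of_sq_eq h1 h2 (fun z hz => by simp [e1 z hz, e2 z hz]) (fun {z} hz h => by
    apply h0 z hz; rw [← e2 z hz, h]; simp) with h | h
  · exact ⟨0, fun z hz => by simp [sg, h hz]⟩
  · exact ⟨1, fun z hz => by simp [sg, h hz]⟩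

lemma dense_frac : Dense {z : ℂ | (∀ n : ℤ, z.re ≠ n) ∧ ∀ n : ℤ, z.im ≠ n} := by
  intro z
  rw [Metric.mem_closure_iff]
  intro ε hε
  have hirr : ∀ x : ℝ, ∃ y, |x - y| < ε / 2 ∧ ∀ n : ℤ, y ≠ n := by
    intro x
    obtain ⟨y, hy, h1, h2⟩ := dense_irrational.exists_between (show x < x + ε / 2 by linarith)
    exact ⟨y, by rw [abs_lt]; constructor <;> linarith, fun n => hy.ne_int n⟩
  obtain ⟨a, ha, ha'⟩ := hirr z.re
  obtain ⟨b, hb, hb'⟩ := hirr z.im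
  refine ⟨⟨a, b⟩, ⟨ha', hb'⟩, ?_⟩
  rw [dist_eq_norm]
  refine (Complex.norm_le_abs_re_add_abs_im _).trans_lt ?_
  simp only [Complex.sub_re, Complex.sub_im]
  linarith

def fl (z : ℂ) : ℤ × ℤ := (⌊z.re⌋, ⌊z.im⌋)

lemma mem_face_fl {z : ℂ} (hz : (∀ n : ℤ, z.re ≠ n) ∧ ∀ n : ℤ, z.im ≠ n) : z ∈ face (fl z) := by
  refine ⟨lt_of_le_of_ne (Int.floor_le _) fun h => hz.1 _ h.symm, ?_, lt_of_le_of_ne (Int.floor_le _) fun h => hz.2 _ h.symm, ?_⟩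
  · push_cast; exact Int.lt_floor_add_one _
  · push_cast; exact Int.lt_floor_add_one _

lemma fl_rc {z : ℂ} {a b c d : ℤ} (hz : z ∈ rc a b c d) :
    a ≤ ⌊z.re⌋ ∧ ⌊z.re⌋ < b ∧ c ≤ ⌊z.im⌋ ∧ ⌊z.im⌋ < d :=
  ⟨Int.le_floor.2 hz.1.le, Int.floor_lt.2 hz.2.1, Int.le_floor.2 hz.2.2.1.le, Int.floor_lt.2 hz.2.2.2⟩

lemma ext_finite (M : ℝ) (k : ℤ) : {x : ℤ × ℤ | ¬ rc (x.1 - 1) (x.1 + 1) (x.2 - 1) (x.2 + 1) ⊆ {z : ℂ | M < ‖z‖}}.Finite := by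
  have hf : (Icc (-⌈M⌉ - 1) (⌈M⌉ + 1) ×ˢ Icc (-⌈M⌉ - 1) (⌈M⌉ + 1) : Set (ℤ × ℤ)).Finite :=
    (finite_Icc _ _).prod (finite_Icc _ _)
  refine hf.subset ?_
  rintro ⟨a, b⟩ h
  obtain ⟨z, ⟨h1, h2, h3, h4⟩, hz⟩ := not_subset.1 h
  have hz' : ‖z‖ ≤ M := not_lt.1 hz
  have hr := abs_le.1 ((Complex.abs_re_le_norm z).trans hz')
  have hi := abs_le.1 ((Complex.abs_im_le_norm z).trans hz')
  have hM := Int.le_ceil M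
  push_cast at h1 h2 h3 h4
  have k1 : (a : ℝ) < ⌈M⌉ + 1 := by linarith
  have k2 : -(⌈M⌉ : ℝ) - 1 < a := by linarith
  have k3 : (b : ℝ) < ⌈M⌉ + 1 := by linarith
  have k4 : -(⌈M⌉ : ℝ) - 1 < b := by linarith
  norm_cast at k1 k2 k3 k4
  refine ⟨⟨?_, ?_⟩, ⟨?_, ?_⟩⟩ <;> simp only <;> omega

theorem sqrt_offC {C : Set (ℤ × ℤ)} (hfin : C.Finite) (hC : LatticeConnected C) {h : ℂ → ℂ}
    (hc : ContinuousOn h (Ct C)ᶜ) (h0 : ∀ z ∈ (Ct C)ᶜ, h z ≠ 0)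
    {M : ℝ} {s0 : ℂ → ℂ} (hs0 : ContinuousOn s0 {z | M < ‖z‖}) (hs0' : ∀ z, M < ‖z‖ → s0 z ^ 2 = h z) :
    ∃ σ : ℂ → ℂ, ContinuousOn σ (Ct C)ᶜ ∧ ∀ z ∈ (Ct C)ᶜ, σ z ^ 2 = h z := by
  have h2 : ∀ a : ZMod 2, a + a = 0 := CharTwo.add_self_eq_zero
  -- the face roots
  have hs : ∀ Q, ∃ s : ℂ → ℂ, ContinuousOn s (face Q) ∧ (∀ z ∈ face Q, s z ^ 2 = h z) ∧
      (face Q ⊆ {z | M < ‖z‖} → s = s0) := by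
    intro Q
    by_cases hQ : face Q ⊆ {z | M < ‖z‖}
    · exact ⟨s0, hs0.mono hQ, fun z hz => hs0' z (hQ hz), fun _ => rfl⟩
    · obtain ⟨r, hr1, hr2⟩ := sqrt_convex (rc_open _ _ _ _) (rc_convex _ _ _ _) (hc.mono (face_sub C Q))
        (fun z hz => h0 z (face_sub C Q hz))
      exact ⟨r, hr1, fun z _ => hr2 z, fun h => absurd h hQ⟩
  choose s hsc hss hse using hs
  have hfacepre : ∀ Q, IsPreconnected (face Q) := fun Q => (rc_convex _ _ _ _).isPreconnected
  -- roots on convex sets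
  have hex : ∀ O : Set ℂ, IsOpen O → Convex ℝ O → O ⊆ (Ct C)ᶜ → ∃ (r : ℂ → ℂ) (a : ℤ × ℤ → ZMod 2),
      ContinuousOn r O ∧ (∀ z ∈ O, r z ^ 2 = h z) ∧ ∀ Q, face Q ⊆ O → ∀ z ∈ face Q, s Q z = sg (a Q) * r z := by
    intro O hO hcv hE
    obtain ⟨r, hr1, hr2⟩ := sqrt_convex hO hcv (hc.mono hE) (fun z hz => h0 z (hE hz))
    have : ∀ Q, ∃ a, face Q ⊆ O → ∀ z ∈ face Q, s Q z = sg a * r z := by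
      intro Q
      by_cases hQ : face Q ⊆ O
      · obtain ⟨a, ha⟩ := sqrt_cmp (hfacepre Q) (hsc Q) (hr1.mono hQ) (hss Q) (fun z _ => hr2 z)
          (fun z hz => h0 z (face_sub C Q hz))
        exact ⟨a, fun _ => ha⟩
      · exact ⟨0, fun h => absurd h hQ⟩
    choose a ha using this
    exact ⟨r, a, hr1, fun z _ => hr2 z, ha⟩
  have huniq : ∀ (Q Q' : ℤ × ℤ) (O1 O2 : Set ℂ) (r1 r2 : ℂ → ℂ) (a1 a2 b1 b2 : ZMod 2),
      Convex ℝ O1 → Convex ℝ O2 → O1 ⊆ (Ct C)ᶜ → face Q ⊆ O1 → face Q' ⊆ O1 → face Q ⊆ O2 → face Q' ⊆ O2 →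
      ContinuousOn r1 O1 → ContinuousOn r2 O2 → (∀ z ∈ O1, r1 z ^ 2 = h z) → (∀ z ∈ O2, r2 z ^ 2 = h z) →
      (∀ z ∈ face Q, s Q z = sg a1 * r1 z) → (∀ z ∈ face Q, s Q z = sg a2 * r2 z) →
      (∀ z ∈ face Q', s Q' z = sg b1 * r1 z) → (∀ z ∈ face Q', s Q' z = sg b2 * r2 z) →
      a1 + b1 = a2 + b2 := by
    intro Q Q' O1 O2 r1 r2 a1 a2 b1 b2 c1 c2 hE q1 q1' q2 q2' k1 k2 e1 e2 A1 A2 B1 B2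
    obtain ⟨m, hm⟩ := sqrt_cmp (O := O1 ∩ O2) (c1.inter c2).isPreconnected (k1.mono inter_subset_left)
      (k2.mono inter_subset_right) (fun z hz => e1 z hz.1) (fun z hz => e2 z hz.2) (fun z hz => h0 z (hE hz.1))
    have key : ∀ (P : ℤ × ℤ) (a b : ZMod 2), face P ⊆ O1 → face P ⊆ O2 → (∀ z ∈ face P, s P z = sg a * r1 z) →
        (∀ z ∈ face P, s P z = sg b * r2 z) → a + m = b := by
      intro P a b p1 p2 ha hb
      obtain ⟨z, hz⟩ := face_nonempty P
      have h1 := ha z hz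
      rw [hb z hz, hm z ⟨p1 hz, p2 hz⟩, ← mul_assoc, ← sg_add] at h1
      have hr : r2 z ≠ 0 := fun h' => h0 z (hE (p1 hz)) (by rw [← e2 z (p2 hz), h']; simp)
      exact (sg_inj (mul_right_cancel₀ hr h1)).symm
    have f1 := key Q a1 a2 q1 q2 A1 A2
    have f2 := key Q' b1 b2 q1' q2' B1 B2
    linear_combination f1 + f2 - h2 m
  -- edges
  have hH : ∀ x : ℤ × ℤ, ∃ t : ZMod 2, ¬ ((x.1, x.2) ∈ C ∧ (x.1 + 1, x.2) ∈ C) → ∃ (r : ℂ → ℂ) (a b : ZMod 2),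
      ContinuousOn r (rc x.1 (x.1 + 1) (x.2 - 1) (x.2 + 1)) ∧
      (∀ z ∈ rc x.1 (x.1 + 1) (x.2 - 1) (x.2 + 1), r z ^ 2 = h z) ∧ (∀ z ∈ face x, s x z = sg a * r z) ∧
      (∀ z ∈ face (x.1, x.2 - 1), s (x.1, x.2 - 1) z = sg b * r z) ∧ a + b = t := by
    rintro ⟨i, j⟩
    by_cases hx : ((i, j) ∈ C ∧ (i + 1, j) ∈ C)
    · exact ⟨0, fun h => absurd hx h⟩
    obtain ⟨r, a, e1, e2, e3⟩ := hex _ (rc_open _ _ _ _) (rc_convex _ _ _ _) (rcH_sub hx)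
    exact ⟨_, fun _ => ⟨r, _, _, e1, e2, e3 (i, j) (rc_mono (by simp) (by simp) (by simp) (by simp)),
      e3 (i, j - 1) (rc_mono (by simp) (by simp) (by simp) (by simp)), rfl⟩⟩
  have hV : ∀ x : ℤ × ℤ, ∃ t : ZMod 2, ¬ ((x.1, x.2) ∈ C ∧ (x.1, x.2 + 1) ∈ C) → ∃ (r : ℂ → ℂ) (a b : ZMod 2),
      ContinuousOn r (rc (x.1 - 1) (x.1 + 1) x.2 (x.2 + 1)) ∧
      (∀ z ∈ rc (x.1 - 1) (x.1 + 1) x.2 (x.2 + 1), r z ^ 2 = h z) ∧ (∀ z ∈ face x, s x z = sg a * r z) ∧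
      (∀ z ∈ face (x.1 - 1, x.2), s (x.1 - 1, x.2) z = sg b * r z) ∧ a + b = t := by
    rintro ⟨i, j⟩
    by_cases hx : ((i, j) ∈ C ∧ (i, j + 1) ∈ C)
    · exact ⟨0, fun h => absurd hx h⟩
    obtain ⟨r, a, e1, e2, e3⟩ := hex _ (rc_open _ _ _ _) (rc_convex _ _ _ _) (rcV_sub hx)
    exact ⟨_, fun _ => ⟨r, _, _, e1, e2, e3 (i, j) (rc_mono (by simp) (by simp) (by simp) (by simp)),
      e3 (i - 1, j) (rc_mono (by simp) (by simp) (by simp) (by simp)), rfl⟩⟩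
  choose H0 hH0 using hH
  choose V0 hV0 using hV
  set H : ℤ × ℤ → ZMod 2 := fun x => if ((x.1, x.2) ∈ C ∧ (x.1 + 1, x.2) ∈ C) then 0 else H0 x with hHdef
  set V : ℤ × ℤ → ZMod 2 := fun x => if ((x.1, x.2) ∈ C ∧ (x.1, x.2 + 1) ∈ C) then 0 else V0 x with hVdef
  have hHs : H.support.Finite := by
    refine (ext_finite M 0).subset ?_
    rintro ⟨i, j⟩ hx hsub
    simp only [hHdef, Function.mem_support, ne_eq, ite_eq_left_iff, not_forall] at hx
    obtain ⟨hx, hne⟩ := hx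
    apply hne
    obtain ⟨r, a, b, e1, e2, e3, e4, e5⟩ := hH0 (i, j) hx
    have hR : rc i (i + 1) (j - 1) (j + 1) ⊆ {z : ℂ | M < ‖z‖} :=
      (rc_mono (by simp) (by simp) (by simp) (by simp)).trans hsub
    have g1 : face (i, j) ⊆ rc i (i + 1) (j - 1) (j + 1) := rc_mono (by simp) (by simp) (by simp) (by simp)
    have g2 : face (i, j - 1) ⊆ rc i (i + 1) (j - 1) (j + 1) := rc_mono (by simp) (by simp) (by simp) (by simp)
    have := huniq (i, j) (i, j - 1) _ _ r s0 a 0 b 0 (rc_convex _ _ _ _) (rc_convex i (i + 1) (j - 1) (j + 1))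
      (rcH_sub hx) g1 g2 g1 g2
      e1 (hs0.mono hR) e2 (fun z hz => hs0' z (hR hz)) e3 (by simp [sg, hse _ (g1.trans hR)]) e4
      (by simp [sg, hse _ (g2.trans hR)])
    rw [← e5, this, add_zero]
  have hVs : V.support.Finite := by
    refine (ext_finite M 0).subset ?_
    rintro ⟨i, j⟩ hx hsub
    simp only [hVdef, Function.mem_support, ne_eq, ite_eq_left_iff, not_forall] at hx
    obtain ⟨hx, hne⟩ := hx
    apply hne
    obtain ⟨r, a, b, e1, e2, e3, e4, e5⟩ := hV0 (i, j) hx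
    have hR : rc (i - 1) (i + 1) j (j + 1) ⊆ {z : ℂ | M < ‖z‖} :=
      (rc_mono (by simp) (by simp) (by simp) (by simp)).trans hsub
    have g1 : face (i, j) ⊆ rc (i - 1) (i + 1) j (j + 1) := rc_mono (by simp) (by simp) (by simp) (by simp)
    have g2 : face (i - 1, j) ⊆ rc (i - 1) (i + 1) j (j + 1) := rc_mono (by simp) (by simp) (by simp) (by simp)
    have := huniq (i, j) (i - 1, j) _ _ r s0 a 0 b 0 (rc_convex _ _ _ _) (rc_convex (i - 1) (i + 1) j (j + 1))
      (rcV_sub hx) g1 g2 g1 g2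
      e1 (hs0.mono hR) e2 (fun z hz => hs0' z (hR hz)) e3 (by simp [sg, hse _ (g1.trans hR)]) e4
      (by simp [sg, hse _ (g2.trans hR)])
    rw [← e5, this, add_zero]
  -- H, V versus any convex set
  have hHO : ∀ i j, ∀ (O : Set ℂ) (r : ℂ → ℂ) (a : ℤ × ℤ → ZMod 2), ¬ ((i, j) ∈ C ∧ (i + 1, j) ∈ C) → Convex ℝ O →
      rc i (i + 1) (j - 1) (j + 1) ⊆ O → ContinuousOn r O → (∀ z ∈ O, r z ^ 2 = h z) →
      (∀ Q, face Q ⊆ O → ∀ z ∈ face Q, s Q z = sg (a Q) * r z) → H (i, j) = a (i, j) + a (i, j - 1) := by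
    intro i j O r a hx hO hsub hr1 hr2 ha
    obtain ⟨r', a', b', e1, e2, e3, e4, e5⟩ := hH0 (i, j) hx
    have g1 : face (i, j) ⊆ rc i (i + 1) (j - 1) (j + 1) := rc_mono (by simp) (by simp) (by simp) (by simp)
    have g2 : face (i, j - 1) ⊆ rc i (i + 1) (j - 1) (j + 1) := rc_mono (by simp) (by simp) (by simp) (by simp)
    have := huniq (i, j) (i, j - 1) _ O r' r a' _ b' _ (rc_convex _ _ _ _) hO (rcH_sub hx) g1 g2 (g1.trans hsub) (g2.trans hsub)
      e1 hr1 e2 hr2 e3 (ha _ (g1.trans hsub)) e4 (ha _ (g2.trans hsub))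
    simp only [hHdef, if_neg hx]
    rw [← e5, this]
  have hVO : ∀ i j, ∀ (O : Set ℂ) (r : ℂ → ℂ) (a : ℤ × ℤ → ZMod 2), ¬ ((i, j) ∈ C ∧ (i, j + 1) ∈ C) → Convex ℝ O →
      rc (i - 1) (i + 1) j (j + 1) ⊆ O → ContinuousOn r O → (∀ z ∈ O, r z ^ 2 = h z) →
      (∀ Q, face Q ⊆ O → ∀ z ∈ face Q, s Q z = sg (a Q) * r z) → V (i, j) = a (i, j) + a (i - 1, j) := by
    intro i j O r a hx hO hsub hr1 hr2 ha
    obtain ⟨r', a', b', e1, e2, e3, e4, e5⟩ := hV0 (i, j) hx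
    have g1 : face (i, j) ⊆ rc (i - 1) (i + 1) j (j + 1) := rc_mono (by simp) (by simp) (by simp) (by simp)
    have g2 : face (i - 1, j) ⊆ rc (i - 1) (i + 1) j (j + 1) := rc_mono (by simp) (by simp) (by simp) (by simp)
    have := huniq (i, j) (i - 1, j) _ O r' r a' _ b' _ (rc_convex _ _ _ _) hO (rcV_sub hx) g1 g2 (g1.trans hsub) (g2.trans hsub)
      e1 hr1 e2 hr2 e3 (ha _ (g1.trans hsub)) e4 (ha _ (g2.trans hsub))
    simp only [hVdef, if_neg hx]
    rw [← e5, this]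
  have hcurl : ∀ x, x ∉ C → curl H V x = 0 := by
    rintro ⟨i, j⟩ hx
    obtain ⟨r, a, e1, e2, e3⟩ := hex _ (rc_open _ _ _ _) (rc_convex _ _ _ _) (rcX_sub hx)
    have k1 := hHO i j _ r a (fun h => hx h.1) (rc_convex _ _ _ _) (rc_mono (by simp) (by simp) (by simp) (by simp)) e1 e2 e3
    have k2 := hHO (i - 1) j _ r a (fun h => hx (by simpa using h.2)) (rc_convex _ _ _ _) (rc_mono (by simp) (by simp) (by simp) (by simp)) e1 e2 e3
    have k3 := hVO i j _ r a (fun h => hx h.1) (rc_convex _ _ _ _) (rc_mono (by simp) (by simp) (by simp) (by simp)) e1 e2 e3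
    have k4 := hVO i (j - 1) _ r a (fun h => hx (by simpa using h.2)) (rc_convex _ _ _ _) (rc_mono (by simp) (by simp) (by simp) (by simp)) e1 e2 e3
    simp only [curl]
    rw [k1, k2, k3, k4]
    linear_combination h2 (a (i, j)) + h2 (a (i, j - 1)) + h2 (a (i - 1, j)) + h2 (a (i - 1, j - 1))
  obtain ⟨ε, hεH, hεV⟩ := potential_off hfin hC H V hHs hVs hcurl
  set A : Set ℂ := {z : ℂ | (∀ n : ℤ, z.re ≠ n) ∧ ∀ n : ℤ, z.im ≠ n} with hA
  set σ0 : ℂ → ℂ := fun z => sg (ε (fl z)) * s (fl z) z with hσ0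
  have hglue : ∀ z ∈ (Ct C)ᶜ, ∃ (O : Set ℂ) (g : ℂ → ℂ), IsOpen O ∧ z ∈ O ∧ ContinuousOn g O ∧
      (∀ y ∈ O, g y ^ 2 = h y) ∧ ∀ y ∈ O ∩ A, σ0 y = g y := by
    intro z hz
    -- reduction to sign consistency
    have red : ∀ (a b c d : ℤ) (Q0 : ℤ × ℤ), z ∈ rc a b c d → rc a b c d ⊆ (Ct C)ᶜ →
        (∀ (r : ℂ → ℂ) (τ : ℤ × ℤ → ZMod 2), ContinuousOn r (rc a b c d) → (∀ z ∈ rc a b c d, r z ^ 2 = h z) →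
        (∀ Q, face Q ⊆ rc a b c d → ∀ z ∈ face Q, s Q z = sg (τ Q) * r z) →
        ∀ Q : ℤ × ℤ, a ≤ Q.1 ∧ Q.1 < b ∧ c ≤ Q.2 ∧ Q.2 < d → ε Q + τ Q = ε Q0 + τ Q0) →
        ∃ (O : Set ℂ) (g : ℂ → ℂ), IsOpen O ∧ z ∈ O ∧ ContinuousOn g O ∧
          (∀ y ∈ O, g y ^ 2 = h y) ∧ ∀ y ∈ O ∩ A, σ0 y = g y := by
      intro a b c d Q0 hzO hOE hcons
      obtain ⟨r, τ, e1, e2, e3⟩ := hex _ (rc_open a b c d) (rc_convex _ _ _ _) hOE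
      refine ⟨rc a b c d, fun y => sg (ε Q0 + τ Q0) * r y, rc_open _ _ _ _, hzO, continuousOn_const.mul e1, ?_, ?_⟩
      · intro y hy
        rw [mul_pow, sg_sq, one_mul, e2 y hy]
      · rintro y ⟨hy, hyA⟩
        have hf := fl_rc hy
        have := hcons r τ e1 e2 e3 (fl y) hf
        simp only [hσ0]
        rw [e3 (fl y) (rc_mono hf.1 hf.2.1 hf.2.2.1 hf.2.2.2) y (mem_face_fl hyA), ← mul_assoc, ← sg_add, this]
    by_cases hre : ∃ i : ℤ, z.re = i
    · obtain ⟨i, hi⟩ := hre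
      by_cases him : ∃ j : ℤ, z.im = j
      · obtain ⟨j, hj⟩ := him
        have hx : (i, j) ∉ C := fun h => hz ⟨(i, j), h, Or.inl ⟨hi, hj⟩⟩
        refine red (i - 1) (i + 1) (j - 1) (j + 1) (i, j) ?_ (rcX_sub hx) ?_
        · simp [rc, hi, hj]
        · intro r a e1 e2 e3
          have k1 := hHO i j _ r a (fun h => hx h.1) (rc_convex _ _ _ _) (rc_mono (by simp) (by simp) (by simp) (by simp)) e1 e2 e3
          have k2 := hHO (i - 1) j _ r a (fun h => hx (by simpa using h.2)) (rc_convex _ _ _ _) (rc_mono (by simp) (by simp) (by simp) (by simp)) e1 e2 e3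
          have k3 := hVO i j _ r a (fun h => hx h.1) (rc_convex _ _ _ _) (rc_mono (by simp) (by simp) (by simp) (by simp)) e1 e2 e3
          have l1 := hεH i j (fun h => hx h.1)
          have l2 := hεH (i - 1) j (fun h => hx (by simpa using h.2))
          have l3 := hεV i j (fun h => hx h.1)
          rw [k1] at l1
          rw [k2] at l2
          rw [k3] at l3
          rintro ⟨p, q⟩ hpq
          simp only at hpq
          rcases (show p = i ∨ p = i - 1 by omega) with hp | hp <;>
          rcases (show q = j ∨ q = j - 1 by omega) with hq | hq <;> rw [hp, hq]
          · linear_combination l1 + h2 (a (i, j - 1)) - h2 (ε (i, j))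
          · linear_combination l3 + h2 (a (i - 1, j)) - h2 (ε (i, j))
          · linear_combination l3 + l2 + h2 (a (i - 1, j - 1)) - h2 (ε (i, j)) - h2 (ε (i - 1, j)) + h2 (a (i - 1, j))
      · push_neg at him
        have hfj1 : ((⌊z.im⌋ : ℤ) : ℝ) < z.im := lt_of_le_of_ne (Int.floor_le _) (fun h => him _ h.symm)
        have hfj2 := Int.lt_floor_add_one z.im
        have hx : ¬ ((i, ⌊z.im⌋) ∈ C ∧ (i, ⌊z.im⌋ + 1) ∈ C) := fun h =>
          hz ⟨_, h.1, Or.inr (Or.inr ⟨h.2, hi, hfj1.le, hfj2.le⟩)⟩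
        refine red (i - 1) (i + 1) ⌊z.im⌋ (⌊z.im⌋ + 1) (i, ⌊z.im⌋) ?_ (rcV_sub hx) ?_
        · simp [rc, hi, hfj1]
        · intro r a e1 e2 e3
          have k3 := hVO i _ _ r a hx (rc_convex _ _ _ _) subset_rfl e1 e2 e3
          have l3 := hεV i _ hx
          rw [k3] at l3
          rintro ⟨p, q⟩ hpq
          simp only at hpq
          obtain rfl : q = ⌊z.im⌋ := by omega
          rcases (show p = i ∨ p = i - 1 by omega) with hp | hp <;> rw [hp]
          · linear_combination l3 + h2 (a (i - 1, ⌊z.im⌋)) - h2 (ε (i, ⌊z.im⌋))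
    · push_neg at hre
      have hfi1 : ((⌊z.re⌋ : ℤ) : ℝ) < z.re := lt_of_le_of_ne (Int.floor_le _) (fun h => hre _ h.symm)
      have hfi2 := Int.lt_floor_add_one z.re
      by_cases him : ∃ j : ℤ, z.im = j
      · obtain ⟨j, hj⟩ := him
        have hx : ¬ ((⌊z.re⌋, j) ∈ C ∧ (⌊z.re⌋ + 1, j) ∈ C) := fun h =>
          hz ⟨_, h.1, Or.inr (Or.inl ⟨h.2, hj, hfi1.le, hfi2.le⟩)⟩
        refine red ⌊z.re⌋ (⌊z.re⌋ + 1) (j - 1) (j + 1) (⌊z.re⌋, j) ?_ (rcH_sub hx) ?_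
        · simp [rc, hj, hfi1]
        · intro r a e1 e2 e3
          have k3 := hHO _ j _ r a hx (rc_convex _ _ _ _) subset_rfl e1 e2 e3
          have l3 := hεH _ j hx
          rw [k3] at l3
          rintro ⟨p, q⟩ hpq
          simp only at hpq
          obtain rfl : p = ⌊z.re⌋ := by omega
          rcases (show q = j ∨ q = j - 1 by omega) with hq | hq <;> rw [hq]
          · linear_combination l3 + h2 (a (⌊z.re⌋, j - 1)) - h2 (ε (⌊z.re⌋, j))
      · push_neg at him
        refine red ⌊z.re⌋ (⌊z.re⌋ + 1) ⌊z.im⌋ (⌊z.im⌋ + 1) (fl z) (mem_face_fl ⟨hre, him⟩) (face_sub C (fl z)) ?_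
        intro r a e1 e2 e3
        rintro ⟨p, q⟩ hpq
        simp only at hpq
        obtain rfl : p = ⌊z.re⌋ := by omega
        obtain rfl : q = ⌊z.im⌋ := by omega
        rfl
  have hlim : ∀ z ∈ (Ct C)ᶜ, ∃ y, Filter.Tendsto σ0 (nhdsWithin z A) (nhds y) ∧ y ^ 2 = h z := by
    intro z hz
    obtain ⟨O, g, hO, hzO, hg, hg2, hgA⟩ := hglue z hz
    refine ⟨g z, ?_, hg2 z hzO⟩
    have h1 : Filter.Tendsto g (nhdsWithin z A) (nhds (g z)) :=
      (hg.continuousAt (hO.mem_nhds hzO)).tendsto.mono_left nhdsWithin_le_nhds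
    refine h1.congr' ?_
    filter_upwards [self_mem_nhdsWithin, mem_nhdsWithin_of_mem_nhds (hO.mem_nhds hzO)] with y hy1 hy2
    exact (hgA y ⟨hy2, hy1⟩).symm
  refine ⟨extendFrom A σ0, continuousOn_extendFrom (fun z _ => dense_frac z) fun z hz => ?_, fun z hz => ?_⟩
  · obtain ⟨y, hy, -⟩ := hlim z hz
    exact ⟨y, hy⟩
  · obtain ⟨y, hy, hy2⟩ := hlim z hz
    rw [extendFrom_eq (dense_frac z) hy, hy2]

def Uw (C : Set (ℤ × ℤ)) (c0 : ℂ) : Set ℂ := {w | w = 0 ∨ c0 + w⁻¹ ∈ (Ct C)ᶜ}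

lemma Ct_bdd {C : Set (ℤ × ℤ)} (hC : C.Finite) (c0 : ℂ) : ∃ M > 0, ∀ z ∈ Ct C, ‖z - c0‖ ≤ M := by
  obtain ⟨B, hB⟩ := (hC.image (fun c => ‖pt c - c0‖)).bddAbove
  refine ⟨|B| + 1, by positivity, fun z hz => ?_⟩
  obtain ⟨c, hc, h⟩ := Ct_near hz
  have h1 : ‖pt c - c0‖ ≤ B := hB ⟨c, hc, rfl⟩
  have h2 : ‖z - c0‖ ≤ ‖z - pt c‖ + ‖pt c - c0‖ := by
    have := norm_add_le (z - pt c) (pt c - c0)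
    simpa using this
  have := le_abs_self B
  linarith

lemma Uw_ball {C : Set (ℤ × ℤ)} (hC : C.Finite) (c0 : ℂ) : ∃ δ > 0, Metric.ball 0 δ ⊆ Uw C c0 := by
  obtain ⟨M, hM, h⟩ := Ct_bdd hC c0
  refine ⟨M⁻¹, by positivity, fun w hw => ?_⟩
  by_cases h0 : w = 0
  · exact Or.inl h0
  refine Or.inr fun hz => ?_
  have := h _ hz
  have hw' : ‖w‖ < M⁻¹ := by simpa using hw
  rw [add_sub_cancel_left, norm_inv] at this
  have h3 : 0 < ‖w‖ := norm_pos_iff.2 h0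
  have := lt_inv_of_lt_inv₀ h3 hw'
  linarith

lemma Uw_open {C : Set (ℤ × ℤ)} (hC : C.Finite) (c0 : ℂ) : IsOpen (Uw C c0) := by
  rw [isOpen_iff_mem_nhds]
  intro w hw
  by_cases h0 : w = 0
  · obtain ⟨δ, hδ, h⟩ := Uw_ball hC c0
    subst h0
    exact Filter.mem_of_superset (Metric.ball_mem_nhds 0 hδ) h
  · have hw' : c0 + w⁻¹ ∈ (Ct C)ᶜ := hw.resolve_left h0
    have hc : ContinuousAt (fun w : ℂ => c0 + w⁻¹) w := continuousAt_const.add (continuousAt_inv₀ h0)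
    filter_upwards [hc.preimage_mem_nhds ((Ct_closed hC).isOpen_compl.mem_nhds hw')] with y hy
    exact Or.inr hy

lemma punct_preconn (δ : ℝ) : IsPreconnected {w : ℂ | w ≠ 0 ∧ ‖w‖ < δ} := by
  rcases le_or_gt δ 0 with h | h
  · convert isPreconnected_empty
    ext w
    simp only [mem_setOf_eq, mem_empty_iff_false, iff_false, not_and, not_lt]
    intro _
    exact h.trans (norm_nonneg _)
  have : {w : ℂ | w ≠ 0 ∧ ‖w‖ < δ} = Complex.exp '' {z | z.re < Real.log δ} := by
    ext w
    constructor
    · rintro ⟨h0, h1⟩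
      refine ⟨Complex.log w, ?_, Complex.exp_log h0⟩
      simp only [mem_setOf_eq, Complex.log_re]
      exact Real.log_lt_log (norm_pos_iff.2 h0) h1
    · rintro ⟨z, hz, rfl⟩
      refine ⟨Complex.exp_ne_zero z, ?_⟩
      rw [Complex.norm_exp]
      exact (Real.lt_log_iff_exp_lt h).1 hz
  rw [this]
  exact ((convex_halfSpace_re_lt _).isPreconnected).image _ Complex.continuous_exp.continuousOn

lemma diff_of_sq {U : Set ℂ} (hU : IsOpen U) {f s : ℂ → ℂ} (hf : DifferentiableOn ℂ f U)
    (hs : ContinuousOn s U) (h0 : ∀ z ∈ U, f z ≠ 0) (hsq : ∀ z ∈ U, s z ^ 2 = f z) :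
    DifferentiableOn ℂ s U := by
  intro z hz
  have hs0 : s z ≠ 0 := fun h => h0 z hz (by rw [← hsq z hz, h]; simp)
  have hd := (hf.differentiableAt (hU.mem_nhds hz)).hasDerivAt
  have hc := hs.continuousAt (hU.mem_nhds hz)
  rw [hasDerivAt_iff_tendsto_slope] at hd
  have hsum : Filter.Tendsto (fun y => s y + s z) (nhdsWithin z {z}ᶜ) (nhds (s z + s z)) :=
    (hc.tendsto.mono_left nhdsWithin_le_nhds).add_const _
  have h2 : s z + s z ≠ 0 := by
    rw [← two_mul]; exact mul_ne_zero two_ne_zero hs0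
  have : HasDerivAt s (deriv f z / (s z + s z)) z := by
    rw [hasDerivAt_iff_tendsto_slope]
    refine (hd.div hsum h2).congr' ?_
    filter_upwards [self_mem_nhdsWithin, mem_nhdsWithin_of_mem_nhds (hU.mem_nhds hz),
      hsum.eventually_ne h2] with y hy hyU hy2
    have hyz : y - z ≠ 0 := sub_ne_zero.2 hy
    simp only [Pi.div_apply, slope_def_field]
    rw [← hsq y hyU, ← hsq z hz]
    field_simp
    ring
  exact this.differentiableAt.differentiableWithinAt

theorem Uw_sqrt {C : Set (ℤ × ℤ)} (hfin : C.Finite) (hC : LatticeConnected C) {c0 : ℂ} (hc0 : c0 ∈ Ct C)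
    (w0 : ℂ) (f : ℂ → ℂ) (hf : DifferentiableOn ℂ f (connectedComponentIn (Uw C c0) w0))
    (hf0 : ∀ z ∈ connectedComponentIn (Uw C c0) w0, f z ≠ 0) :
    ∃ s : ℂ → ℂ, DifferentiableOn ℂ s (connectedComponentIn (Uw C c0) w0) ∧
      ∀ z ∈ connectedComponentIn (Uw C c0) w0, s z ^ 2 = f z := by
  set U := Uw C c0 with hUdef
  set V := connectedComponentIn U w0 with hV
  have hUo : IsOpen U := Uw_open hfin c0
  have hVo : IsOpen V := hUo.connectedComponentIn
  have hVU : V ⊆ U := connectedComponentIn_subset _ _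
  set F : ℂ → ℂ := fun w => if w ∈ V then f w else 1 with hF
  have hFc : ContinuousOn F U := by
    intro w hw
    apply ContinuousAt.continuousWithinAt
    by_cases hwV : w ∈ V
    · refine (hf.continuousOn.continuousAt (hVo.mem_nhds hwV)).congr ?_
      filter_upwards [hVo.mem_nhds hwV] with y hy
      simp [hF, hy]
    · refine (continuousAt_const (y := (1 : ℂ))).congr ?_
      filter_upwards [(hUo.connectedComponentIn (x := w)).mem_nhds (mem_connectedComponentIn hw)] with y hy
      have : y ∉ V := by
        intro hyV
        have e1 := connectedComponentIn_eq hyV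
        have e2 := connectedComponentIn_eq hy
        apply hwV
        rw [hV, e1, ← e2]
        exact mem_connectedComponentIn hw
      simp [hF, this]
  have hF0 : ∀ w, F w ≠ 0 := by
    intro w
    by_cases hwV : w ∈ V
    · simp [hF, hwV, hf0 w hwV]
    · simp [hF, hwV]
  obtain ⟨δ, hδ, hball⟩ := Uw_ball hfin c0
  obtain ⟨s1, hs1, hs1'⟩ := sqrt_convex Metric.isOpen_ball (convex_ball 0 δ) (hFc.mono hball) (fun z _ => hF0 z)
  have hne : ∀ z ∈ (Ct C)ᶜ, z - c0 ≠ 0 := fun z hz h => hz (by rwa [sub_eq_zero.1 h])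
  have hinvU : ∀ z ∈ (Ct C)ᶜ, (z - c0)⁻¹ ∈ U := fun z hz => Or.inr (by simpa using hz)
  have hinvc : ∀ S : Set ℂ, (∀ z ∈ S, z - c0 ≠ 0) → ContinuousOn (fun z : ℂ => (z - c0)⁻¹) S :=
    fun S hS => (continuousOn_id.sub continuousOn_const).inv₀ hS
  have hM : ∀ z, ‖c0‖ + δ⁻¹ < ‖z‖ → z - c0 ≠ 0 ∧ ‖(z - c0)⁻¹‖ < δ := by
    intro z hz
    have h1 : δ⁻¹ < ‖z - c0‖ := by
      have := norm_sub_norm_le z c0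
      linarith
    have h2 : 0 < ‖z - c0‖ := lt_trans (by positivity) h1
    refine ⟨norm_pos_iff.1 h2, ?_⟩
    rw [norm_inv]
    exact inv_lt_of_inv_lt₀ hδ h1
  obtain ⟨σ, hσ, hσ'⟩ := sqrt_offC hfin hC (h := fun z => F (z - c0)⁻¹) (hFc.comp (hinvc _ hne) hinvU)
    (fun z _ => hF0 _) (M := ‖c0‖ + δ⁻¹) (s0 := fun z => s1 (z - c0)⁻¹)
    (hs1.comp (hinvc _ fun z hz => (hM z hz).1) fun z hz => by simpa using (hM z hz).2)
    (fun z _ => hs1' _)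
  have hcS : ContinuousOn (fun w : ℂ => σ (c0 + w⁻¹)) (U \ {0}) := by
    refine hσ.comp (continuousOn_const.add (continuousOn_id.inv₀ fun z hz => hz.2)) ?_
    rintro w ⟨hw, hw0⟩
    exact hw.resolve_left hw0
  have hsS : ∀ w ∈ U \ {0}, (σ (c0 + w⁻¹)) ^ 2 = F w := by
    rintro w ⟨hw, hw0⟩
    rw [hσ' _ (hw.resolve_left hw0)]
    simp
  have hsub : {w : ℂ | w ≠ 0 ∧ ‖w‖ < δ} ⊆ U \ {0} := by
    rintro w ⟨h1, h2⟩
    exact ⟨hball (by simpa using h2), h1⟩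
  obtain ⟨a, ha⟩ := sqrt_cmp (punct_preconn δ) (hcS.mono hsub)
    (hs1.mono (s := Metric.ball 0 δ) (fun w hw => by simpa using hw.2)) (fun w hw => hsS w (hsub hw)) (fun w _ => hs1' w)
    (fun w _ => hF0 w)
  set S : ℂ → ℂ := fun w => if w = 0 then sg a * s1 0 else σ (c0 + w⁻¹) with hS
  have hSball : ∀ w ∈ Metric.ball (0 : ℂ) δ, S w = sg a * s1 w := by
    intro w hw
    by_cases h0 : w = 0
    · simp [hS, h0]
    · simp only [hS, h0, if_false]
      exact ha w ⟨h0, by simpa using hw⟩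
  have hSc : ContinuousOn S U := by
    intro w hw
    apply ContinuousAt.continuousWithinAt
    by_cases h0 : w = 0
    · have hb : Metric.ball (0 : ℂ) δ ∈ nhds w := by rw [h0]; exact Metric.ball_mem_nhds 0 hδ
      refine ((hs1.continuousAt hb).const_mul (sg a)).congr ?_
      filter_upwards [hb] with y hy
      exact (hSball y hy).symm
    · have hb : U \ {0} ∈ nhds w := (hUo.sdiff isClosed_singleton).mem_nhds ⟨hw, h0⟩
      refine (hcS.continuousAt hb).congr ?_
      filter_upwards [hb] with y hy
      have : y ≠ 0 := hy.2
      simp [hS, this]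
  have hSsq : ∀ w ∈ V, S w ^ 2 = f w := by
    intro w hw
    have hFw : F w = f w := by simp [hF, hw]
    rw [← hFw]
    by_cases h0 : w = 0
    · rw [hSball w (by simpa [h0] using hδ), mul_pow, sg_sq, one_mul, hs1']
    · rw [← hsS w ⟨hVU hw, h0⟩]
      simp [hS, h0]
  exact ⟨S, diff_of_sq hVo hf (hSc.mono hVU) hf0 hSsq, hSsq⟩

abbrev Vw (C : Set (ℤ × ℤ)) (c0 w0 : ℂ) : Set ℂ := connectedComponentIn (Uw C c0) w0

lemma Vw_ball {C : Set (ℤ × ℤ)} {c0 : ℂ} (hc0 : c0 ∈ Ct C) {w0 z0 : ℂ} {d : ℝ} (hd : 0 < d)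
    (h : (z0 - c0)⁻¹ ∈ Vw C c0 w0) (hb : Metric.ball z0 d ⊆ (Ct C)ᶜ) :
    ∀ z ∈ Metric.ball z0 d, (z - c0)⁻¹ ∈ Vw C c0 w0 := by
  have hne : ∀ z ∈ Metric.ball z0 d, z - c0 ≠ 0 := fun z hz h =>
    hb hz (by rwa [sub_eq_zero.1 h])
  have h1 : IsPreconnected ((fun z : ℂ => (z - c0)⁻¹) '' Metric.ball z0 d) :=
    (convex_ball z0 d).isPreconnected.image _ ((continuousOn_id.sub continuousOn_const).inv₀ hne)
  have h2 : ((fun z : ℂ => (z - c0)⁻¹) '' Metric.ball z0 d) ⊆ Uw C c0 := by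
    rintro _ ⟨z, hz, rfl⟩
    exact Or.inr (by simpa using hb hz)
  have h3 := h1.subset_connectedComponentIn (x := (z0 - c0)⁻¹) ⟨z0, Metric.mem_ball_self hd, rfl⟩ h2
  intro z hz
  have h4 := connectedComponentIn_eq h
  rw [Vw, h4]
  exact h3 ⟨z, hz, rfl⟩

set_option maxHeartbeats 1000000 in
theorem competitor {C : Set (ℤ × ℤ)} (hfin : C.Finite) (hC : LatticeConnected C) {c0 : ℂ} (hc0 : c0 ∈ Ct C)
    {w0 w1 : ℂ} (hw1 : w1 ∈ Vw C c0 w0) (hw10 : w1 ≠ 0) {a b : ℂ} (ha : a ∈ Ct C) (hb : b ∈ Ct C)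
    {d θ : ℝ} (hd : 0 < d) (hθ : 0 < θ) (hθ1 : θ ≤ 1)
    (hball : Metric.ball (c0 + w1⁻¹) d ⊆ (Ct C)ᶜ) (had : ‖c0 + w1⁻¹ - a‖ ≤ 2 * d)
    (hab : θ * d ≤ ‖a - b‖) :
    ∃ G, Fam (Vw C c0 w0) G ∧ θ ^ 2 / (27648 * d) ≤ ‖deriv G w1‖ * ‖w1‖ ^ 2 := by
  set V := Vw C c0 w0 with hV
  have hVo : IsOpen V := (Uw_open hfin c0).connectedComponentIn
  have hVU : V ⊆ Uw C c0 := connectedComponentIn_subset _ _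
  set z0 := c0 + w1⁻¹ with hz0
  have hw1' : (z0 - c0)⁻¹ = w1 := by simp [hz0]
  set D := ‖a - b‖ with hD
  have hD0 : 0 < D := lt_of_lt_of_le (by positivity) hab
  have hab0 : a - b ≠ 0 := norm_pos_iff.1 hD0
  have hfar : ∀ c ∈ Ct C, d ≤ ‖z0 - c‖ := by
    intro c hc
    by_contra h
    push Not at h
    exact hball (by rw [Metric.mem_ball, dist_comm, dist_eq_norm]; exact h) hc
  have hna := hfar a ha
  have hnb := hfar b hb
  have hden : ∀ c ∈ Ct C, ∀ w ∈ V, 1 + w * (c0 - c) ≠ 0 := by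
    intro c hc w hw
    by_cases h0 : w = 0
    · simp [h0]
    · have h1 : c0 + w⁻¹ ∈ (Ct C)ᶜ := (hVU hw).resolve_left h0
      intro h2
      apply h1
      have : c0 + w⁻¹ = c := by
        field_simp
        linear_combination h2
      rwa [this]
  set q : ℂ → ℂ := fun w => (1 + w * (c0 - a)) / (1 + w * (c0 - b)) with hq
  have hqd : ∀ w ∈ V, HasDerivAt q ((b - a) / (1 + w * (c0 - b)) ^ 2) w := by
    intro w hw
    have e1 : HasDerivAt (fun w : ℂ => 1 + w * (c0 - a)) (c0 - a) w := by
      simpa using ((hasDerivAt_id w).mul_const (c0 - a)).const_add 1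
    have e2 : HasDerivAt (fun w : ℂ => 1 + w * (c0 - b)) (c0 - b) w := by
      simpa using ((hasDerivAt_id w).mul_const (c0 - b)).const_add 1
    exact (e1.div e2 (hden b hb w hw)).congr_deriv (by ring)
  have hq0 : ∀ w ∈ V, q w ≠ 0 := fun w hw => div_ne_zero (hden a ha w hw) (hden b hb w hw)
  have hqz : ∀ w, w ≠ 0 → q w = (c0 + w⁻¹ - a) / (c0 + w⁻¹ - b) := by
    intro w h0
    have e : ∀ c : ℂ, c0 + w⁻¹ - c = w⁻¹ * (1 + w * (c0 - c)) := by
      intro c; field_simp; ring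
    rw [e, e, mul_div_mul_left _ _ (inv_ne_zero h0)]
  obtain ⟨s, hs, hsq⟩ := Uw_sqrt hfin hC hc0 w0 q
    (fun w hw => (hqd w hw).differentiableAt.differentiableWithinAt) hq0
  set s0 := s w1 with hs0
  have hs00 : s0 ≠ 0 := fun h => hq0 w1 hw1 (by rw [← hsq w1 hw1, ← hs0, h]; simp)
  have hs0p : 0 < ‖s0‖ := norm_pos_iff.2 hs00
  set r : ℝ := θ / 288 with hr
  have hrp : 0 < r := by positivity
  have hr1 : r ≤ 1 / 288 := by rw [hr]; linarith
  have hz0a : z0 - a ≠ 0 := norm_pos_iff.1 (lt_of_lt_of_le hd hna)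
  have hz0b : z0 - b ≠ 0 := norm_pos_iff.1 (lt_of_lt_of_le hd hnb)
  have hq1 : q w1 = (z0 - a) / (z0 - b) := hqz w1 hw10
  have hdD : d ≤ D / θ := by rw [le_div_iff₀ hθ]; linarith
  have hz0bu : ‖z0 - b‖ ≤ 3 / θ * D := by
    have h1 : ‖z0 - b‖ ≤ ‖z0 - a‖ + D := by
      have := norm_add_le (z0 - a) (a - b)
      simpa using this
    have h2 : D ≤ D / θ := by rw [le_div_iff₀ hθ]; nlinarith
    have h3 : 3 / θ * D = 3 * (D / θ) := by ring
    linarith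
  have hrD : 6 * r * d ≤ D / 48 := by
    have : r * d ≤ D / 288 := by
      rw [hr]; linarith
    linarith
  -- key lower bound
  have key : ∀ w ∈ V, r * ‖s0‖ ≤ ‖s w + s0‖ := by
    intro w hw
    by_contra hlt
    push Not at hlt
    have h1 : ‖s w - s0‖ ≤ 3 * ‖s0‖ := by
      have : ‖s w - s0‖ ≤ ‖s w + s0‖ + ‖2 * s0‖ := by
        have := norm_sub_le (s w + s0) (2 * s0)
        rwa [show s w + s0 - 2 * s0 = s w - s0 by ring] at this
      rw [norm_mul, Complex.norm_two] at this
      nlinarith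
    have h2 : ‖q w - q w1‖ < 3 * r * ‖q w1‖ := by
      rw [← hsq w hw, ← hsq w1 hw1, show s w ^ 2 - s w1 ^ 2 = (s w + s0) * (s w - s0) by rw [hs0]; ring,
        norm_mul, norm_pow]
      calc _ ≤ ‖s w + s0‖ * (3 * ‖s0‖) := by gcongr
        _ < (r * ‖s0‖) * (3 * ‖s0‖) := by gcongr
        _ = _ := by ring
    by_cases h0 : w = 0
    · have h3 : q w = 1 := by simp [hq, h0]
      have h4 : (1 : ℂ) - (z0 - a) / (z0 - b) = (a - b) / (z0 - b) := by field_simp; ring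
      rw [h3, hq1, h4, norm_div, norm_div, ← mul_div_assoc,
        div_lt_div_iff_of_pos_right (lt_of_lt_of_le hd hnb)] at h2
      nlinarith
    set z := c0 + w⁻¹ with hz
    have hzU : z ∈ (Ct C)ᶜ := (hVU hw).resolve_left h0
    have hzb : z - b ≠ 0 := fun h => hzU (by rwa [sub_eq_zero.1 h])
    have hdiff : ∀ z, z - b ≠ 0 → (z - a) / (z - b) - (z0 - a) / (z0 - b) = (z - z0) * (a - b) / ((z - b) * (z0 - b)) := by
      intro z hzb
      field_simp
      ring
    have h3 : ‖z - z0‖ < d / 8 := by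
      rw [hqz w h0, hq1, hdiff z hzb, norm_div, norm_div, norm_mul, norm_mul, div_lt_iff₀ (by positivity)] at h2
      have h4 : 3 * r * (‖z0 - a‖ / ‖z0 - b‖) * (‖z - b‖ * ‖z0 - b‖) = 3 * r * ‖z0 - a‖ * ‖z - b‖ := by
        have : ‖z0 - b‖ ≠ 0 := norm_ne_zero_iff.2 hz0b
        field_simp
      rw [h4] at h2
      have h5 : ‖z - b‖ ≤ ‖z - z0‖ + ‖z0 - b‖ := by
        have := norm_add_le (z - z0) (z0 - b)
        simpa using this
      have h6 : 3 * r * ‖z0 - a‖ * ‖z - b‖ ≤ 6 * r * d * (‖z - z0‖ + 3 / θ * D) := by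
        calc _ ≤ 3 * r * (2 * d) * (‖z - z0‖ + 3 / θ * D) := by
              gcongr; linarith
          _ = _ := by ring
      have h7 : 6 * r * d * (3 / θ * D) = d / 16 * D := by
        rw [hr]; field_simp; ring
      have h8 : 6 * r * d * ‖z - z0‖ ≤ D / 48 * ‖z - z0‖ := by gcongr
      have h9 : ‖z - z0‖ * D < D / 48 * ‖z - z0‖ + d / 16 * D := by
        calc _ < _ := h2
          _ ≤ _ := h6
          _ ≤ _ := by rw [mul_add, h7]; linarith
      by_contra hcon
      push Not at hcon
      nlinarith
    have hsubb : Metric.ball z0 (d / 8) ⊆ Metric.ball z0 d := Metric.ball_subset_ball (by linarith)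
    have hVb := Vw_ball hc0 (w0 := w0) hd (by rw [hw1']; exact hw1) hball
    have hcne : ∀ y ∈ Metric.ball z0 (d / 8), y - c0 ≠ 0 := fun y hy h =>
      hball (hsubb hy) (by rwa [sub_eq_zero.1 h])
    have hcont : ContinuousOn (fun y : ℂ => (s (y - c0)⁻¹ / s0).re) (Metric.ball z0 (d / 8)) := by
      apply Complex.continuous_re.comp_continuousOn
      refine ContinuousOn.div_const ?_ s0
      exact hs.continuousOn.comp ((continuousOn_id.sub continuousOn_const).inv₀ hcne)
        (fun y hy => hVb y (hsubb hy))
    have hzb8 : z ∈ Metric.ball z0 (d / 8) := by rw [Metric.mem_ball, dist_eq_norm]; exact h3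
    have hz0b8 : z0 ∈ Metric.ball z0 (d / 8) := Metric.mem_ball_self (by positivity)
    have hiv := (convex_ball z0 (d / 8)).isPreconnected.intermediate_value hzb8 hz0b8 hcont
    have hzw : (z - c0)⁻¹ = w := by simp [hz]
    have hneg : (s (z - c0)⁻¹ / s0).re ≤ 0 := by
      rw [hzw]
      have e1 : ‖s w / s0 + 1‖ < 1 := by
        rw [show s w / s0 + 1 = (s w + s0) / s0 by field_simp, norm_div, div_lt_one hs0p]
        nlinarith
      have e2 := Complex.abs_re_le_norm (s w / s0 + 1)
      have e3 := le_abs_self (s w / s0 + 1).re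
      simp only [Complex.add_re, Complex.one_re] at e2 e3
      linarith
    have hpos : (s (z0 - c0)⁻¹ / s0).re = 1 := by
      rw [hw1', ← hs0, div_self hs00]; simp
    obtain ⟨y, hy, hy0⟩ := hiv ⟨hneg, by simp only [hpos]; norm_num⟩
    have hyV := hVb y (hsubb hy)
    have hyn : ‖y - z0‖ < d / 8 := by rw [Metric.mem_ball, dist_eq_norm] at hy; exact hy
    have hyb : y - b ≠ 0 := fun h => hball (hsubb hy) (by rwa [sub_eq_zero.1 h])
    have hyq : q (y - c0)⁻¹ = (y - a) / (y - b) := by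
      rw [hqz _ (inv_ne_zero (hcne y hy))]; simp
    have f1 : (s (y - c0)⁻¹ / s0) ^ 2 - 1 = (y - z0) * (a - b) / ((y - b) * (z0 - a)) := by
      rw [div_pow, hsq _ hyV, hs0, hsq w1 hw1, hyq, hq1]
      field_simp
      ring
    have f2 : 1 ≤ ‖(s (y - c0)⁻¹ / s0) ^ 2 - 1‖ := by
      set t := s (y - c0)⁻¹ / s0
      have e1 := Complex.abs_re_le_norm (t ^ 2 - 1)
      have e2 := neg_abs_le (t ^ 2 - 1).re
      have e3 : (t ^ 2 - 1).re = t.re ^ 2 - t.im ^ 2 - 1 := by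
        simp [pow_two]
      have e4 : t.re = 0 := hy0
      rw [e3, e4] at e2
      rw [e3, e4] at e1
      nlinarith [sq_nonneg t.im]
    have f3 : ‖(y - z0) * (a - b) / ((y - b) * (z0 - a))‖ < 1 := by
      rw [norm_div, norm_mul, norm_mul, div_lt_one (by positivity)]
      have g1 : D ≤ ‖z0 - a‖ + ‖z0 - b‖ := by
        have := norm_sub_le (z0 - b) (z0 - a)
        rw [show z0 - b - (z0 - a) = a - b by ring] at this
        linarith
      have g2 : ‖z0 - b‖ - d / 8 ≤ ‖y - b‖ := by
        have := norm_sub_le (y - b) (y - z0)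
        rw [show y - b - (y - z0) = z0 - b by ring] at this
        linarith
      have g3 : ‖y - z0‖ * D ≤ d / 8 * (‖z0 - a‖ + ‖z0 - b‖) := by gcongr
      have g4 : (‖z0 - b‖ - d / 8) * ‖z0 - a‖ ≤ ‖y - b‖ * ‖z0 - a‖ := by gcongr
      nlinarith [mul_nonneg (sub_nonneg.2 hna) (sub_nonneg.2 hnb)]
    rw [f1] at f2
    linarith
  have hsne : ∀ w ∈ V, s w + s0 ≠ 0 := fun w hw h => by
    have := key w hw
    rw [h, norm_zero] at this
    nlinarith [mul_pos hrp hs0p]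
  have hsw : ∀ w ∈ V, s w ≠ 0 := fun w hw h => hq0 w hw (by rw [← hsq w hw, h]; simp)
  set G : ℂ → ℂ := fun w => (r / 2 * s0) / (s w + s0) with hG
  have hGd : ∀ w ∈ V, HasDerivAt G (-(r / 2 * s0) * deriv s w / (s w + s0) ^ 2) w := by
    intro w hw
    have e1 := (hs.differentiableAt (hVo.mem_nhds hw)).hasDerivAt.add_const s0
    exact ((hasDerivAt_const w ((r : ℂ) / 2 * s0)).div e1 (hsne w hw)).congr_deriv (by ring)
  have hsd : ∀ w ∈ V, 2 * s w * deriv s w = (b - a) / (1 + w * (c0 - b)) ^ 2 := by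
    intro w hw
    have e1 := (hs.differentiableAt (hVo.mem_nhds hw)).hasDerivAt.pow 2
    have e2 : HasDerivAt q (2 * s w * deriv s w) w := by
      refine HasDerivAt.congr_of_eventuallyEq (f := s ^ 2) (by simpa using e1) ?_
      filter_upwards [hVo.mem_nhds hw] with y hy
      simp [hsq y hy]
    exact e2.unique (hqd w hw)
  have hba : b - a ≠ 0 := by rw [← neg_sub]; exact neg_ne_zero.2 hab0
  have hsd0 : ∀ w ∈ V, deriv s w ≠ 0 := by
    intro w hw h
    have := hsd w hw
    rw [h, mul_zero] at this
    exact div_ne_zero hba (pow_ne_zero 2 (hden b hb w hw)) this.symm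
  have hr0 : (r : ℂ) / 2 * s0 ≠ 0 := mul_ne_zero (div_ne_zero (by exact_mod_cast hrp.ne') two_ne_zero) hs00
  have hnr : ‖(r : ℂ) / 2 * s0‖ = r / 2 * ‖s0‖ := by
    rw [norm_mul, norm_div, Complex.norm_real, Complex.norm_two, Real.norm_of_nonneg hrp.le]
  refine ⟨G, ⟨fun w hw => (hGd w hw).differentiableAt.differentiableWithinAt, ?_, ?_, ?_⟩, ?_⟩
  · intro w hw
    have := key w hw
    simp only [Metric.mem_ball, dist_zero_right, hG, norm_div, hnr]
    rw [div_lt_one (by nlinarith [mul_pos hrp hs0p])]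
    nlinarith [mul_pos hrp hs0p]
  · intro w hw w' hw' h
    simp only [hG] at h
    have h1 : s w = s w' := by
      rw [div_eq_div_iff (hsne w hw) (hsne w' hw')] at h
      have := mul_left_cancel₀ hr0 h
      exact (add_right_cancel this).symm
    have h2 : q w = q w' := by rw [← hsq w hw, ← hsq w' hw', h1]
    simp only [hq] at h2
    rw [div_eq_div_iff (hden b hb w hw) (hden b hb w' hw')] at h2
    have h3 : (w - w') * (a - b) = 0 := by linear_combination -h2
    exact sub_eq_zero.1 ((mul_eq_zero.1 h3).resolve_right hab0)
  · intro w hw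
    rw [(hGd w hw).deriv]
    exact div_ne_zero (mul_ne_zero (neg_ne_zero.2 hr0) (hsd0 w hw)) (pow_ne_zero 2 (hsne w hw))
  · have e1 : deriv G w1 * w1 ^ 2 = r / 16 * ((a - b) / ((z0 - a) * (z0 - b))) := by
      rw [(hGd w1 hw1).deriv]
      have e2 := hsd w1 hw1
      have e3 := hsq w1 hw1
      rw [hq1] at e3
      have e4 : 1 + w1 * (c0 - b) = w1 * (z0 - b) := by rw [hz0]; field_simp; ring
      rw [e4, ← hs0] at e2
      rw [← hs0] at e3
      have e5 : deriv s w1 = (b - a) / (w1 * (z0 - b)) ^ 2 / (2 * s0) := by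
        rw [eq_div_iff (mul_ne_zero two_ne_zero hs00), ← e2]; ring
      have e6 : deriv s w1 * w1 ^ 2 = (b - a) / (2 * s0 * (z0 - b) ^ 2) := by
        rw [e5]; field_simp
      have e7 : s0 ^ 2 * (z0 - b) ^ 2 = (z0 - a) * (z0 - b) := by
        rw [e3]; field_simp
      rw [show -(↑r / 2 * s0) * deriv s w1 / (s w1 + s0) ^ 2 * w1 ^ 2 =
        -(↑r / 2 * s0) * (deriv s w1 * w1 ^ 2) / (s w1 + s0) ^ 2 by ring, e6, ← e7, ← hs0]
      field_simp
      ring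
    have e2 : ‖deriv G w1‖ * ‖w1‖ ^ 2 = r / 16 * (D / (‖z0 - a‖ * ‖z0 - b‖)) := by
      rw [← norm_pow, ← norm_mul, e1]
      simp [abs_of_pos hrp, hD]
    rw [e2]
    have e3 : θ / (6 * d) ≤ D / (‖z0 - a‖ * ‖z0 - b‖) := by
      rw [div_le_div_iff₀ (by positivity) (by positivity)]
      calc θ * (‖z0 - a‖ * ‖z0 - b‖) ≤ θ * (2 * d * (3 / θ * D)) := by gcongr
        _ = _ := by field_simp; ring
    calc θ ^ 2 / (27648 * d) = r / 16 * (θ / (6 * d)) := by rw [hr]; field_simp; ring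
      _ ≤ _ := by gcongr

theorem conformal {C : Set (ℤ × ℤ)} (hfin : C.Finite) (hC : LatticeConnected C) {c0 : ℂ} (hc0 : c0 ∈ Ct C)
    {vc : ℂ} (hvc : vc ∉ Ct C) {δ : ℝ} (hδ : 0 < δ) (hdiam : ∀ a ∈ Ct C, ∃ b ∈ Ct C, δ ≤ ‖a - b‖) :
    ∃ (E : Set ℂ) (f : ℂ → ℂ), E ⊆ (Ct C)ᶜ ∧ vc ∈ E ∧
      (∀ z ∈ E, ∀ d > 0, Metric.ball z d ⊆ (Ct C)ᶜ → Metric.ball z d ⊆ E) ∧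
      DifferentiableOn ℂ f E ∧ MapsTo f E (Metric.ball 0 1) ∧ f vc = 0 ∧
      ∀ z ∈ E, ∀ d > 0, ∀ θ > 0, θ ≤ 1 → Metric.ball z d ⊆ (Ct C)ᶜ → (∃ a ∈ Ct C, ‖z - a‖ ≤ 2 * d) →
        θ * d ≤ δ → θ ^ 2 / (27648 * d) ≤ ‖deriv f z‖ / (1 - ‖f z‖ ^ 2) := by
  have hvne : vc - c0 ≠ 0 := fun h => hvc (by rwa [sub_eq_zero.1 h])
  set w0 := (vc - c0)⁻¹ with hw0
  have hw0U : w0 ∈ Uw C c0 := Or.inr (by simpa [hw0] using hvc)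
  have hw0V : w0 ∈ Vw C c0 w0 := mem_connectedComponentIn hw0U
  have hVo : IsOpen (Vw C c0 w0) := (Uw_open hfin c0).connectedComponentIn
  have hVp : IsPreconnected (Vw C c0 w0) := isPreconnected_connectedComponentIn
  have hw00 : w0 ≠ 0 := inv_ne_zero hvne
  have hw0i : c0 + w0⁻¹ = vc := by simp [hw0]
  have hne : ∃ G, Fam (Vw C c0 w0) G := by
    have hd : 0 < Metric.infDist vc (Ct C) :=
      ((Ct_closed hfin).notMem_iff_infDist_pos ⟨c0, hc0⟩).1 hvc
    obtain ⟨a, ha, had⟩ := (Metric.infDist_lt_iff (r := 2 * Metric.infDist vc (Ct C)) ⟨c0, hc0⟩).1 (by linarith)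
    obtain ⟨b, hb, hab⟩ := hdiam a ha
    set d := Metric.infDist vc (Ct C) with hddef
    obtain ⟨G, hG, -⟩ := competitor hfin hC hc0 hw0V hw00 ha hb (d := d) (θ := min 1 (δ / d)) hd
      (lt_min one_pos (by positivity)) (min_le_left _ _)
      (by
        rw [hw0i]
        intro z hz hzC
        have := Metric.infDist_le_dist_of_mem (x := vc) hzC
        rw [Metric.mem_ball, dist_comm] at hz
        linarith)
      (by rw [hw0i, ← dist_eq_norm]; exact had.le)
      (by
        refine le_trans ?_ hab
        calc _ ≤ δ / d * d := by gcongr; exact min_le_right _ _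
          _ = δ := by field_simp)
    exact ⟨G, hG⟩
  obtain ⟨F, hF, hF0, hFs⟩ := riemann_map hVo hVp hw0V (Uw_sqrt hfin hC hc0 w0) hne
  set E : Set ℂ := {z | z ∉ Ct C ∧ (z - c0)⁻¹ ∈ Vw C c0 w0} with hE
  have hEne : ∀ z ∈ E, z - c0 ≠ 0 := fun z hz h => hz.1 (by rwa [sub_eq_zero.1 h])
  have hid : ∀ z ∈ E, HasDerivAt (fun z : ℂ => (z - c0)⁻¹) (-((z - c0)⁻¹) ^ 2) z := by
    intro z hz
    exact (((hasDerivAt_id z).sub_const c0).inv (hEne z hz)).congr_deriv (by simp [div_eq_mul_inv])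
  have hfd : ∀ z ∈ E, HasDerivAt (fun z => F (z - c0)⁻¹) (deriv F (z - c0)⁻¹ * (-((z - c0)⁻¹) ^ 2)) z := by
    intro z hz
    exact (hF.1.differentiableAt (hVo.mem_nhds hz.2)).hasDerivAt.comp z (hid z hz)
  refine ⟨E, fun z => F (z - c0)⁻¹, fun z hz => hz.1, ⟨hvc, hw0V⟩, ?_, ?_, ?_, hF0, ?_⟩
  · intro z hz d hd hb y hy
    exact ⟨hb hy, Vw_ball hc0 hd hz.2 hb y hy⟩
  · intro z hz
    exact (hfd z hz).differentiableAt.differentiableWithinAt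
  · intro z hz
    exact hF.2.1 hz.2
  · rintro z hz d hd θ hθ hθ1 hb ⟨a, ha, had⟩ hθd
    obtain ⟨b, hb', hab⟩ := hdiam a ha
    have hz0 : (z - c0)⁻¹ ≠ 0 := inv_ne_zero (hEne z hz)
    have hzi : c0 + (z - c0)⁻¹⁻¹ = z := by simp
    obtain ⟨G, hG, hGl⟩ := competitor hfin hC hc0 hz.2 hz0 ha hb' (d := d) (θ := θ) hd hθ hθ1
      (by rw [hzi]; exact hb) (by rw [hzi]; exact had) (hθd.trans hab)
    have h1 := riemann_extremal hVo hF hFs hG.1 hG.2.1 hz.2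
    have hFn : ‖F (z - c0)⁻¹‖ < 1 := by simpa using hF.2.1 hz.2
    have hGn : ‖G (z - c0)⁻¹‖ < 1 := by simpa using hG.2.1 hz.2
    simp only [(hfd z hz).deriv]
    rw [norm_mul, norm_neg, norm_pow]
    have h2 : ‖deriv G (z - c0)⁻¹‖ ≤ ‖deriv G (z - c0)⁻¹‖ / (1 - ‖G (z - c0)⁻¹‖ ^ 2) := by
      rw [le_div_iff₀ (by nlinarith [norm_nonneg (G (z - c0)⁻¹)])]
      nlinarith [norm_nonneg (deriv G (z - c0)⁻¹), sq_nonneg ‖G (z - c0)⁻¹‖]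
    calc _ ≤ _ := hGl
      _ ≤ ‖deriv F (z - c0)⁻¹‖ / (1 - ‖F (z - c0)⁻¹‖ ^ 2) * ‖(z - c0)⁻¹‖ ^ 2 := by
        gcongr; linarith
      _ = _ := by ring

lemma taylor_two {H : ℂ → ℂ} {η M : ℝ} (hη : 0 < η) (hd : DifferentiableOn ℂ H (Metric.ball 0 η))
    (hM : ∀ u ∈ Metric.ball (0 : ℂ) η, ‖H u‖ ≤ M) {u : ℂ} (hu : ‖u‖ < η) :
    ‖H u - H 0 - deriv H 0 * u‖ ≤ 4 * M * (‖u‖ / η) ^ 2 := by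
  have h0 : (0 : ℂ) ∈ Metric.ball (0 : ℂ) η := Metric.mem_ball_self hη
  have hM0 : 0 ≤ M := (norm_nonneg _).trans (hM 0 h0)
  have hda : HasDerivAt H (deriv H 0) 0 := (hd.differentiableAt (Metric.isOpen_ball.mem_nhds h0)).hasDerivAt
  have hder : ‖deriv H 0‖ ≤ 2 * M / η := by
    refine Complex.norm_deriv_le_div_of_mapsTo_ball hd (fun w hw => ?_) hη
    rw [mem_closedBall_iff_norm]
    have := norm_sub_le (H w) (H 0)
    linarith [hM w hw, hM 0 h0]
  set K : ℂ → ℂ := fun u => H u - H 0 - deriv H 0 * u with hK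
  have hK0 : K 0 = 0 := by simp [hK]
  have hKd : DifferentiableOn ℂ K (Metric.ball 0 η) :=
    (hd.sub_const _).sub (differentiableOn_id.const_mul _)
  have hKm : MapsTo K (Metric.ball 0 η) (Metric.closedBall (K 0) (4 * M)) := by
    intro w hw
    rw [hK0, mem_closedBall_zero_iff]
    have hw' : ‖w‖ < η := by simpa using hw
    have e1 : ‖deriv H 0 * w‖ ≤ 2 * M := by
      rw [norm_mul]
      calc _ ≤ 2 * M / η * η := by gcongr
        _ = 2 * M := by field_simp
    have e2 := norm_sub_le (H w - H 0) (deriv H 0 * w)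
    have e3 := norm_sub_le (H w) (H 0)
    linarith [hM w hw, hM 0 h0]
  have hKo : (fun w => K w - K 0) =o[nhds 0] fun w : ℂ => ‖w - 0‖ ^ 1 := by
    have := hasDerivAt_iff_isLittleO.1 hda
    rw [← Asymptotics.isLittleO_norm_right] at this
    simp only [hK0, pow_one, sub_zero]
    refine this.congr (fun w => ?_) (fun w => by simp)
    simp [hK, mul_comm]
  have := Complex.dist_le_mul_div_pow_of_mapsTo_ball_of_isLittleO hKd hKm hKo (z := u) (by simpa using hu)
  rw [hK0] at this
  simpa using this

lemma symm_three {H : ℂ → ℂ} {η M : ℝ} (hη : 0 < η) (hd : DifferentiableOn ℂ H (Metric.ball 0 η))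
    (hM : ∀ u ∈ Metric.ball (0 : ℂ) η, ‖H u‖ ≤ M) {u : ℂ} (hu : ‖u‖ < η) :
    ‖(H u + H (Complex.I * u) + H (-u) + H (-(Complex.I * u))) / 4 - H 0‖ ≤ 2 * M * (‖u‖ / η) ^ 3 := by
  have h0 : (0 : ℂ) ∈ Metric.ball (0 : ℂ) η := Metric.mem_ball_self hη
  set K : ℂ → ℂ := fun u => (H u + H (Complex.I * u) + H (-u) + H (-(Complex.I * u))) / 4 with hK
  have hK0 : K 0 = H 0 := by simp [hK]; ring
  have hb : ∀ w ∈ Metric.ball (0 : ℂ) η, Complex.I * w ∈ Metric.ball (0 : ℂ) η ∧ -w ∈ Metric.ball (0 : ℂ) η ∧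
      -(Complex.I * w) ∈ Metric.ball (0 : ℂ) η := by
    intro w hw
    simpa using hw
  have hKd : DifferentiableOn ℂ K (Metric.ball 0 η) := by
    refine DifferentiableOn.div_const ((( hd.add ?_).add ?_).add ?_) 4
    · exact hd.comp (differentiableOn_id.const_mul _) fun w hw => (hb w hw).1
    · exact hd.comp differentiableOn_id.neg fun w hw => (hb w hw).2.1
    · exact hd.comp (differentiableOn_id.const_mul _).neg fun w hw => (hb w hw).2.2
  have hKm : MapsTo K (Metric.ball 0 η) (Metric.closedBall (K 0) (2 * M)) := by
    intro w hw
    rw [hK0, mem_closedBall_iff_norm]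
    obtain ⟨b1, b2, b3⟩ := hb w hw
    have e1 : ‖K w‖ ≤ M := by
      simp only [hK, norm_div, RCLike.norm_ofNat]
      rw [div_le_iff₀ (by norm_num)]
      refine (norm_add_le _ _).trans ?_
      have := norm_add₃_le (a := H w) (b := H (Complex.I * w)) (c := H (-w))
      linarith [hM _ hw, hM _ b1, hM _ b2, hM _ b3]
    have := norm_sub_le (K w) (H 0)
    linarith [hM 0 h0]
  have hKo : (fun w => K w - K 0) =o[nhds 0] fun w : ℂ => ‖w - 0‖ ^ 2 := by
    obtain ⟨p, hp⟩ := (hd.analyticAt (Metric.isOpen_ball.mem_nhds h0))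
    have hO := hp.isBigO_sub_partialSum_pow 3
    have hcomp : ∀ c : ℂ, ‖c‖ = 1 → (fun y : ℂ => H (c * y) - p.partialSum 3 (c * y)) =O[nhds 0] fun y => ‖y‖ ^ 3 := by
      intro c hc
      have ht : Filter.Tendsto (fun y : ℂ => c * y) (nhds 0) (nhds 0) := by
        have : Continuous fun y : ℂ => c * y := by fun_prop
        simpa using this.tendsto 0
      have := hO.comp_tendsto ht
      simpa [Function.comp_def, hc] using this
    have hsum := (((hcomp 1 (by simp)).add (hcomp Complex.I (by simp))).add (hcomp (-1) (by simp))).add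
      (hcomp (-Complex.I) (by simp))
    have hO3 : (fun w => K w - K 0) =O[nhds 0] fun w : ℂ => ‖w‖ ^ 3 := by
      refine (hsum.const_mul_left (1 / 4)).congr_left fun w => ?_
      have hp0 : p.coeff 0 = H 0 := hp.coeff_zero _
      simp only [FormalMultilinearSeries.partialSum, Finset.sum_range_succ, Finset.sum_range_zero,
        FormalMultilinearSeries.apply_eq_pow_smul_coeff, smul_eq_mul, hp0, hK0]
      simp only [hK, one_mul, neg_mul]
      linear_combination (-1 / 2 * w ^ 2 * p.coeff 2) * Complex.I_sq
    simp only [sub_zero]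
    refine hO3.trans_isLittleO ?_
    have h3 : (fun w : ℂ => ‖w‖ ^ 3) =o[nhds 0] fun w : ℂ => ‖w‖ ^ 2 := by
      have h1 : (fun x : ℝ => x ^ 3) =o[nhds 0] fun x : ℝ => x ^ 2 := Asymptotics.isLittleO_pow_pow (by norm_num)
      exact h1.comp_tendsto (by simpa using (continuous_norm (E := ℂ)).tendsto 0)
    exact h3
  have := Complex.dist_le_mul_div_pow_of_mapsTo_ball_of_isLittleO hKd hKm hKo (z := u) (by simpa using hu)
  rw [hK0, dist_eq_norm] at this
  simpa using this

/-- Data of the normalised map `ψ = mob ζ ∘ φ`. -/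
lemma normalise {φ : ℂ → ℂ} (hd : DifferentiableOn ℂ φ (Metric.ball 0 1))
    (hm : MapsTo φ (Metric.ball 0 1) (Metric.ball 0 1)) :
    ∃ ψ : ℂ → ℂ, DifferentiableOn ℂ ψ (Metric.ball 0 1) ∧ ψ 0 = 0 ∧ (∀ u, ‖u‖ < 1 → ‖ψ u‖ ≤ ‖u‖) ∧
      (∀ u, ‖u‖ < 1 → 1 - ‖φ u‖ ^ 2 = (1 - ‖φ 0‖ ^ 2) * (1 - ‖ψ u‖ ^ 2) /
        ‖1 + (starRingEnd ℂ) (φ 0) * ψ u‖ ^ 2) ∧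
      (∀ u, ‖u‖ < 1 → ‖deriv φ u‖ = ‖deriv ψ u‖ * (1 - ‖φ 0‖ ^ 2) / ‖1 + (starRingEnd ℂ) (φ 0) * ψ u‖ ^ 2) := by
  have h0 : ‖φ 0‖ < 1 := by simpa using hm (Metric.mem_ball_self one_pos)
  have hlt : ∀ u : ℂ, ‖u‖ < 1 → ‖φ u‖ < 1 := fun u hu => by simpa using hm (by simpa using hu)
  have hψd : DifferentiableOn ℂ (mob (φ 0) ∘ φ) (Metric.ball 0 1) := (mob_differentiableOn h0).comp hd hm
  have hψm : MapsTo (mob (φ 0) ∘ φ) (Metric.ball 0 1) (Metric.ball 0 1) := (mob_mapsTo h0).comp hm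
  have hψ0 : (mob (φ 0) ∘ φ) 0 = 0 := mob_self _
  have hneg : ‖-φ 0‖ < 1 := by simpa using h0
  have hinv : ∀ u : ℂ, ‖u‖ < 1 → φ u = mob (-φ 0) ((mob (φ 0) ∘ φ) u) := fun u hu =>
    (mob_neg_mob h0 (hlt u hu)).symm
  have hψlt : ∀ u : ℂ, ‖u‖ < 1 → ‖(mob (φ 0) ∘ φ) u‖ < 1 := fun u hu => mob_norm_lt h0 (hlt u hu)
  refine ⟨mob (φ 0) ∘ φ, hψd, hψ0, ?_, ?_, ?_⟩
  · intro u hu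
    have := Complex.dist_le_mul_div_pow_of_mapsTo_ball_of_isLittleO (n := 0) hψd (R₂ := 1)
      (c := 0) (z := u) (R₁ := 1) (by
        rw [hψ0]; exact hψm.mono_right Metric.ball_subset_closedBall) (by
        simpa using (hψd.continuousOn.continuousAt (Metric.ball_mem_nhds 0 one_pos)).sub_const ((mob (φ 0) ∘ φ) 0)) (by simpa using hu)
    rw [hψ0] at this
    simpa using this
  · intro u hu
    have := mob_norm_sq hneg (hψlt u hu)
    rw [← hinv u hu] at this
    simpa using this
  · intro u hu
    have hub : u ∈ Metric.ball (0 : ℂ) 1 := by simpa using hu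
    have e1 : HasDerivAt (fun u => mob (-φ 0) ((mob (φ 0) ∘ φ) u))
        (deriv (mob (-φ 0)) ((mob (φ 0) ∘ φ) u) * deriv (mob (φ 0) ∘ φ) u) u := by
      refine HasDerivAt.comp (h₂ := mob (-φ 0)) u ?_ (hψd.differentiableAt (Metric.isOpen_ball.mem_nhds hub)).hasDerivAt
      exact (mob_hasDerivAt hneg (hψlt u hu)).differentiableAt.hasDerivAt
    have e2 : HasDerivAt φ (deriv (mob (-φ 0)) ((mob (φ 0) ∘ φ) u) * deriv (mob (φ 0) ∘ φ) u) u := by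
      refine e1.congr_of_eventuallyEq ?_
      filter_upwards [Metric.isOpen_ball.mem_nhds hub] with y hy
      exact hinv y (by simpa using hy)
    rw [e2.deriv, norm_mul, mob_deriv_norm hneg (hψlt u hu)]
    simp only [map_neg, neg_mul, sub_neg_eq_add, norm_neg]
    ring

set_option maxHeartbeats 1000000 in
lemma four_avg {H ψ : ℂ → ℂ} {b : ℂ} {k h q p : ℝ} (hk : 1 ≤ k) (hh : 0 < h) (hhk : h * (32 * k) ≤ 1)
    (hp0 : 0 ≤ p) (hp1 : p ≤ 1) (hq0 : 0 < q) (hq1 : q ≤ 1)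
    (hb1 : ‖b‖ ≤ 1) (hbk : 1 ≤ k * ‖b‖) (hH0 : H 0 = 1)
    (hHd : DifferentiableOn ℂ H (Metric.ball 0 (1 / (16 * k))))
    (hH8 : ∀ u ∈ Metric.ball (0 : ℂ) (1 / (16 * k)), ‖H u‖ ≤ 8)
    (hH1 : ‖deriv H 0‖ ≤ q * ‖b‖ + 5 * k * p)
    (hψ : ∀ u, ‖u‖ < 1 → ‖ψ u‖ ≤ ‖u‖) (hψ2 : ∀ u, ‖u‖ < 1 → ‖ψ u - b * u‖ ≤ 4 * ‖u‖ ^ 2) :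
    (‖H h‖ ^ 2 * (1 - q * ‖ψ h‖ ^ 2) + ‖H (Complex.I * h)‖ ^ 2 * (1 - q * ‖ψ (Complex.I * h)‖ ^ 2) +
     ‖H (-h)‖ ^ 2 * (1 - q * ‖ψ (-h)‖ ^ 2) + ‖H (-(Complex.I * h))‖ ^ 2 * (1 - q * ‖ψ (-(Complex.I * h))‖ ^ 2)) / 4
     ≤ 1 - q * (1 - q) / k ^ 2 * h ^ 2 + 25 * k ^ 2 * (p ^ 2 + p * q) * h ^ 2 + 3000000 * k ^ 3 * h ^ 3 := by
  have hη : 0 < 1 / (16 * k) := by positivity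
  have hhη : h < 1 / (16 * k) := by
    rw [lt_div_iff₀ (by positivity)]; nlinarith
  have hh1 : h ≤ 1 / 32 := by nlinarith
  have hdiv : h / (1 / (16 * k)) = 16 * k * h := by field_simp
  have hnh : ‖(h : ℂ)‖ = h := by simp [abs_of_pos hh]
  have hsym := symm_three hη hHd hH8 (u := h) (by rw [hnh]; exact hhη)
  rw [hnh, hdiv, hH0] at hsym
  have hkh : 0 < k * h := by positivity
  have hB : ‖deriv H 0‖ ≤ 6 * k := by
    have : q * ‖b‖ ≤ 1 := by nlinarith [norm_nonneg b]
    nlinarith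
  have hone : ∀ u : ℂ, ‖u‖ = h → ‖H u‖ ^ 2 * (1 - q * ‖ψ u‖ ^ 2) ≤ 1 + 2 * (H u - 1).re
      + ‖deriv H 0‖ ^ 2 * h ^ 2 - q * ‖b‖ ^ 2 * h ^ 2 + 2300000 * k ^ 3 * h ^ 3 := by
    intro u hu
    have hub : u ∈ Metric.ball (0 : ℂ) (1 / (16 * k)) := by simpa [hu] using hhη
    have ht := taylor_two hη hHd hH8 (u := u) (by rw [hu]; exact hhη)
    rw [hu, hdiv, hH0] at ht
    have hsq : ‖H u‖ ^ 2 = 1 + 2 * (H u - 1).re + ‖H u - 1‖ ^ 2 := by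
      rw [← Complex.normSq_eq_norm_sq, ← Complex.normSq_eq_norm_sq, Complex.normSq_apply, Complex.normSq_apply]
      simp; ring
    set B := ‖deriv H 0‖ with hBdef
    have hB0 : 0 ≤ B := norm_nonneg _
    have hn1 : ‖H u - 1‖ ≤ B * h + 8192 * k ^ 2 * h ^ 2 := by
      have := norm_add_le (H u - 1 - deriv H 0 * u) (deriv H 0 * u)
      rw [sub_add_cancel, norm_mul, hu] at this
      nlinarith
    have hkk : k ^ 2 * h ^ 2 * 32 ≤ k * h := by nlinarith [mul_nonneg hkh.le (sub_nonneg.2 hhk)]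
    have hn2 : ‖H u - 1‖ ≤ 262 * (k * h) := by nlinarith
    have hk2 : k ^ 2 * h ^ 3 ≤ k ^ 3 * h ^ 3 := by
      have : k ^ 2 ≤ k ^ 3 := pow_le_pow_right₀ hk (by norm_num)
      gcongr
    have hk1 : k * h ^ 3 ≤ k ^ 3 * h ^ 3 := by
      have : k ≤ k ^ 3 := by simpa using pow_le_pow_right₀ hk (show 1 ≤ 3 by norm_num)
      gcongr
    have hk0 : h ^ 3 ≤ k ^ 3 * h ^ 3 := by
      have : 1 ≤ k ^ 3 := one_le_pow₀ hk
      nlinarith [pow_pos hh 3]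
    have hsq1 : ‖H u - 1‖ ^ 2 ≤ B ^ 2 * h ^ 2 + 2200000 * (k ^ 3 * h ^ 3) := by
      have e1 : ‖H u - 1‖ ^ 2 ≤ (B * h + 8192 * k ^ 2 * h ^ 2) ^ 2 := by gcongr
      have e2 : B * (k ^ 2 * h ^ 3) ≤ 6 * (k ^ 3 * h ^ 3) := by
        calc _ ≤ 6 * k * (k ^ 2 * h ^ 3) := by gcongr
          _ = _ := by ring
      have e3 : 32 * (k ^ 4 * h ^ 4) ≤ k ^ 3 * h ^ 3 := by
        have : 0 < k ^ 3 * h ^ 3 := by positivity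
        nlinarith
      nlinarith
    have hu1 : ‖u‖ < 1 := by rw [hu]; linarith
    have hψu := hψ u hu1
    have hψu2 := hψ2 u hu1
    rw [hu] at hψu hψu2
    have hψlow : ‖b‖ ^ 2 * h ^ 2 - 8 * h ^ 3 ≤ ‖ψ u‖ ^ 2 := by
      have e1 : ‖b‖ * h ≤ ‖ψ u‖ + 4 * h ^ 2 := by
        have := norm_sub_le (ψ u) (ψ u - b * u)
        rw [sub_sub_cancel, norm_mul, hu] at this
        linarith
      have hbh : 0 ≤ ‖b‖ * h := by positivity
      have e2 : ‖b‖ * h * h ^ 2 ≤ h ^ 3 := by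
        calc _ ≤ 1 * h * h ^ 2 := by gcongr
          _ = _ := by ring
      have e3 : ‖b‖ ^ 2 * h ^ 2 = (‖b‖ * h) ^ 2 := by ring
      have e4 := pow_pos hh 3
      rw [e3]
      generalize ‖b‖ * h = B' at *
      have hX := norm_nonneg (ψ u)
      by_cases hc : B' ≤ 4 * h ^ 2
      · have := mul_le_mul_of_nonneg_left hc hbh
        have := sq_nonneg ‖ψ u‖
        linarith [sq B']
      · push Not at hc
        have : (B' - 4 * h ^ 2) ^ 2 ≤ ‖ψ u‖ ^ 2 := by
          apply pow_le_pow_left₀ <;> linarith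
        have h5 : (B' - 4 * h ^ 2) ^ 2 = B' ^ 2 - 8 * (B' * h ^ 2) + 16 * (h ^ 2) ^ 2 := by ring
        have := sq_nonneg (h ^ 2)
        linarith
    have hcross : (1 - ‖H u‖ ^ 2) * (q * ‖ψ u‖ ^ 2) ≤ 3000 * (k ^ 3 * h ^ 3) := by
      have e1 : 1 - ‖H u‖ ≤ ‖H u - 1‖ := by
        have := norm_sub_norm_le 1 (H u)
        rw [norm_one, norm_sub_rev] at this
        exact this
      have e2 : 1 - ‖H u‖ ^ 2 ≤ 9 * (262 * (k * h)) := by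
        have : 1 - ‖H u‖ ^ 2 = (1 - ‖H u‖) * (1 + ‖H u‖) := by ring
        rw [this]
        have h8 := hH8 u hub
        have hn := norm_nonneg (H u)
        calc _ ≤ ‖H u - 1‖ * (1 + ‖H u‖) := by gcongr
          _ ≤ (262 * (k * h)) * 9 := by gcongr; linarith
          _ = _ := by ring
      have e3 : q * ‖ψ u‖ ^ 2 ≤ h ^ 2 := by
        have : ‖ψ u‖ ^ 2 ≤ h ^ 2 := by gcongr
        nlinarith [sq_nonneg ‖ψ u‖]
      have e4 : 0 ≤ q * ‖ψ u‖ ^ 2 := by positivity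
      calc _ ≤ 9 * (262 * (k * h)) * (q * ‖ψ u‖ ^ 2) := by gcongr
        _ ≤ 9 * (262 * (k * h)) * h ^ 2 := by gcongr
        _ = 2358 * (k * h ^ 3) := by ring
        _ ≤ _ := by nlinarith [pow_pos hh 3]
    have hq8 : q * (‖b‖ ^ 2 * h ^ 2 - 8 * h ^ 3) ≤ q * ‖ψ u‖ ^ 2 := by gcongr
    have hq9 : q * (8 * h ^ 3) ≤ 8 * h ^ 3 := by nlinarith [pow_pos hh 3]
    have hid : ‖H u‖ ^ 2 * (1 - q * ‖ψ u‖ ^ 2) =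
        ‖H u‖ ^ 2 - q * ‖ψ u‖ ^ 2 + (1 - ‖H u‖ ^ 2) * (q * ‖ψ u‖ ^ 2) := by ring
    have hid2 : q * (‖b‖ ^ 2 * h ^ 2 - 8 * h ^ 3) = q * ‖b‖ ^ 2 * h ^ 2 - q * (8 * h ^ 3) := by ring
    have hid3 : 2300000 * k ^ 3 * h ^ 3 = 2300000 * (k ^ 3 * h ^ 3) := by ring
    rw [hid, hsq, hid3]
    rw [hsq] at hcross
    linarith [pow_pos hh 3]
  have n1 := hone h hnh
  have n2 := hone (Complex.I * h) (by simp [abs_of_pos hh])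
  have n3 := hone (-h) (by simp [abs_of_pos hh])
  have n4 := hone (-(Complex.I * h)) (by simp [abs_of_pos hh])
  have hre : ((H h - 1).re + (H (Complex.I * h) - 1).re + (H (-h) - 1).re + (H (-(Complex.I * h)) - 1).re) / 4
      ≤ 16 * (16 * k * h) ^ 3 := by
    have e := (Complex.re_le_norm _).trans hsym
    have e2 : ((H h + H (Complex.I * h) + H (-h) + H (-(Complex.I * h))) / 4 - 1).re =
      ((H h - 1).re + (H (Complex.I * h) - 1).re + (H (-h) - 1).re + (H (-(Complex.I * h)) - 1).re) / 4 := by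
      have : ∀ z : ℂ, (z / 4).re = z.re / 4 := fun z => by
        rw [show (4 : ℂ) = ((4 : ℝ) : ℂ) by norm_num, Complex.div_ofReal_re]
      simp only [Complex.sub_re, this, Complex.add_re, Complex.one_re]
      ring
    rw [e2] at e
    linarith
  have hBsq : ‖deriv H 0‖ ^ 2 ≤ q ^ 2 * ‖b‖ ^ 2 + 25 * k ^ 2 * (p ^ 2 + p * q) := by
    have e1 : ‖deriv H 0‖ ^ 2 ≤ (q * ‖b‖ + 5 * k * p) ^ 2 := by gcongr
    have e2 : q * p * (k * ‖b‖) ≤ q * p * k ^ 2 := by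
      have : k * ‖b‖ ≤ k ^ 2 := by nlinarith [norm_nonneg b]
      gcongr
    have e3 : 0 ≤ q * p * k ^ 2 := by positivity
    nlinarith
  have hblow : 1 / k ^ 2 ≤ ‖b‖ ^ 2 := by
    rw [div_le_iff₀ (by positivity)]
    have : 1 ≤ (k * ‖b‖) ^ 2 := one_le_pow₀ hbk
    nlinarith
  have f1 : q * (1 - q) / k ^ 2 * h ^ 2 ≤ q * (1 - q) * ‖b‖ ^ 2 * h ^ 2 := by
    have : 0 ≤ q * (1 - q) := mul_nonneg hq0.le (by linarith)
    calc _ = q * (1 - q) * (1 / k ^ 2) * h ^ 2 := by ring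
      _ ≤ _ := by gcongr
  have f2 : ‖deriv H 0‖ ^ 2 * h ^ 2 ≤ (q ^ 2 * ‖b‖ ^ 2 + 25 * k ^ 2 * (p ^ 2 + p * q)) * h ^ 2 := by gcongr
  have hk3 : 0 < k ^ 3 * h ^ 3 := by positivity
  have g1 : (16 * k * h) ^ 3 = 4096 * (k ^ 3 * h ^ 3) := by ring
  rw [g1] at hre
  have g2 : ∀ c : ℝ, c * k ^ 3 * h ^ 3 = c * (k ^ 3 * h ^ 3) := fun c => by ring
  simp only [g2] at n1 n2 n3 n4 ⊢
  have g3 : (q ^ 2 * ‖b‖ ^ 2 + 25 * k ^ 2 * (p ^ 2 + p * q)) * h ^ 2 =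
    q * ‖b‖ ^ 2 * h ^ 2 - q * (1 - q) * ‖b‖ ^ 2 * h ^ 2 + 25 * k ^ 2 * (p ^ 2 + p * q) * h ^ 2 := by ring
  rw [g3] at f2
  linarith

set_option maxHeartbeats 1000000 in
lemma mk_H {ψ : ℂ → ℂ} (hd : DifferentiableOn ℂ ψ (Metric.ball 0 1)) (h0 : ψ 0 = 0)
    (hψ : ∀ u, ‖u‖ < 1 → ‖ψ u‖ ≤ ‖u‖) {ζ : ℂ} (hζ : ‖ζ‖ < 1) {k p q : ℝ} (hk : 1 ≤ k)
    (hbk : 1 ≤ k * ‖deriv ψ 0‖) (hp0 : 0 ≤ p) (hp1 : p ≤ 1) (hq0 : 0 < q) (hq1 : q ≤ 1) :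
    ‖deriv ψ 0‖ ≤ 1 ∧ ∃ H : ℂ → ℂ, H 0 = 1 ∧ DifferentiableOn ℂ H (Metric.ball 0 (1 / (16 * k))) ∧
      (∀ u ∈ Metric.ball (0 : ℂ) (1 / (16 * k)), ‖H u‖ ≤ 8) ∧
      ‖deriv H 0‖ ≤ q * ‖deriv ψ 0‖ + 5 * k * p ∧
      (∀ u ∈ Metric.ball (0 : ℂ) (1 / (16 * k)), ‖H u‖ ^ 2 =
        (‖deriv ψ u‖ / ‖deriv ψ 0‖) ^ p * (‖1 + (starRingEnd ℂ) ζ * ψ u‖ ^ 2) ^ (-(p + q))) := by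
  set b := deriv ψ 0 with hb
  have hk0 : 0 < k := by linarith
  have hbp : 0 < ‖b‖ := by
    rcases (norm_nonneg b).eq_or_lt with h | h
    · rw [← h] at hbk; norm_num at hbk
    · exact h
  have hb0 : b ≠ 0 := norm_pos_iff.1 hbp
  have hη1 : 1 / (16 * k) ≤ 1 / 16 := by
    rw [div_le_div_iff₀ (by positivity) (by norm_num)]; linarith
  have hm1 : MapsTo ψ (Metric.ball 0 1) (Metric.ball 0 1) := fun u hu => by
    have hu' : ‖u‖ < 1 := by simpa using hu
    simpa using (hψ u hu').trans_lt hu'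
  have hdψ : ∀ u : ℂ, ‖u‖ < 1 / 2 → ‖deriv ψ u‖ ≤ 2 := by
    intro u hu
    have hsub : Metric.ball u (1 / 2) ⊆ Metric.ball 0 1 := by
      apply Metric.ball_subset_ball'
      simp; linarith
    have := schwarz_pick_ball (c := u) (R := 1 / 2) (by norm_num) (hd.mono hsub) (hm1.mono_left hsub)
    refine this.trans ?_
    have := sq_nonneg ‖ψ u‖
    linarith
  have hb1 : ‖b‖ ≤ 1 := by
    have := schwarz_pick_ball (c := 0) (R := 1) (by norm_num) hd hm1
    rw [h0] at this
    simpa using this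
  have hdd : DifferentiableOn ℂ (deriv ψ) (Metric.ball 0 (1 / 2)) :=
    (hd.deriv Metric.isOpen_ball).mono (Metric.ball_subset_ball (by norm_num))
  have hmd : MapsTo (deriv ψ) (Metric.ball 0 (1 / 2)) (Metric.closedBall (deriv ψ 0) 4) := by
    intro u hu
    rw [mem_closedBall_iff_norm]
    have := norm_sub_le (deriv ψ u) (deriv ψ 0)
    linarith [hdψ u (by simpa using hu), hdψ 0 (by simp)]
  have hψ2 : ‖deriv (deriv ψ) 0‖ ≤ 8 := by
    have := Complex.norm_deriv_le_div_of_mapsTo_ball hdd hmd (by norm_num)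
    norm_num at this ⊢
    exact this
  have hclose : ∀ u : ℂ, ‖u‖ < 1 / (16 * k) → ‖deriv ψ u / b - 1‖ ≤ 1 / 2 := by
    intro u hu
    have := Complex.dist_le_div_mul_dist_of_mapsTo_ball hdd hmd (z := u) (by
      simp only [Metric.mem_ball, dist_zero_right]; linarith)
    rw [dist_eq_norm, dist_zero_right] at this
    rw [show deriv ψ u / b - 1 = (deriv ψ u - b) / b by field_simp, norm_div, div_le_iff₀ hbp]
    rw [lt_div_iff₀ (by positivity)] at hu
    have h3 : ‖u‖ * 16 ≤ ‖b‖ := by nlinarith [norm_nonneg u]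
    norm_num at this
    linarith
  have hclose2 : ∀ u : ℂ, ‖u‖ < 1 / (16 * k) → ‖(starRingEnd ℂ) ζ * ψ u‖ ≤ 1 / 2 := by
    intro u hu
    rw [norm_mul, RCLike.norm_conj]
    have := hψ u (by linarith)
    nlinarith [norm_nonneg ζ, norm_nonneg (ψ u)]
  have hsl1 : ∀ u : ℂ, ‖u‖ < 1 / (16 * k) → deriv ψ u / b ∈ Complex.slitPlane := by
    intro u hu
    have := Complex.mem_slitPlane_of_norm_lt_one (z := deriv ψ u / b - 1) (by linarith [hclose u hu])
    rwa [add_sub_cancel] at this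
  have hsl2 : ∀ u : ℂ, ‖u‖ < 1 / (16 * k) → 1 + (starRingEnd ℂ) ζ * ψ u ∈ Complex.slitPlane := fun u hu =>
    Complex.mem_slitPlane_of_norm_lt_one (by linarith [hclose2 u hu])
  have hHd : ∀ u : ℂ, ‖u‖ < 1 / (16 * k) → HasDerivAt (fun u => (deriv ψ u / b) ^ ((p / 2 : ℝ) : ℂ) *
      (1 + (starRingEnd ℂ) ζ * ψ u) ^ ((-(p + q) : ℝ) : ℂ))
      ((((p / 2 : ℝ) : ℂ) * (deriv ψ u / b) ^ (((p / 2 : ℝ) : ℂ) - 1) * (deriv (deriv ψ) u / b)) *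
        (1 + (starRingEnd ℂ) ζ * ψ u) ^ ((-(p + q) : ℝ) : ℂ) +
        (deriv ψ u / b) ^ ((p / 2 : ℝ) : ℂ) * (((-(p + q) : ℝ) : ℂ) *
        (1 + (starRingEnd ℂ) ζ * ψ u) ^ (((-(p + q) : ℝ) : ℂ) - 1) * ((starRingEnd ℂ) ζ * deriv ψ u))) u := by
    intro u hu
    have e1 : HasDerivAt (fun u => deriv ψ u / b) (deriv (deriv ψ) u / b) u :=
      ((hdd.differentiableAt (Metric.isOpen_ball.mem_nhds (by
        simp only [Metric.mem_ball, dist_zero_right]; linarith))).hasDerivAt).div_const b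
    have e2 : HasDerivAt (fun u => 1 + (starRingEnd ℂ) ζ * ψ u) ((starRingEnd ℂ) ζ * deriv ψ u) u :=
      (((hd.differentiableAt (Metric.isOpen_ball.mem_nhds (by
        simp only [Metric.mem_ball, dist_zero_right]; linarith))).hasDerivAt).const_mul _).const_add 1
    exact (e1.cpow_const (hsl1 u hu)).mul (e2.cpow_const (hsl2 u hu))
  refine ⟨hb1, _, ?_, fun u hu => (hHd u (by simpa using hu)).differentiableAt.differentiableWithinAt, ?_, ?_, ?_⟩
  · simp [h0, ← hb, div_self hb0]
  · intro u hu
    have hu : ‖u‖ < 1 / (16 * k) := by simpa using hu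
    rw [norm_mul, Complex.norm_cpow_real, Complex.norm_cpow_real]
    have g1 : ‖deriv ψ u / b‖ ≤ 2 := by
      have := norm_add_le (deriv ψ u / b - 1) 1
      rw [sub_add_cancel, norm_one] at this
      linarith [hclose u hu]
    have g2 : 1 / 2 ≤ ‖1 + (starRingEnd ℂ) ζ * ψ u‖ := by
      have := norm_sub_le (1 + (starRingEnd ℂ) ζ * ψ u) ((starRingEnd ℂ) ζ * ψ u)
      rw [add_sub_cancel_right, norm_one] at this
      linarith [hclose2 u hu]
    have g3 : ‖deriv ψ u / b‖ ^ (p / 2) ≤ 2 := by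
      calc _ ≤ (2 : ℝ) ^ (p / 2) := by gcongr
        _ ≤ (2 : ℝ) ^ (1 : ℝ) := by
          apply Real.rpow_le_rpow_of_exponent_le <;> linarith
        _ = 2 := by simp
    have g4 : ‖1 + (starRingEnd ℂ) ζ * ψ u‖ ^ (-(p + q)) ≤ 4 := by
      calc _ ≤ (1 / 2 : ℝ) ^ (-(p + q)) := by
            apply Real.rpow_le_rpow_of_nonpos <;> linarith
        _ = (2 : ℝ) ^ (p + q) := by
            rw [one_div, Real.inv_rpow (by norm_num), Real.rpow_neg (by norm_num), inv_inv]
        _ ≤ (2 : ℝ) ^ (2 : ℝ) := by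
          apply Real.rpow_le_rpow_of_exponent_le <;> linarith
        _ = 4 := by norm_num
    calc _ ≤ (2 : ℝ) * 4 := by gcongr
      _ = 8 := by norm_num
  · rw [(hHd 0 (by simpa using hk0)).deriv]
    simp only [h0, ← hb, div_self hb0, Complex.one_cpow, mul_zero, add_zero, mul_one, one_mul]
    refine (norm_add_le _ _).trans ?_
    rw [norm_mul, norm_mul, norm_mul, norm_div, Complex.norm_real, Complex.norm_real, Real.norm_of_nonneg (by linarith),
      norm_neg, Real.norm_of_nonneg (by linarith), RCLike.norm_conj]
    have e1 : ‖deriv (deriv ψ) 0‖ / ‖b‖ ≤ 8 * k := by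
      rw [div_le_iff₀ hbp]
      nlinarith
    have e2 : p / 2 * (‖deriv (deriv ψ) 0‖ / ‖b‖) ≤ p / 2 * (8 * k) := by gcongr
    have e3 : (p + q) * (‖ζ‖ * ‖b‖) ≤ (p + q) * (1 * ‖b‖) := by gcongr
    have e4 : p * ‖b‖ ≤ p * k := by
      have : ‖b‖ ≤ k := by linarith
      gcongr
    linarith
  · intro u hu
    have hu : ‖u‖ < 1 / (16 * k) := by simpa using hu
    rw [norm_mul, Complex.norm_cpow_real, Complex.norm_cpow_real, mul_pow, norm_div]
    have hn := norm_nonneg (1 + (starRingEnd ℂ) ζ * ψ u)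
    congr 1
    · rw [← Real.rpow_natCast, ← Real.rpow_mul (by positivity)]; norm_num
    · rw [← Real.rpow_natCast, ← Real.rpow_natCast, ← Real.rpow_mul hn, ← Real.rpow_mul hn]
      congr 1
      push_cast
      ring

lemma lemM0 {φ : ℂ → ℂ} (hd : DifferentiableOn ℂ φ (Metric.ball 0 1))
    (hm : MapsTo φ (Metric.ball 0 1) (Metric.ball 0 1)) {k p q h : ℝ} (hk : 1 ≤ k)
    (hlow : 1 - ‖φ 0‖ ^ 2 ≤ k * ‖deriv φ 0‖) (hp0 : 0 ≤ p) (hp1 : p ≤ 1) (hq0 : 0 < q) (hq1 : q ≤ 1)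
    (hh : 0 < h) (hhk : h * (32 * k) ≤ 1) {Ψ : ℂ → ℝ} (hΨ : ∀ u, Ψ u = ‖deriv φ u‖ ^ p * (1 - ‖φ u‖ ^ 2) ^ q) :
    (Ψ h + Ψ (Complex.I * h) + Ψ (-h) + Ψ (-(Complex.I * h))) / 4 ≤ Ψ 0 *
      (1 - q * (1 - q) / k ^ 2 * h ^ 2 + 25 * k ^ 2 * (p ^ 2 + p * q) * h ^ 2 + 3000000 * k ^ 3 * h ^ 3) := by
  obtain ⟨ψ, hψd, hψ0, hψ1, hg, hder⟩ := normalise hd hm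
  have hζ : ‖φ 0‖ < 1 := by simpa using hm (Metric.mem_ball_self one_pos)
  set g := 1 - ‖φ 0‖ ^ 2 with hgdef
  have hgp : 0 < g := by nlinarith [norm_nonneg (φ 0)]
  have hd0 : ‖deriv φ 0‖ = ‖deriv ψ 0‖ * g := by
    have := hder 0 (by simp)
    simpa [hψ0] using this
  have hbk : 1 ≤ k * ‖deriv ψ 0‖ := by
    rw [hd0] at hlow
    by_contra hc
    push Not at hc
    nlinarith
  obtain ⟨hb1, H, hH0, hHd, hH8, hH1, hHn⟩ := mk_H hψd hψ0 hψ1 hζ hk hbk hp0 hp1 hq0 hq1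
  have hbp : 0 < ‖deriv ψ 0‖ := by
    rcases (norm_nonneg (deriv ψ 0)).eq_or_lt with h | h
    · rw [← h] at hbk; norm_num at hbk
    · exact h
  have hψ2 : ∀ u, ‖u‖ < 1 → ‖ψ u - deriv ψ 0 * u‖ ≤ 4 * ‖u‖ ^ 2 := by
    intro u hu
    have := taylor_two one_pos hψd (M := 1) (fun w hw => by
      have hw' : ‖w‖ < 1 := by simpa using hw
      exact (hψ1 w hw').trans hw'.le) hu
    simpa [hψ0] using this
  have hmain := four_avg hk hh hhk hp0 hp1 hq0 hq1 hb1 hbk hH0 hHd hH8 hH1 hψ1 hψ2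
  have hΨ0 : Ψ 0 = (‖deriv ψ 0‖ * g) ^ p * g ^ q := by rw [hΨ, hd0]
  have hΨ0p : 0 < Ψ 0 := by rw [hΨ0]; positivity
  have hone : ∀ u : ℂ, ‖u‖ = h → Ψ u ≤ Ψ 0 * (‖H u‖ ^ 2 * (1 - q * ‖ψ u‖ ^ 2)) := by
    intro u hu
    have hhη : h < 1 / (16 * k) := by
      rw [lt_div_iff₀ (by positivity)]; nlinarith
    have hu1 : ‖u‖ < 1 := by rw [hu]; nlinarith
    have hub : u ∈ Metric.ball (0 : ℂ) (1 / (16 * k)) := by simpa [hu] using hhη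
    have hψu := hψ1 u hu1
    have hx1 : ‖ψ u‖ ^ 2 < 1 := by nlinarith [norm_nonneg (ψ u)]
    have hb : (1 - ‖ψ u‖ ^ 2) ^ q ≤ 1 - q * ‖ψ u‖ ^ 2 := by
      have := rpow_one_add_le_one_add_mul_self (s := -‖ψ u‖ ^ 2) (by linarith) hq0.le hq1
      simpa [← sub_eq_add_neg] using this
    have hne : 1 + (starRingEnd ℂ) (φ 0) * ψ u ≠ 0 := by
      have := mob_den_ne (a := -φ 0) (z := ψ u) (by simpa using hζ) (by linarith)
      simpa using this
    set n := ‖1 + (starRingEnd ℂ) (φ 0) * ψ u‖ ^ 2 with hn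
    have hnp : 0 < n := by have := norm_pos_iff.2 hne; positivity
    have heq : Ψ u = Ψ 0 * (‖H u‖ ^ 2 * (1 - ‖ψ u‖ ^ 2) ^ q) := by
      rw [hΨ0, hΨ, hder u hu1, hg u hu1, hHn u hub, ← hn,
        Real.div_rpow (by positivity) hnp.le, Real.div_rpow (mul_nonneg hgp.le (by linarith)) hnp.le,
        Real.mul_rpow (norm_nonneg _) hgp.le, Real.mul_rpow hgp.le (by linarith), Real.mul_rpow hbp.le hgp.le,
        Real.div_rpow (norm_nonneg _) hbp.le, Real.rpow_neg hnp.le, Real.rpow_add hnp]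
      have h1 := (Real.rpow_pos_of_pos hbp p).ne'
      have h2 := (Real.rpow_pos_of_pos hnp p).ne'
      have h3 := (Real.rpow_pos_of_pos hnp q).ne'
      field_simp
    rw [heq]
    gcongr
  have n1 := hone h (by simp [abs_of_pos hh])
  have n2 := hone (Complex.I * h) (by simp [abs_of_pos hh])
  have n3 := hone (-h) (by simp [abs_of_pos hh])
  have n4 := hone (-(Complex.I * h)) (by simp [abs_of_pos hh])
  have := mul_le_mul_of_nonneg_left hmain hΨ0p.le
  linarith

lemma scale_facts {f : ℂ → ℂ} {x : ℂ} {d : ℝ} (hd : 0 < d) (hf : DifferentiableOn ℂ f (Metric.ball x d))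
    (hm : MapsTo f (Metric.ball x d) (Metric.ball 0 1)) :
    DifferentiableOn ℂ (fun u : ℂ => f (x + d * u)) (Metric.ball 0 1) ∧
    MapsTo (fun u : ℂ => f (x + d * u)) (Metric.ball 0 1) (Metric.ball 0 1) ∧
    ∀ u : ℂ, ‖u‖ < 1 → deriv (fun u : ℂ => f (x + d * u)) u = d * deriv f (x + d * u) := by
  have hmap : MapsTo (fun u : ℂ => x + d * u) (Metric.ball 0 1) (Metric.ball x d) := by
    intro u hu
    have hu' : ‖u‖ < 1 := by simpa using hu
    simp only [Metric.mem_ball, dist_eq_norm, add_sub_cancel_left, norm_mul, Complex.norm_real,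
      Real.norm_of_nonneg hd.le]
    nlinarith
  refine ⟨hf.comp ((differentiableOn_id.const_mul _).const_add x) hmap, hm.comp hmap, fun u hu => ?_⟩
  have h1 : HasDerivAt (fun u : ℂ => x + d * u) (d : ℂ) u := by
    simpa using ((hasDerivAt_id u).const_mul (d : ℂ)).const_add x
  have h2 := (hf.differentiableAt (Metric.isOpen_ball.mem_nhds (hmap (by simpa using hu)))).hasDerivAt
  have h3 : HasDerivAt (fun u : ℂ => f (x + d * u)) (deriv f (x + d * u) * d) u :=
    HasDerivAt.comp (h₂ := f) u h2 h1
  rw [h3.deriv]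
  ring

lemma lemM {f : ℂ → ℂ} {x : ℂ} {d k p q : ℝ} (hd : 0 < d) (hf : DifferentiableOn ℂ f (Metric.ball x d))
    (hm : MapsTo f (Metric.ball x d) (Metric.ball 0 1)) (hk : 1 ≤ k)
    (hlow : 1 - ‖f x‖ ^ 2 ≤ k * (d * ‖deriv f x‖)) (hp0 : 0 ≤ p) (hp1 : p ≤ 1) (hq0 : 0 < q) (hq1 : q ≤ 1)
    (hdk : 32 * k ≤ d) {Ψ : ℂ → ℝ} (hΨ : ∀ u, Ψ u = ‖deriv f u‖ ^ p * (1 - ‖f u‖ ^ 2) ^ q) :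
    (Ψ (x + 1) + Ψ (x + Complex.I) + Ψ (x - 1) + Ψ (x - Complex.I)) / 4 ≤ Ψ x *
      (1 - q * (1 - q) / k ^ 2 / d ^ 2 + 25 * k ^ 2 * (p ^ 2 + p * q) / d ^ 2 + 3000000 * k ^ 3 / d ^ 3) := by
  obtain ⟨h1, h2, h3⟩ := scale_facts hd hf hm
  have hnd : ∀ u : ℂ, ‖(d : ℂ) * u‖ = d * ‖u‖ := fun u => by
    rw [norm_mul, Complex.norm_real, Real.norm_of_nonneg hd.le]
  have hdc : (d : ℂ) ≠ 0 := by exact_mod_cast hd.ne'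
  have hd1 : 1 < d := by linarith
  have := lemM0 h1 h2 hk (h := 1 / d) (p := p) (q := q) (by
    rw [h3 0 (by simp)]; simpa [abs_of_pos hd] using hlow) hp0 hp1 hq0 hq1 (by positivity)
    (by rw [one_div_mul_eq_div]; exact (div_le_one hd).2 hdk) (fun u => rfl)
  have hdp : 0 < d ^ p := Real.rpow_pos_of_pos hd p
  have hval : ∀ u : ℂ, ‖u‖ < 1 → ‖deriv (fun u : ℂ => f (x + d * u)) u‖ ^ p * (1 - ‖f (x + d * u)‖ ^ 2) ^ q
      = d ^ p * Ψ (x + d * u) := by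
    intro u hu
    rw [h3 u hu, hnd, Real.mul_rpow hd.le (norm_nonneg _), hΨ]
    ring
  have hn1 : ‖((1 / d : ℝ) : ℂ)‖ < 1 := by
    rw [Complex.norm_real, Real.norm_of_nonneg (by positivity), div_lt_one hd]
    exact hd1
  rw [hval _ hn1, hval _ (by simpa using hn1), hval _ (by simpa using hn1), hval _ (by simpa using hn1),
    hval 0 (by simp)] at this
  have e1 : x + d * ((1 / d : ℝ) : ℂ) = x + 1 := by push_cast; field_simp
  have e2 : x + d * (Complex.I * ((1 / d : ℝ) : ℂ)) = x + Complex.I := by push_cast; field_simp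
  have e3 : x + d * (-((1 / d : ℝ) : ℂ)) = x - 1 := by push_cast; field_simp; ring
  have e4 : x + d * (-(Complex.I * ((1 / d : ℝ) : ℂ))) = x - Complex.I := by push_cast; field_simp; ring
  rw [e1, e2, e3, e4, mul_zero, add_zero] at this
  have h5 : d ^ p * ((Ψ (x + 1) + Ψ (x + Complex.I) + Ψ (x - 1) + Ψ (x - Complex.I)) / 4) ≤ d ^ p * (Ψ x *
      (1 - q * (1 - q) / k ^ 2 / d ^ 2 + 25 * k ^ 2 * (p ^ 2 + p * q) / d ^ 2 + 3000000 * k ^ 3 / d ^ 3)) := by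
    refine le_trans (le_of_eq ?_) (this.trans (le_of_eq ?_))
    · ring
    · field_simp
  exact le_of_mul_le_mul_left h5 hdp

lemma g_harnack {f : ℂ → ℂ} {x : ℂ} {d : ℝ} (hd : 0 < d) (hf : DifferentiableOn ℂ f (Metric.ball x d))
    (hm : MapsTo f (Metric.ball x d) (Metric.ball 0 1)) {z : ℂ} (hz : 4 * ‖z - x‖ ≤ d) :
    1 - ‖f z‖ ^ 2 ≤ 2 * (1 - ‖f x‖ ^ 2) ∧ (1 - ‖f x‖ ^ 2) / 2 ≤ 1 - ‖f z‖ ^ 2 := by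
  obtain ⟨h1, h2, -⟩ := scale_facts hd hf hm
  obtain ⟨ψ, hψd, hψ0, hψ1, hg, -⟩ := normalise h1 h2
  have hdc : (d : ℂ) ≠ 0 := by exact_mod_cast hd.ne'
  have hu : ‖(z - x) / d‖ ≤ 1 / 4 := by
    rw [norm_div, Complex.norm_real, Real.norm_of_nonneg hd.le, div_le_div_iff₀ hd (by norm_num)]
    linarith
  have hzx : x + d * ((z - x) / d) = z := by field_simp; ring
  have e := hg ((z - x) / d) (by linarith)
  simp only [hzx, mul_zero, add_zero] at e
  have hx : ‖f x‖ < 1 := by simpa using hm (Metric.mem_ball_self hd)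
  have hgp : 0 < 1 - ‖f x‖ ^ 2 := by nlinarith [norm_nonneg (f x)]
  have hψ := (hψ1 ((z - x) / d) (by linarith)).trans hu
  set y := ψ ((z - x) / d)
  have hc : ‖(starRingEnd ℂ) (f x) * y‖ ≤ 1 / 4 := by
    rw [norm_mul, RCLike.norm_conj]; nlinarith [norm_nonneg (f x), norm_nonneg y]
  have hl : 3 / 4 ≤ ‖1 + (starRingEnd ℂ) (f x) * y‖ := by
    have := norm_sub_le (1 + (starRingEnd ℂ) (f x) * y) ((starRingEnd ℂ) (f x) * y)
    rw [add_sub_cancel_right, norm_one] at this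
    linarith
  have hup : ‖1 + (starRingEnd ℂ) (f x) * y‖ ≤ 5 / 4 := by
    have := norm_add_le 1 ((starRingEnd ℂ) (f x) * y)
    rw [norm_one] at this
    linarith
  set n := ‖1 + (starRingEnd ℂ) (f x) * y‖
  have hy2 : ‖y‖ ^ 2 ≤ 1 / 16 := by nlinarith [norm_nonneg y]
  have hn2 : 9 / 16 ≤ n ^ 2 := by nlinarith
  have hn3 : n ^ 2 ≤ 25 / 16 := by nlinarith
  rw [e]
  constructor
  · rw [div_le_iff₀ (by positivity)]
    nlinarith [sq_nonneg ‖y‖]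
  · rw [le_div_iff₀ (by positivity)]
    nlinarith [sq_nonneg ‖y‖]

/-- average over the four neighbours -/
def av (F : ℤ × ℤ → ℝ) (y : ℤ × ℤ) : ℝ :=
  (F (y.1 + 1, y.2) + F (y.1 - 1, y.2) + F (y.1, y.2 + 1) + F (y.1, y.2 - 1)) / 4

lemma nbrs_sum (F : ℤ × ℤ → ℝ) (y : ℤ × ℤ) : (1 / 4) * ∑ w ∈ nbrs y, F w = av F y := by
  unfold nbrs av
  rw [Finset.sum_insert, Finset.sum_insert, Finset.sum_insert, Finset.sum_singleton]
  · ring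
  · simp; omega
  · simp
  · simp; omega

lemma mem_nbrs {w y : ℤ × ℤ} : w ∈ nbrs y ↔ w = (y.1 + 1, y.2) ∨ w = (y.1 - 1, y.2) ∨
    w = (y.1, y.2 + 1) ∨ w = (y.1, y.2 - 1) := by simp [nbrs]

lemma av_mono {F G : ℤ × ℤ → ℝ} {y : ℤ × ℤ} (h : ∀ w ∈ nbrs y, F w ≤ G w) : av F y ≤ av G y := by
  unfold av
  have h1 := h (y.1 + 1, y.2) (by simp [mem_nbrs])
  have h2 := h (y.1 - 1, y.2) (by simp [mem_nbrs])
  have h3 := h (y.1, y.2 + 1) (by simp [mem_nbrs])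
  have h4 := h (y.1, y.2 - 1) (by simp [mem_nbrs])
  linarith

/-- maximum principle -/
lemma maxp (D : Finset (ℤ × ℤ)) (F : ℤ × ℤ → ℝ) (hs : ∀ y ∈ D, F y ≤ av F y)
    (hb : ∀ y ∈ D, ∀ w ∈ nbrs y, w ∉ D → F w ≤ 0) : ∀ y ∈ D, F y ≤ 0 := by
  by_contra! hcon
  obtain ⟨y0, hy0, hpos⟩ := hcon
  obtain ⟨y1, hy1, hmax⟩ := D.exists_max_image F ⟨y0, hy0⟩
  obtain ⟨y, hy, hm⟩ := (D.filter (fun z => F y1 ≤ F z)).exists_max_image (fun z => z.1)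
    ⟨y1, by simp [hy1]⟩
  rw [Finset.mem_filter] at hy
  have hM : 0 < F y := by linarith [hmax y0 hy0, hy.2]
  have hle : ∀ w ∈ nbrs y, F w ≤ F y := by
    intro w hw
    by_cases hwD : w ∈ D
    · exact (hmax w hwD).trans hy.2
    · exact (hb y hy.1 w hw hwD).trans hM.le
  have h1 := hle (y.1 + 1, y.2) (by simp [mem_nbrs])
  have h2 := hle (y.1 - 1, y.2) (by simp [mem_nbrs])
  have h3 := hle (y.1, y.2 + 1) (by simp [mem_nbrs])
  have h4 := hle (y.1, y.2 - 1) (by simp [mem_nbrs])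
  have h5 := hs y hy.1
  unfold av at h5
  have h6 : F y ≤ F (y.1 + 1, y.2) := by linarith
  have h7 : (y.1 + 1, y.2) ∈ D := by
    by_contra hc
    have := hb y hy.1 _ (by simp [mem_nbrs]) hc
    linarith
  have := hm (y.1 + 1, y.2) (by simp only [Finset.mem_filter]; exact ⟨h7, hy.2.trans h6⟩)
  simp at this

lemma hit_partial (A K : Set (ℤ × ℤ)) (hA : A ⊆ K) (S : Finset (ℤ × ℤ)) (hS : (S : Set (ℤ × ℤ)) = A) (n : ℕ) (y : ℤ × ℤ) :
    ∑ k ∈ Finset.range (n + 1), ∑ u ∈ S, hitStep K k y u =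
      if y ∈ K then (if y ∈ A then 1 else 0)
      else av (fun w => ∑ k ∈ Finset.range n, ∑ u ∈ S, hitStep K k w u) y := by
  rw [Finset.sum_range_succ']
  by_cases hy : y ∈ K
  · rw [if_pos hy]
    have : ∀ k u, hitStep K (k + 1) y u = 0 := fun k u => by simp [hitStep, hy]
    have hyA : y ∈ A ↔ y ∈ S := by rw [← hS]; simp
    simp [this, hitStep, hy, hyA]
  · rw [if_neg hy]
    have h0 : ∀ u, hitStep K 0 y u = 0 := fun u => by simp [hitStep, hy]
    have h1 : ∀ k u, hitStep K (k + 1) y u = av (fun w => hitStep K k w u) y := fun k u => by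
      rw [← nbrs_sum]; simp [hitStep, hy]
    simp only [h0, h1, Finset.sum_const_zero, add_zero]
    simp only [av, ← Finset.sum_div, Finset.sum_add_distrib]

lemma hitStep_nonneg (K : Set (ℤ × ℤ)) (k : ℕ) : ∀ y u, 0 ≤ hitStep K k y u := by
  induction k with
  | zero => intro y u; simp only [hitStep]; split_ifs <;> norm_num
  | succ k ih =>
    intro y u
    simp only [hitStep]
    split_ifs
    · exact le_rfl
    · exact mul_nonneg (by norm_num) (Finset.sum_nonneg fun w _ => ih w u)

lemma hm_facts (A K : Set (ℤ × ℤ)) (hA : A ⊆ K) (hfin : A.Finite) :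
    (∀ y, 0 ≤ hmSet y A K) ∧ (∀ y, hmSet y A K ≤ 1) ∧ (∀ y ∈ A, hmSet y A K = 1) ∧
    (∀ y ∈ K, y ∉ A → hmSet y A K = 0) ∧ (∀ y, y ∉ K → hmSet y A K = av (fun w => hmSet w A K) y) := by
  set S := hfin.toFinset with hSdef
  have hS : (S : Set (ℤ × ℤ)) = A := hfin.coe_toFinset
  set P : ℕ → ℤ × ℤ → ℝ := fun n y => ∑ k ∈ Finset.range n, ∑ u ∈ S, hitStep K k y u with hP
  have hrec := hit_partial A K hA S hS
  have hP1 : ∀ n y, P n y ≤ 1 := by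
    intro n
    induction n with
    | zero => intro y; simp [hP]
    | succ n ih =>
      intro y
      have := hrec n y
      change P (n + 1) y = _ at this
      rw [this]
      split_ifs
      · exact le_rfl
      · norm_num
      · change av (P n) y ≤ 1
        unfold av
        linarith [ih (y.1 + 1, y.2), ih (y.1 - 1, y.2), ih (y.1, y.2 + 1), ih (y.1, y.2 - 1)]
  have hsum : ∀ y u, u ∈ S → Summable (fun k => hitStep K k y u) := by
    intro y u hu
    refine summable_of_sum_range_le (c := 1) (fun k => hitStep_nonneg K k y u) (fun n => ?_)
    refine le_trans ?_ (hP1 n y)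
    refine Finset.sum_le_sum fun k _ => ?_
    exact Finset.single_le_sum (f := fun u => hitStep K k y u) (fun u _ => hitStep_nonneg K k y u) hu
  have hval : ∀ y, hmSet y A K = ∑ u ∈ S, hm y u K := by
    intro y
    unfold hmSet
    rw [← hS]
    exact Finset.tsum_subtype S (fun u => hm y u K)
  have hlim : ∀ y, Filter.Tendsto (fun n => P n y) Filter.atTop (nhds (hmSet y A K)) := by
    intro y
    have h1 : HasSum (fun k => ∑ u ∈ S, hitStep K k y u) (∑ u ∈ S, hm y u K) :=
      hasSum_sum fun u hu => (hsum y u hu).hasSum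
    rw [hval]
    exact h1.tendsto_sum_nat
  have hlim1 : ∀ y, Filter.Tendsto (fun n => P (n + 1) y) Filter.atTop (nhds (hmSet y A K)) := fun y =>
    (hlim y).comp (Filter.tendsto_add_atTop_nat 1)
  refine ⟨fun y => ?_, fun y => ?_, fun y hy => ?_, fun y hy hyA => ?_, fun y hy => ?_⟩
  · rw [hval]
    exact Finset.sum_nonneg fun u _ => tsum_nonneg fun k => hitStep_nonneg K k y u
  · exact le_of_tendsto' (hlim y) fun n => hP1 n y
  · refine tendsto_nhds_unique (hlim1 y) ?_
    have : ∀ n, P (n + 1) y = 1 := fun n => by rw [hP]; simp only; rw [hrec, if_pos (hA hy), if_pos hy]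
    simp [this]
  · refine tendsto_nhds_unique (hlim1 y) ?_
    have : ∀ n, P (n + 1) y = 0 := fun n => by rw [hP]; simp only; rw [hrec, if_pos hy, if_neg hyA]
    simp [this]
  · refine tendsto_nhds_unique (hlim1 y) ?_
    have : ∀ n, P (n + 1) y = av (P n) y := fun n => by
      rw [hP]; simp only; rw [hrec, if_neg hy]
    simp only [this, av]
    exact ((((hlim _).add (hlim _)).add (hlim _)).add (hlim _)).div_const 4

lemma sbp_shift (F G : ℤ × ℤ → ℝ) (e : ℤ × ℤ) : ∑' y, F y * G (y + e) = ∑' y, F (y - e) * G y := by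
  rw [← (Equiv.addRight e).tsum_eq (fun y => F (y - e) * G y)]
  simp

lemma sbp (F G : ℤ × ℤ → ℝ) (hF : (Function.support F).Finite) :
    ∑' y, F y * av G y = ∑' y, av F y * G y := by
  have e1 : ∀ y : ℤ × ℤ, F y * av G y = (1 / 4) * (F y * G (y + (1, 0)) + F y * G (y + (-1, 0)) + F y * G (y + (0, 1)) +
      F y * G (y + (0, -1))) := by
    rintro ⟨a, b⟩; simp only [av, Prod.mk_add_mk, add_zero, ← sub_eq_add_neg]; ring
  have e2 : ∀ y : ℤ × ℤ, av F y * G y = (1 / 4) * (F (y - (1, 0)) * G y + F (y - (-1, 0)) * G y + F (y - (0, 1)) * G y +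
      F (y - (0, -1)) * G y) := by
    rintro ⟨a, b⟩; simp only [av, Prod.mk_sub_mk, sub_zero, sub_neg_eq_add]; ring
  have s1 : ∀ e : ℤ × ℤ, Summable (fun y => F y * G (y + e)) := fun e =>
    summable_of_finite_support (hF.subset (fun y hy => by
      simp only [Function.mem_support] at hy ⊢
      exact left_ne_zero_of_mul hy))
  have s2 : ∀ e : ℤ × ℤ, Summable (fun y => F (y - e) * G y) := fun e => by
    rw [← (Equiv.addRight e).summable_iff]
    convert s1 e using 1
    funext y; simp
  simp only [e1, e2, tsum_mul_left]
  rw [(((s1 _).add (s1 _)).add (s1 _)).tsum_add (s1 _), ((s1 _).add (s1 _)).tsum_add (s1 _), (s1 _).tsum_add (s1 _),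
    (((s2 _).add (s2 _)).add (s2 _)).tsum_add (s2 _), ((s2 _).add (s2 _)).tsum_add (s2 _), (s2 _).tsum_add (s2 _)]
  simp only [sbp_shift]

/-- Green-type inequality -/
lemma green_ineq (D X : Finset (ℤ × ℤ)) (hDX : Disjoint D X) (w P : ℤ × ℤ → ℝ) (v : ℤ × ℤ) (c : ℝ) (hv : v ∈ D)
    (hw0 : ∀ y, 0 ≤ w y) (hwh : ∀ y ∈ D, w y = av w y) (hw1 : ∀ y ∈ X, w y = 1)
    (hwz : ∀ y, y ∉ D → y ∉ X → w y = 0) (hPz : ∀ y, y ∉ D → P y = 0)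
    (hP : ∀ y ∈ D, av P y ≤ P y) (hPv : av P v ≤ P v - c) :
    c * w v ≤ ∑ x ∈ X, av P x := by
  have h := sbp P w (D.finite_toSet.subset (fun y hy => by
    by_contra hc; exact hy (hPz y hc)))
  have hl : ∑' y, P y * av w y = ∑ y ∈ D, P y * w y := by
    rw [tsum_eq_sum (s := D) (fun y hy => by rw [hPz y hy, zero_mul])]
    exact Finset.sum_congr rfl fun y hy => by rw [← hwh y hy]
  have hr : ∑' y, av P y * w y = ∑ y ∈ D, av P y * w y + ∑ x ∈ X, av P x := by
    rw [tsum_eq_sum (s := D ∪ X) (fun y hy => by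
      rw [Finset.mem_union, not_or] at hy
      rw [hwz y hy.1 hy.2, mul_zero]), Finset.sum_union hDX]
    congr 1
    exact Finset.sum_congr rfl fun y hy => by rw [hw1 y hy, mul_one]
  rw [hl, hr] at h
  have h2 : ∑ y ∈ D, av P y * w y + c * w v ≤ ∑ y ∈ D, P y * w y := by
    rw [← Finset.add_sum_erase _ _ hv, ← Finset.add_sum_erase D (fun y => P y * w y) hv]
    have h3 : ∑ y ∈ D.erase v, av P y * w y ≤ ∑ y ∈ D.erase v, P y * w y :=
      Finset.sum_le_sum fun y hy => mul_le_mul_of_nonneg_right (hP y (Finset.mem_of_mem_erase hy)) (hw0 y)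
    nlinarith [hw0 v]
  linarith

/-- squared Euclidean norm of a lattice point -/
def r2 (y : ℤ × ℤ) : ℝ := (y.1 : ℝ) ^ 2 + (y.2 : ℝ) ^ 2

lemma r2_pt (x y : ℤ × ℤ) : r2 (x - y) = ‖pt x - pt y‖ ^ 2 := by
  rw [Complex.sq_norm, Complex.normSq_apply]
  simp [r2, pt]; ring

lemma log_four {a b c e s : ℝ} (ha : 0 < a) (hb : 0 < b) (hc : 0 < c) (he : 0 < e) :
    Real.log (a * b * (c * e)) = Real.log a + Real.log b + Real.log c + Real.log e := by
  rw [Real.log_mul (by positivity) (by positivity), Real.log_mul ha.ne' hb.ne', Real.log_mul hc.ne' he.ne']; ring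

lemma log_sub (x y : ℝ) : 4 * Real.log (x ^ 2 + y ^ 2 + 1 / 2) ≤ Real.log ((x + 1) ^ 2 + y ^ 2 + 1 / 2) +
    Real.log ((x - 1) ^ 2 + y ^ 2 + 1 / 2) + Real.log (x ^ 2 + (y + 1) ^ 2 + 1 / 2) +
    Real.log (x ^ 2 + (y - 1) ^ 2 + 1 / 2) := by
  rw [← log_four (s := 0) (by positivity) (by positivity) (by positivity) (by positivity)]
  have : 4 * Real.log (x ^ 2 + y ^ 2 + 1 / 2) = Real.log ((x ^ 2 + y ^ 2 + 1 / 2) ^ 4) := by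
    rw [Real.log_pow]; norm_num
  rw [this]
  refine Real.log_le_log (by positivity) ?_
  nlinarith [sq_nonneg (x * y), sq_nonneg x, sq_nonneg y]

def Lf (t : ℝ) : ℝ := t - 1 - Real.log t

lemma Lf_nonneg {t : ℝ} (ht : 0 < t) : 0 ≤ Lf t := by
  unfold Lf; linarith [Real.log_le_sub_one_of_pos ht]

lemma Lf_le {t : ℝ} (ht : 0 < t) : Lf t ≤ (t - 1) ^ 2 / t := by
  have h := Real.log_le_sub_one_of_pos (inv_pos.2 ht)
  rw [Real.log_inv] at h
  unfold Lf
  have : (t - 1) ^ 2 / t = t - 1 + (t⁻¹ - 1) := by field_simp; ring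
  linarith

def ph (m : ℝ) (x y : ℝ) : ℝ := Lf (min ((x ^ 2 + y ^ 2 + 1 / 2) / m) 1)

lemma ph_nonneg {m : ℝ} (hm : 0 < m) (x y : ℝ) : 0 ≤ ph m x y :=
  Lf_nonneg (lt_min (by positivity) one_pos)

lemma ph_le {m : ℝ} (hm : 0 < m) (x y : ℝ) : ph m x y ≤ Lf ((x ^ 2 + y ^ 2 + 1 / 2) / m) := by
  unfold ph
  rcases le_total ((x ^ 2 + y ^ 2 + 1 / 2) / m) 1 with h | h
  · rw [min_eq_left h]
  · rw [min_eq_right h]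
    have := Lf_nonneg (t := (x ^ 2 + y ^ 2 + 1 / 2) / m) (by positivity)
    simpa [Lf] using this

lemma ph_zero {m : ℝ} (hm : 0 < m) {x y : ℝ} (h : m ≤ x ^ 2 + y ^ 2 + 1 / 2) : ph m x y = 0 := by
  unfold ph
  rw [min_eq_right ((one_le_div hm).2 h)]; simp [Lf]

lemma ph_near {m : ℝ} (hm : 36 ≤ m) {x y x' y' : ℝ} (h : m ≤ x ^ 2 + y ^ 2 + 1 / 2)
    (hd : (x' = x + 1 ∧ y' = y) ∨ (x' = x - 1 ∧ y' = y) ∨ (x' = x ∧ y' = y + 1) ∨ (x' = x ∧ y' = y - 1)) :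
    ph m x' y' ≤ 18 / m := by
  have hm0 : 0 < m := by linarith
  rcases le_total m (x' ^ 2 + y' ^ 2 + 1 / 2) with h1 | h1
  · rw [ph_zero hm0 h1]; positivity
  refine (ph_le hm0 x' y').trans ?_
  set t := (x' ^ 2 + y' ^ 2 + 1 / 2) / m with ht
  have htm : t * m = x' ^ 2 + y' ^ 2 + 1 / 2 := by rw [ht]; field_simp
  have h2 : ((1 - t) * m) ^ 2 ≤ 9 * m := by
    have e0 : 0 ≤ (1 - t) * m := by nlinarith
    have key : ∀ z : ℝ, (1 - t) * m ≤ 2 * z + 1 → z ^ 2 ≤ m → ((1 - t) * m) ^ 2 ≤ 9 * m := by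
      intro z hz1 hz2
      have : ((1 - t) * m) ^ 2 ≤ (2 * z + 1) ^ 2 := by gcongr
      nlinarith [sq_nonneg (2 * z - 1)]
    rcases hd with ⟨rfl, rfl⟩ | ⟨rfl, rfl⟩ | ⟨rfl, rfl⟩ | ⟨rfl, rfl⟩
    · exact key (-(x + 1)) (by nlinarith) (by nlinarith)
    · exact key (x - 1) (by nlinarith) (by nlinarith)
    · exact key (-(y + 1)) (by nlinarith) (by nlinarith)
    · exact key (y - 1) (by nlinarith) (by nlinarith)
  have h3 : (1 - t) ^ 2 ≤ 9 / m := by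
    rw [le_div_iff₀ hm0]
    have : (1 - t) ^ 2 * m * m ≤ 9 * m := by nlinarith
    exact le_of_mul_le_mul_right this hm0
  have h4 : 9 / m ≤ 1 / 4 := by rw [div_le_div_iff₀ hm0 (by norm_num)]; linarith
  have ht0 : 1 / 2 ≤ t := by nlinarith
  refine (Lf_le (by linarith)).trans ?_
  rw [div_le_iff₀ (by linarith)]
  have : 18 / m = 2 * (9 / m) := by ring
  rw [this]
  nlinarith [sq_nonneg (1 - t)]

/-- the cut-off logarithmic potential around `v` -/
def phi (m : ℝ) (v y : ℤ × ℤ) : ℝ := ph m ((y.1 : ℝ) - v.1) ((y.2 : ℝ) - v.2)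

lemma av_phi (m : ℝ) (v y : ℤ × ℤ) : av (phi m v) y =
    (ph m ((y.1 : ℝ) - v.1 + 1) ((y.2 : ℝ) - v.2) + ph m ((y.1 : ℝ) - v.1 - 1) ((y.2 : ℝ) - v.2) +
     ph m ((y.1 : ℝ) - v.1) ((y.2 : ℝ) - v.2 + 1) + ph m ((y.1 : ℝ) - v.1) ((y.2 : ℝ) - v.2 - 1)) / 4 := by
  simp only [av, phi]
  push_cast
  rw [show (y.1 : ℝ) + 1 - v.1 = y.1 - v.1 + 1 by ring, show (y.1 : ℝ) - 1 - v.1 = y.1 - v.1 - 1 by ring,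
    show (y.2 : ℝ) + 1 - v.2 = y.2 - v.2 + 1 by ring, show (y.2 : ℝ) - 1 - v.2 = y.2 - v.2 - 1 by ring]

lemma phi_av {m : ℝ} (hm : 36 ≤ m) (v y : ℤ × ℤ) : av (phi m v) y ≤ phi m v y + 18 / m := by
  have hm0 : 0 < m := by linarith
  rw [av_phi]
  simp only [phi]
  set a : ℝ := (y.1 : ℝ) - v.1
  set b : ℝ := (y.2 : ℝ) - v.2
  rcases le_total m (a ^ 2 + b ^ 2 + 1 / 2) with h | h
  · have h1 := ph_near hm (x' := a + 1) (y' := b) h (by simp)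
    have h2 := ph_near hm (x' := a - 1) (y' := b) h (by simp)
    have h3 := ph_near hm (x' := a) (y' := b + 1) h (by simp)
    have h4 := ph_near hm (x' := a) (y' := b - 1) h (by simp)
    linarith [ph_nonneg hm0 a b]
  · have h1 := ph_le hm0 (a + 1) b
    have h2 := ph_le hm0 (a - 1) b
    have h3 := ph_le hm0 a (b + 1)
    have h4 := ph_le hm0 a (b - 1)
    have h0 : ph m a b = Lf ((a ^ 2 + b ^ 2 + 1 / 2) / m) := by
      unfold ph; rw [min_eq_left ((div_le_one hm0).2 h)]
    have hl := log_sub a b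
    unfold Lf at *
    rw [Real.log_div (by positivity) hm0.ne'] at h0 h1 h2 h3 h4
    have e : ((a + 1) ^ 2 + b ^ 2 + 1 / 2) / m + ((a - 1) ^ 2 + b ^ 2 + 1 / 2) / m + (a ^ 2 + (b + 1) ^ 2 + 1 / 2) / m
      + (a ^ 2 + (b - 1) ^ 2 + 1 / 2) / m = 4 * ((a ^ 2 + b ^ 2 + 1 / 2) / m) + 4 * (1 / m) := by ring
    have e2 : 1 / m ≤ 18 / m := by gcongr; norm_num
    linarith

lemma phi_far {m : ℝ} (hm : 36 ≤ m) (v y : ℤ × ℤ) (h : 4 * m < r2 (y - v)) : av (phi m v) y ≤ phi m v y := by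
  have hm0 : 0 < m := by linarith
  rw [av_phi]
  simp only [phi]
  simp only [r2, Prod.fst_sub, Prod.snd_sub] at h
  push_cast at h
  set a : ℝ := (y.1 : ℝ) - v.1
  set b : ℝ := (y.2 : ℝ) - v.2
  rw [ph_zero hm0 (x := a + 1) (y := b) (by nlinarith [sq_nonneg (a + 2), sq_nonneg b]),
    ph_zero hm0 (x := a - 1) (y := b) (by nlinarith [sq_nonneg (a - 2), sq_nonneg b]),
    ph_zero hm0 (x := a) (y := b + 1) (by nlinarith [sq_nonneg (b + 2), sq_nonneg a]),
    ph_zero hm0 (x := a) (y := b - 1) (by nlinarith [sq_nonneg (b - 2), sq_nonneg a])]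
  simpa using ph_nonneg hm0 a b

lemma phi_ctr {m : ℝ} (hm : 36 ≤ m) (v : ℤ × ℤ) : av (phi m v) v ≤ phi m v v - 1 / 2 := by
  have hm0 : 0 < m := by linarith
  rw [av_phi]
  simp only [phi, sub_self]
  have h1 := ph_le hm0 (0 + 1) 0
  have h2 := ph_le hm0 (0 - 1) 0
  have h3 := ph_le hm0 0 (0 + 1)
  have h4 := ph_le hm0 0 (0 - 1)
  have h0 : ph m 0 0 = Lf ((0 ^ 2 + 0 ^ 2 + 1 / 2) / m) := by
    unfold ph; rw [min_eq_left ((div_le_one hm0).2 (by norm_num; linarith))]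
  norm_num at h0 h1 h2 h3 h4 ⊢
  have hl : Lf (3 / 2 / m) = Lf (1 / 2 / m) + 1 / m - Real.log 3 := by
    unfold Lf
    rw [show (3 : ℝ) / 2 / m = 3 * (1 / 2 / m) by ring, Real.log_mul (by norm_num) (by positivity)]
    ring
  have h5 : 1 / m ≤ 1 / 36 := by gcongr
  have h6 : (1 : ℝ) ≤ Real.log 3 := by
    rw [Real.le_log_iff_exp_le (by norm_num)]
    linarith [Real.exp_one_lt_d9]
  linarith

def kv (y : ℤ × ℤ) : ℝ := if y = 0 then 1 / 128 else r2 y - 1 / 2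

lemma kv_pos (y : ℤ × ℤ) : 0 < kv y := by
  unfold kv
  split_ifs with h
  · norm_num
  · have h1 : (1 : ℤ) ≤ y.1 ^ 2 + y.2 ^ 2 := by
      by_contra hc
      have h2 : y.1 ^ 2 + y.2 ^ 2 = 0 := by nlinarith [sq_nonneg y.1, sq_nonneg y.2]
      have h3 : y.1 = 0 := by nlinarith [sq_nonneg y.1, sq_nonneg y.2]
      have h4 : y.2 = 0 := by nlinarith [sq_nonneg y.1, sq_nonneg y.2]
      exact h (Prod.ext h3 h4)
    have h2 : (1 : ℝ) ≤ r2 y := by unfold r2; exact_mod_cast h1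
    linarith

def kf (y : ℤ × ℤ) : ℝ := Real.log (kv y)

lemma kf_super {y : ℤ × ℤ} (hy : y ≠ 0) : av kf y ≤ kf y := by
  have hprod : kv (y.1 + 1, y.2) * kv (y.1 - 1, y.2) * (kv (y.1, y.2 + 1) * kv (y.1, y.2 - 1)) ≤ kv y ^ 4 := by
    obtain ⟨a, b⟩ := y
    by_cases h1 : a = 1 ∧ b = 0
    · obtain ⟨rfl, rfl⟩ := h1; norm_num [kv, r2]
    by_cases h2 : a = -1 ∧ b = 0
    · obtain ⟨rfl, rfl⟩ := h2; norm_num [kv, r2]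
    by_cases h3 : a = 0 ∧ b = 1
    · obtain ⟨rfl, rfl⟩ := h3; norm_num [kv, r2]
    by_cases h4 : a = 0 ∧ b = -1
    · obtain ⟨rfl, rfl⟩ := h4; norm_num [kv, r2]
    have n1 : ((a + 1, b) : ℤ × ℤ) ≠ 0 := by simp only [ne_eq, Prod.mk_eq_zero]; omega
    have n2 : ((a - 1, b) : ℤ × ℤ) ≠ 0 := by simp only [ne_eq, Prod.mk_eq_zero]; omega
    have n3 : ((a, b + 1) : ℤ × ℤ) ≠ 0 := by simp only [ne_eq, Prod.mk_eq_zero]; omega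
    have n4 : ((a, b - 1) : ℤ × ℤ) ≠ 0 := by simp only [ne_eq, Prod.mk_eq_zero]; omega
    simp only [kv, if_neg n1, if_neg n2, if_neg n3, if_neg n4, if_neg hy, r2]
    push_cast
    nlinarith [sq_nonneg ((a : ℝ) ^ 2 - (b : ℝ) ^ 2)]
  have h1 := Real.log_le_log (mul_pos (mul_pos (kv_pos _) (kv_pos _)) (mul_pos (kv_pos _) (kv_pos _))) hprod
  rw [log_four (s := 0) (kv_pos _) (kv_pos _) (kv_pos _) (kv_pos _), Real.log_pow] at h1
  unfold av kf
  norm_num at h1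
  linarith

/-- lattice square -/
def bx (a : ℤ × ℤ) (M : ℕ) : Finset (ℤ × ℤ) :=
  Finset.Icc (a.1 - M) (a.1 + M) ×ˢ Finset.Icc (a.2 - M) (a.2 + M)

lemma bx_card (a : ℤ × ℤ) (M : ℕ) : (bx a M).card = (2 * M + 1) ^ 2 := by
  unfold bx
  rw [Finset.card_product, Int.card_Icc, Int.card_Icc, sq]
  congr 1 <;> omega

lemma mem_bx {a y : ℤ × ℤ} {M : ℕ} (h : ‖pt y - pt a‖ ≤ M) : y ∈ bx a M := by
  have h1 := (Complex.abs_re_le_norm (pt y - pt a)).trans h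
  have h2 := (Complex.abs_im_le_norm (pt y - pt a)).trans h
  simp only [pt, Complex.sub_re, Complex.sub_im] at h1 h2
  have h1' : |y.1 - a.1| ≤ (M : ℤ) := by exact_mod_cast h1
  have h2' : |y.2 - a.2| ≤ (M : ℤ) := by exact_mod_cast h2
  rw [abs_le] at h1' h2'
  simp only [bx, Finset.mem_product, Finset.mem_Icc]
  omega

lemma nbr_dist {w y : ℤ × ℤ} (h : w ∈ nbrs y) : ‖pt w - pt y‖ = 1 := by
  have h1 : r2 (w - y) = 1 := by
    rw [mem_nbrs] at h
    rcases h with rfl | rfl | rfl | rfl <;> simp [r2]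
  rw [r2_pt] at h1
  have := norm_nonneg (pt w - pt y)
  nlinarith

def l1 (x y : ℤ × ℤ) : ℤ := |x.1 - y.1| + |x.2 - y.2|

lemma l1_tri (x y z : ℤ × ℤ) : l1 x z ≤ l1 x y + l1 y z := by
  unfold l1
  linarith [abs_sub_le x.1 y.1 z.1, abs_sub_le x.2 y.2 z.2]

lemma l1_comm (x y : ℤ × ℤ) : l1 x y = l1 y x := by
  unfold l1; rw [abs_sub_comm x.1, abs_sub_comm x.2]

lemma l1_le_norm (x y : ℤ × ℤ) : ‖pt x - pt y‖ ≤ l1 x y := by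
  have := Complex.norm_le_abs_re_add_abs_im (pt x - pt y)
  simp only [pt, Complex.sub_re, Complex.sub_im] at this
  unfold l1; push_cast; exact this

lemma l1_sq (x y : ℤ × ℤ) : ((l1 x y : ℤ) : ℝ) ^ 2 ≤ 2 * r2 (x - y) := by
  unfold l1 r2
  push_cast
  simp only [Prod.fst_sub, Prod.snd_sub, Int.cast_sub]
  rw [← sq_abs ((x.1 : ℝ) - y.1), ← sq_abs ((x.2 : ℝ) - y.2)]
  nlinarith [sq_nonneg (|(x.1 : ℝ) - y.1| - |(x.2 : ℝ) - y.2|)]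

lemma ivt_conn {C : Set (ℤ × ℤ)} (hC : LatticeConnected C) {a b : ℤ × ℤ} (ha : a ∈ C) (hb : b ∈ C) (t : ℤ) (ht0 : 0 < t)
    (ht : t ≤ l1 b a) : ∃ c ∈ C, l1 c a = t := by
  obtain ⟨m, p, hp0, hpm, hpC, hadj⟩ := hC a ha b hb
  have hex : ∃ i, i ≤ m ∧ t ≤ l1 (p i) a := ⟨m, le_rfl, by rw [hpm]; exact ht⟩
  obtain ⟨him, hti⟩ := Nat.find_spec hex
  set i := Nat.find hex with hi
  refine ⟨p i, hpC i him, le_antisymm ?_ hti⟩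
  rcases Nat.eq_zero_or_pos i with h0 | h0
  · rw [h0, hp0] at hti ⊢
    simp [l1] at hti; omega
  · have hlt := Nat.find_min hex (m := i - 1) (by omega)
    have h1 := hadj (i - 1) (by omega)
    rw [show i - 1 + 1 = i by omega] at h1
    have h2 := l1_tri (p i) (p (i - 1)) a
    have h3 : l1 (p i) (p (i - 1)) = 1 := by rw [l1_comm]; exact h1
    have h4 : ¬ t ≤ l1 (p (i - 1)) a := fun h => hlt ⟨by omega, h⟩
    omega

lemma sum_log_le (n : ℕ) (hn : 1 ≤ n) : ∑ m ∈ Finset.Icc 1 n, Real.log (n / m) ≤ n := by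
  have h1 : ∀ k : ℕ, ∑ m ∈ Finset.Icc 1 k, Real.log (n / m) = Real.log ((n : ℝ) ^ k / k.factorial) := by
    intro k
    induction k with
    | zero => simp
    | succ k ih =>
      rw [Finset.sum_Icc_succ_top (by omega), ih, ← Real.log_mul (by positivity) (by positivity), Nat.factorial_succ]
      congr 1
      push_cast
      field_simp
      ring
  rw [h1]
  have h2 := Real.pow_div_factorial_le_exp (n : ℝ) (by positivity) n
  exact (Real.log_le_log (by positivity) h2).trans (by rw [Real.log_exp])

lemma sum_log_inj (n : ℕ) (hn : 1 ≤ n) (S : Finset ℕ) (e : ℕ → ℕ) (he : Set.InjOn e S)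
    (hr : ∀ j ∈ S, e j ∈ Finset.Icc 1 n) : ∑ j ∈ S, Real.log (n / (e j : ℕ)) ≤ n := by
  rw [← Finset.sum_image (f := fun m : ℕ => Real.log ((n : ℝ) / m)) he]
  refine le_trans (Finset.sum_le_sum_of_subset_of_nonneg (fun m hm => ?_) (fun m hm _ => ?_)) (sum_log_le n hn)
  · obtain ⟨j, hj, rfl⟩ := Finset.mem_image.1 hm
    exact hr j hj
  · rw [Finset.mem_Icc] at hm
    apply Real.log_nonneg
    rw [one_le_div (by exact_mod_cast hm.1)]
    exact_mod_cast hm.2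

lemma sum_log_two (n i : ℕ) (hn : 1 ≤ n) (hi : i ∈ Finset.Icc 1 n) :
    ∑ j ∈ (Finset.Icc 1 n).erase i, Real.log (n / |(i : ℝ) - j|) ≤ 2 * n := by
  rw [Finset.mem_Icc] at hi
  rw [← Finset.sum_filter_add_sum_filter_not _ (fun j => j < i)]
  have h1 : ∑ j ∈ ((Finset.Icc 1 n).erase i).filter (fun j => j < i), Real.log (n / |(i : ℝ) - j|) ≤ n := by
    refine le_trans (le_of_eq ?_) (sum_log_inj n hn (((Finset.Icc 1 n).erase i).filter (fun j => j < i)) (fun j => i - j) ?_ ?_)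
    · refine Finset.sum_congr rfl fun j hj => ?_
      simp only [Finset.mem_filter] at hj
      rw [Nat.cast_sub hj.2.le, abs_of_pos]
      have : (j : ℝ) < i := by exact_mod_cast hj.2
      linarith
    · intro j hj j' hj' h
      simp only [Finset.coe_filter, Finset.mem_erase, Finset.mem_Icc, Set.mem_ofPred_eq] at hj hj' h
      omega
    · intro j hj
      simp only [Finset.mem_filter, Finset.mem_erase, Finset.mem_Icc] at hj ⊢
      omega
  have h2 : ∑ j ∈ ((Finset.Icc 1 n).erase i).filter (fun j => ¬ j < i), Real.log (n / |(i : ℝ) - j|) ≤ n := by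
    refine le_trans (le_of_eq ?_) (sum_log_inj n hn (((Finset.Icc 1 n).erase i).filter (fun j => ¬ j < i)) (fun j => j - i) ?_ ?_)
    · refine Finset.sum_congr rfl fun j hj => ?_
      simp only [Finset.mem_filter, Finset.mem_erase] at hj
      rw [Nat.cast_sub (by omega), abs_sub_comm, abs_of_pos]
      have : (i : ℝ) < j := by exact_mod_cast (show i < j by omega)
      linarith
    · intro j hj j' hj' h
      simp only [Finset.coe_filter, Finset.mem_erase, Finset.mem_Icc, Set.mem_ofPred_eq] at hj hj' h
      omega
    · intro j hj
      simp only [Finset.mem_filter, Finset.mem_erase, Finset.mem_Icc] at hj ⊢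
      omega
  linarith

lemma log_hundred : Real.log 100 ≤ 5 := by
  rw [Real.log_le_iff_le_exp (by norm_num)]
  have h : Real.exp 5 = Real.exp 1 ^ 5 := by rw [← Real.exp_nat_mul]; norm_num
  rw [h]
  have h1 := Real.exp_one_gt_d9
  have h2 : (2.7 : ℝ) ^ 5 ≤ Real.exp 1 ^ 5 := by gcongr; linarith
  norm_num at h2; linarith

lemma log_128 : Real.log 128 ≤ 5 := by
  rw [Real.log_le_iff_le_exp (by norm_num)]
  have h : Real.exp 5 = Real.exp 1 ^ 5 := by rw [← Real.exp_nat_mul]; norm_num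
  rw [h]
  have h1 := Real.exp_one_gt_d9
  have h2 : (2.7 : ℝ) ^ 5 ≤ Real.exp 1 ^ 5 := by gcongr; linarith
  norm_num at h2; linarith

lemma av_const_sub (c : ℝ) (F : ℤ × ℤ → ℝ) (y : ℤ × ℤ) : av (fun z => c - F z) y = c - av F y := by
  unfold av; ring

lemma av_shift (F : ℤ × ℤ → ℝ) (c y : ℤ × ℤ) : av (fun z => F (z - c)) y = av F (y - c) := by
  unfold av
  have e : ∀ p q : ℤ, ((p, q) : ℤ × ℤ) - c = (p - c.1, q - c.2) := fun p q => rfl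
  simp only [e, Prod.fst_sub, Prod.snd_sub]
  rw [show y.1 + 1 - c.1 = y.1 - c.1 + 1 by ring, show y.1 - 1 - c.1 = y.1 - c.1 - 1 by ring,
    show y.2 + 1 - c.2 = y.2 - c.2 + 1 by ring, show y.2 - 1 - c.2 = y.2 - c.2 - 1 by ring]

lemma av_sum {ι : Type*} (S : Finset ι) (F : ι → ℤ × ℤ → ℝ) (y : ℤ × ℤ) :
    av (fun z => ∑ j ∈ S, F j z) y = ∑ j ∈ S, av (F j) y := by
  simp only [av, ← Finset.sum_div, Finset.sum_add_distrib]

lemma pot_exists {C : Set (ℤ × ℤ)} (hC : LatticeConnected C) {a b : ℤ × ℤ} (ha : a ∈ C) (hb : b ∈ C) (n : ℕ) (hn : 1 ≤ n)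
    (hab : 4 * (n : ℤ) ≤ l1 b a) : ∃ f : ℤ × ℤ → ℝ, (∀ y, y ∉ C → f y ≤ av f y) ∧ (∀ y, f y ≤ 20 * n) ∧
      (∀ y, 15 * (n : ℝ) ≤ ‖pt y - pt a‖ → f y ≤ 0) ∧ (∀ y, ‖pt y - pt a‖ ≤ n → n ≤ f y) := by
  have hn' : (1 : ℝ) ≤ n := by exact_mod_cast hn
  have hc : ∀ j : ℕ, ∃ c : ℤ × ℤ, j ∈ Finset.Icc 1 n → c ∈ C ∧ l1 c a = 4 * j := by
    intro j
    by_cases hj : j ∈ Finset.Icc 1 n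
    · rw [Finset.mem_Icc] at hj
      obtain ⟨c, hc, h⟩ := ivt_conn hC ha hb (4 * j) (by omega) (by omega)
      exact ⟨c, fun _ => ⟨hc, h⟩⟩
    · exact ⟨0, fun h => absurd h hj⟩
  choose c hc using hc
  have hca : ∀ j ∈ Finset.Icc 1 n, ‖pt (c j) - pt a‖ ≤ 4 * n := by
    intro j hj
    have h1 := l1_le_norm (c j) a
    rw [(hc j hj).2] at h1
    have h2 : (j : ℝ) ≤ n := by exact_mod_cast (Finset.mem_Icc.1 hj).2
    push_cast at h1; linarith
  have hcc : ∀ i ∈ Finset.Icc 1 n, ∀ j ∈ Finset.Icc 1 n, 8 * ((i : ℝ) - j) ^ 2 ≤ r2 (c i - c j) := by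
    intro i hi j hj
    have h1 := l1_sq (c i) (c j)
    have h2 := l1_tri (c i) (c j) a
    have h3 := l1_tri (c j) (c i) a
    rw [l1_comm (c j) (c i)] at h3
    rw [(hc i hi).2, (hc j hj).2] at h2 h3
    have h4 : |4 * ((i : ℤ) - j)| ≤ l1 (c i) (c j) := by rw [abs_le]; constructor <;> linarith
    have h5 : |4 * ((i : ℝ) - j)| ≤ (l1 (c i) (c j) : ℝ) := by exact_mod_cast h4
    have h6 := sq_le_sq' (by linarith [abs_nonneg (4 * ((i : ℝ) - j))]) h5
    rw [sq_abs] at h6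
    nlinarith
  set f : ℤ × ℤ → ℝ := fun y => ∑ j ∈ Finset.Icc 1 n, (Real.log (100 * n ^ 2) - kf (y - c j)) with hf
  have hsub : ∀ y, (∀ j ∈ Finset.Icc 1 n, y ≠ c j) → f y ≤ av f y := by
    intro y hy
    rw [hf, av_sum]
    refine Finset.sum_le_sum fun j hj => ?_
    rw [av_const_sub, av_shift kf]
    linarith [kf_super (sub_ne_zero.2 (hy j hj))]
  have hS : ∀ i ∈ Finset.Icc 1 n, f (c i) ≤ 20 * n := by
    intro i hi
    rw [hf]
    simp only
    rw [← Finset.add_sum_erase _ _ hi]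
    have h1 : Real.log (100 * n ^ 2) - kf (c i - c i) ≤ 10 + 2 * n := by
      rw [sub_self, kf, kv, if_pos rfl, Real.log_mul (by norm_num) (by positivity), Real.log_pow,
        one_div, Real.log_inv]
      have := Real.log_le_sub_one_of_pos (show (0 : ℝ) < n by linarith)
      have h2 := log_hundred
      have h3 := log_128
      push_cast; linarith
    have h2 : ∀ j ∈ (Finset.Icc 1 n).erase i, Real.log (100 * n ^ 2) - kf (c i - c j) ≤
        5 + 2 * Real.log (n / |(i : ℝ) - j|) := by
      intro j hj
      rw [Finset.mem_erase] at hj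
      have h3 := hcc i hi j hj.2
      have hij : (1 : ℝ) ≤ |(i : ℝ) - j| := by
        have : (1 : ℤ) ≤ |(i : ℤ) - j| := Int.one_le_abs (by omega)
        exact_mod_cast this
      have hne : c i - c j ≠ 0 := by
        intro h0; rw [h0] at h3; simp [r2] at h3
        rw [← sq_abs] at h3; nlinarith
      have h4 : |(i : ℝ) - j| ^ 2 ≤ kv (c i - c j) := by
        rw [kv, if_neg hne]
        rw [← sq_abs] at h3; nlinarith
      have h5 := Real.log_le_log (by positivity) h4
      rw [Real.log_pow] at h5
      rw [kf, Real.log_div (by positivity) (by positivity), Real.log_mul (by norm_num) (by positivity), Real.log_pow]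
      have := log_hundred
      push_cast at h5 ⊢; linarith
    have h3 := Finset.sum_le_sum h2
    rw [Finset.sum_add_distrib, ← Finset.mul_sum] at h3
    have h4 := sum_log_two n i hn hi
    have h5 : ∑ j ∈ (Finset.Icc 1 n).erase i, (5 : ℝ) = 5 * (n - 1) := by
      rw [Finset.sum_const, Finset.card_erase_of_mem hi, Nat.card_Icc, nsmul_eq_mul]
      rw [show n + 1 - 1 - 1 = n - 1 by omega, Nat.cast_sub hn]; push_cast; ring
    linarith
  have hout : ∀ y, 15 * (n : ℝ) ≤ ‖pt y - pt a‖ → f y ≤ 0 := by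
    intro y hy
    refine Finset.sum_nonpos fun j hj => ?_
    have h1 := hca j hj
    have h2 : 11 * (n : ℝ) ≤ ‖pt y - pt (c j)‖ := by
      have := norm_sub_le_norm_sub_add_norm_sub (pt y) (pt (c j)) (pt a)
      linarith
    have h3 : 121 * (n : ℝ) ^ 2 ≤ r2 (y - c j) := by rw [r2_pt]; nlinarith
    have hne : y - c j ≠ 0 := by
      intro h0; rw [h0] at h3; simp [r2] at h3; nlinarith
    rw [kf, kv, if_neg hne]
    have := Real.log_le_log (show 0 < 100 * (n : ℝ) ^ 2 by positivity)
      (show 100 * (n : ℝ) ^ 2 ≤ r2 (y - c j) - 1 / 2 by nlinarith)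
    linarith
  refine ⟨f, fun y hy => hsub y fun j hj h => hy (h ▸ (hc j hj).1), ?_, hout, ?_⟩
  · obtain ⟨Q, hQ⟩ : ∃ Q : Set (ℤ × ℤ), ∀ y, y ∈ Q ↔ (‖pt y - pt a‖ < 15 * n ∧ ∀ j ∈ Finset.Icc 1 n, y ≠ c j) :=
      ⟨{y | ‖pt y - pt a‖ < 15 * n ∧ ∀ j ∈ Finset.Icc 1 n, y ≠ c j}, fun y => Iff.rfl⟩
    set D := (bx a (15 * n)).filter (fun y => y ∈ Q) with hD
    have hoff : ∀ y, y ∉ D → f y ≤ 20 * n := by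
      intro y hy
      by_cases h1 : 15 * (n : ℝ) ≤ ‖pt y - pt a‖
      · linarith [hout y h1]
      push Not at h1
      by_cases h2 : ∃ j ∈ Finset.Icc 1 n, y = c j
      · obtain ⟨j, hj, rfl⟩ := h2; exact hS j hj
      · exfalso; apply hy
        rw [hD, Finset.mem_filter, hQ]
        refine ⟨mem_bx (by push_cast; exact h1.le), h1, fun j hj h => h2 ⟨j, hj, h⟩⟩
    intro y
    by_cases hy : y ∈ D
    · have := maxp D (fun y => f y - 20 * n) (fun y hy => by
        have := hsub y ((hQ y).1 (Finset.mem_filter.1 hy).2).2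
        unfold av at this ⊢; linarith) (fun y _ w _ hw => by linarith [hoff w hw]) y hy
      linarith
    · exact hoff y hy
  · intro y hy
    have h0 : ∀ j ∈ Finset.Icc 1 n, (1 : ℝ) ≤ Real.log (100 * n ^ 2) - kf (y - c j) := by
      intro j hj
      have h1 : ‖pt y - pt (c j)‖ ≤ 5 * n := by
        have := norm_sub_le_norm_sub_add_norm_sub (pt y) (pt a) (pt (c j))
        rw [norm_sub_rev (pt a)] at this
        linarith [hca j hj]
      have h2 : r2 (y - c j) ≤ 25 * n ^ 2 := by
        rw [r2_pt]; nlinarith [norm_nonneg (pt y - pt (c j))]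
      have h3 : kv (y - c j) ≤ 25 * n ^ 2 := by
        unfold kv; split_ifs <;> nlinarith
      have h4 := Real.log_le_log (kv_pos _) h3
      rw [show (100 : ℝ) * n ^ 2 = 4 * (25 * n ^ 2) by ring, Real.log_mul (by norm_num) (by positivity), kf]
      have h5 : (1 : ℝ) ≤ Real.log 4 := by
        rw [Real.le_log_iff_exp_le (by norm_num)]
        linarith [Real.exp_one_lt_d9]
      linarith
    have h6 := Finset.sum_le_sum h0
    rw [Finset.sum_const, Nat.card_Icc, nsmul_eq_mul, mul_one, Nat.add_sub_cancel] at h6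
    exact h6

lemma one_scale {C K : Set (ℤ × ℤ)} (hCK : C ⊆ K) (hC : LatticeConnected C) {a b x : ℤ × ℤ} (ha : a ∈ C) (hb : b ∈ C)
    (n : ℕ) (hn : 1 ≤ n) (hab : 4 * (n : ℤ) ≤ l1 b a) (hx : ‖pt x - pt a‖ ≤ n) (u : ℤ × ℤ → ℝ) {σ : ℝ} (hσ0 : 0 ≤ σ)
    (hu : ∀ y, y ∉ K → u y ≤ av u y) (hz : ∀ y ∈ K, ‖pt y - pt a‖ ≤ 16 * n → u y ≤ 0)
    (hσ : ∀ y, ‖pt y - pt a‖ ≤ 16 * n → u y ≤ σ) : u x ≤ 19 / 20 * σ := by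
  have hn' : (1 : ℝ) ≤ n := by exact_mod_cast hn
  obtain ⟨f, f1, f2, f3, f4⟩ := pot_exists hC ha hb n hn hab
  by_cases hxK : x ∈ K
  · have := hz x hxK (by linarith)
    linarith
  set D := (bx a (15 * n)).filter (fun y => ‖pt y - pt a‖ < 15 * n ∧ y ∉ K) with hD
  have hxD : x ∈ D := by
    rw [hD, Finset.mem_filter]
    exact ⟨mem_bx (by push_cast; linarith), by linarith, hxK⟩
  have h := maxp D (fun y => u y - σ + σ * (f y / (20 * n))) (fun y hy => by
      rw [hD, Finset.mem_filter] at hy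
      have h1 := hu y hy.2.2
      have h2 := mul_le_mul_of_nonneg_left (f1 y fun hc => hy.2.2 (hCK hc)) (show 0 ≤ σ / (20 * n) by positivity)
      unfold av at h1 h2 ⊢
      have e : ∀ z, σ * (f z / (20 * n)) = σ / (20 * n) * f z := fun z => by ring
      simp only [e]
      linarith) (fun y hy w hw hwD => by
      rw [hD, Finset.mem_filter] at hy hwD
      have h1 : ‖pt w - pt a‖ ≤ 16 * n := by
        have := norm_sub_le_norm_sub_add_norm_sub (pt w) (pt y) (pt a)
        rw [nbr_dist hw] at this
        linarith
      by_cases hwK : w ∈ K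
      · have h2 := hz w hwK h1
        have h3 : f w / (20 * n) ≤ 1 := by rw [div_le_one (by positivity)]; exact f2 w
        nlinarith
      · have h2 : 15 * (n : ℝ) ≤ ‖pt w - pt a‖ := by
          by_contra! hc
          exact hwD ⟨mem_bx (by push_cast; linarith), hc, hwK⟩
        have h3 : f w / (20 * n) ≤ 0 := div_nonpos_of_nonpos_of_nonneg (f3 w h2) (by positivity)
        nlinarith [hσ w h1]) x hxD
  have h4 : 1 / 20 ≤ f x / (20 * n) := by
    rw [div_le_div_iff₀ (by norm_num) (by positivity)]
    linarith [f4 x hx]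
  nlinarith

lemma near_bd {C K : Set (ℤ × ℤ)} (hCK : C ⊆ K) (hC : LatticeConnected C) (u : ℤ × ℤ → ℝ)
    (hu : ∀ y, y ∉ K → u y ≤ av u y) (hu1 : ∀ y, u y ≤ 1) (M : ℤ) (hM : ∀ a ∈ C, ∃ b ∈ C, M ≤ l1 b a) (J : ℕ) :
    ∀ (n : ℕ) (x a : ℤ × ℤ), 1 ≤ n → 4 * (n : ℤ) * 40 ^ J ≤ M → a ∈ C → ‖pt x - pt a‖ ≤ n →
      (∀ y ∈ K, ‖pt y - pt x‖ ≤ n * 40 ^ J → u y ≤ 0) → u x ≤ (19 / 20) ^ J := by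
  induction J with
  | zero => intro n x a _ _ _ _ _; simpa using hu1 x
  | succ J ih =>
    intro n x a hn hnM ha hxa hz
    have hn' : (1 : ℝ) ≤ n := by exact_mod_cast hn
    have hnz : (1 : ℤ) ≤ n := by exact_mod_cast hn
    obtain ⟨b, hb, hab⟩ := hM a ha
    have h40 : (1 : ℝ) ≤ 40 ^ J := one_le_pow₀ (by norm_num)
    have h40z : (1 : ℤ) ≤ 40 ^ J := one_le_pow₀ (by norm_num)
    have hpr : (n : ℝ) ≤ n * 40 ^ J := by nlinarith
    have hprz : (n : ℤ) ≤ n * 40 ^ J := by nlinarith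
    rw [pow_succ (40 : ℤ)] at hnM
    rw [pow_succ (40 : ℝ)] at hz
    rw [pow_succ (19 / 20 : ℝ)]
    have hax : ‖pt a - pt x‖ ≤ n := by rw [norm_sub_rev]; exact hxa
    have := one_scale hCK hC ha hb n hn (by nlinarith) hxa u (σ := (19 / 20) ^ J) (by positivity) hu
      (fun y hy hya => hz y hy (by
        have := norm_sub_le_norm_sub_add_norm_sub (pt y) (pt a) (pt x)
        nlinarith))
      (fun y hya => ih (16 * n) y a (by omega) (by push_cast; nlinarith) ha (by push_cast; exact hya)
        (fun z hz1 hzy => hz z hz1 (by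
          have h1 := norm_sub_le_norm_sub_add_norm_sub (pt z) (pt y) (pt x)
          have h2 := norm_sub_le_norm_sub_add_norm_sub (pt y) (pt a) (pt x)
          push_cast at hzy
          nlinarith)))
    linarith

structure Conf (C : Set (ℤ × ℤ)) (E : Set ℂ) (f : ℂ → ℂ) (k D0 : ℝ) : Prop where
  cl : IsClosed (Ct C)
  ne : (Ct C).Nonempty
  sub : E ⊆ (Ct C)ᶜ
  bal : ∀ z ∈ E, ∀ d > 0, Metric.ball z d ⊆ (Ct C)ᶜ → Metric.ball z d ⊆ E
  dif : DifferentiableOn ℂ f E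
  map : MapsTo f E (Metric.ball 0 1)
  hk : 1 ≤ k
  low : ∀ z ∈ E, Metric.infDist z (Ct C) ≤ D0 → 1 - ‖f z‖ ^ 2 ≤ k * (Metric.infDist z (Ct C) * ‖deriv f z‖)

section Core

variable {C : Set (ℤ × ℤ)} {E : Set ℂ} {f : ℂ → ℂ} {k D0 : ℝ}

lemma Conf.pos (h : Conf C E f k D0) {z : ℂ} (hz : z ∈ E) : 0 < Metric.infDist z (Ct C) :=
  (h.cl.notMem_iff_infDist_pos h.ne).1 (h.sub hz)

lemma Conf.ball (h : Conf C E f k D0) {z : ℂ} (hz : z ∈ E) : Metric.ball z (Metric.infDist z (Ct C)) ⊆ E :=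
  h.bal z hz _ (h.pos hz) (fun _ hy hc => Set.disjoint_left.1 Metric.disjoint_ball_infDist hy hc)

lemma Conf.g_pos (h : Conf C E f k D0) {z : ℂ} (hz : z ∈ E) : 0 < 1 - ‖f z‖ ^ 2 := by
  have h1 := h.map hz
  rw [mem_ball_zero_iff] at h1
  nlinarith [norm_nonneg (f z)]

lemma Conf.nbr (h : Conf C E f k D0) {w y : ℤ × ℤ} (hy : pt y ∈ E) (hw : w ∈ nbrs y)
    (hd : 1 < Metric.infDist (pt y) (Ct C)) : pt w ∈ E := by
  apply h.ball hy
  rw [Metric.mem_ball, dist_eq_norm, nbr_dist hw]; exact hd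

lemma infD_nbr {w y : ℤ × ℤ} (hw : w ∈ nbrs y) :
    Metric.infDist (pt w) (Ct C) ≤ Metric.infDist (pt y) (Ct C) + 1 := by
  have := Metric.infDist_le_infDist_add_dist (s := Ct C) (x := pt w) (y := pt y)
  rwa [dist_eq_norm, nbr_dist hw] at this

lemma nbr_symm {w y : ℤ × ℤ} (hw : w ∈ nbrs y) : y ∈ nbrs w := by
  obtain ⟨a, b⟩ := y
  obtain ⟨c, d⟩ := w
  simp only [mem_nbrs, Prod.mk.injEq] at hw ⊢
  omega

lemma av_pt (Ψ : ℂ → ℝ) (y : ℤ × ℤ) : av (fun w => Ψ (pt w)) y =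
    (Ψ (pt y + 1) + Ψ (pt y + Complex.I) + Ψ (pt y - 1) + Ψ (pt y - Complex.I)) / 4 := by
  unfold av
  have e1 : pt (y.1 + 1, y.2) = pt y + 1 := by apply Complex.ext <;> simp [pt]
  have e2 : pt (y.1 - 1, y.2) = pt y - 1 := by apply Complex.ext <;> simp [pt]
  have e3 : pt (y.1, y.2 + 1) = pt y + Complex.I := by apply Complex.ext <;> simp [pt]
  have e4 : pt (y.1, y.2 - 1) = pt y - Complex.I := by apply Complex.ext <;> simp [pt]
  simp only [e1, e2, e3, e4]; ring

lemma Conf.super (h : Conf C E f k D0) {y : ℤ × ℤ} (hy : pt y ∈ E) {R p q : ℝ}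
    (hR : R ≤ Metric.infDist (pt y) (Ct C)) (hkR : 32 * k ≤ R) (hD : Metric.infDist (pt y) (Ct C) ≤ D0)
    (hp0 : 0 ≤ p) (hp1 : p ≤ 1) (hq0 : 0 < q) (hq1 : q ≤ 1)
    {Ψ : ℂ → ℝ} (hΨ : ∀ u, Ψ u = ‖deriv f u‖ ^ p * (1 - ‖f u‖ ^ 2) ^ q) {e : ℝ}
    (he : 25 * k ^ 2 * (p ^ 2 + p * q) + 3000000 * k ^ 3 / R + e ≤ q * (1 - q) / k ^ 2) :
    av (fun w => Ψ (pt w)) y ≤ Ψ (pt y) * (1 - e / (Metric.infDist (pt y) (Ct C)) ^ 2) := by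
  set d := Metric.infDist (pt y) (Ct C) with hd
  have hd0 : 0 < d := h.pos hy
  have hk := h.hk
  have hR0 : 0 < R := by linarith
  rw [av_pt]
  refine (lemM hd0 (h.dif.mono (h.ball hy)) (h.map.mono_left (h.ball hy)) hk (h.low _ hy hD) hp0 hp1 hq0 hq1
    (by linarith) hΨ).trans ?_
  have hΨ0 : 0 ≤ Ψ (pt y) := by
    rw [hΨ]
    exact mul_nonneg (Real.rpow_nonneg (norm_nonneg _) _) (Real.rpow_nonneg (h.g_pos hy).le _)
  refine mul_le_mul_of_nonneg_left ?_ hΨ0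
  have h1 : 3000000 * k ^ 3 / d ^ 3 ≤ 3000000 * k ^ 3 / R / d ^ 2 := by
    rw [div_div]
    apply div_le_div_of_nonneg_left (by positivity) (by positivity)
    nlinarith [sq_nonneg d]
  have h2 : (25 * k ^ 2 * (p ^ 2 + p * q) + 3000000 * k ^ 3 / R + e) / d ^ 2 ≤ q * (1 - q) / k ^ 2 / d ^ 2 := by gcongr
  rw [add_div, add_div] at h2
  linarith

lemma av_le_of {F : ℤ × ℤ → ℝ} {y : ℤ × ℤ} {c : ℝ} (h : ∀ w ∈ nbrs y, F w ≤ c) : av F y ≤ c := by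
  have := av_mono (F := F) (G := fun _ => c) h
  refine this.trans (le_of_eq ?_)
  unfold av; ring

lemma core_w (h : Conf C E f k D0) (D X : Finset (ℤ × ℤ)) {R r τ η : ℝ} {v : ℤ × ℤ}
    (hkR : 32 * k ≤ R) (hη0 : 0 < η) (hη1 : η ≤ 1 / 2) (hηR : 12000000 * k ^ 5 ≤ η * R)
    (hD : ∀ y ∈ D, pt y ∈ E ∧ R ≤ Metric.infDist (pt y) (Ct C) ∧ Metric.infDist (pt y) (Ct C) ≤ D0)
    (hX : ∀ x ∈ X, x ∉ D ∧ pt x ∈ E ∧ R - 1 ≤ Metric.infDist (pt x) (Ct C) ∧ Metric.infDist (pt x) (Ct C) < R ∧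
      1 - ‖f (pt x)‖ ^ 2 ≤ τ)
    (hv : v ∈ D) (hfv : f (pt v) = 0) (hr : 6 ≤ r) (hr1 : 8 * r ≤ Metric.infDist (pt v) (Ct C))
    (hr2 : R + 1 + r ≤ Metric.infDist (pt v) (Ct C)) :
    hmSet v (X : Set (ℤ × ℤ)) ((D : Set (ℤ × ℤ))ᶜ) ≤
      2 * (X.card * (144 * k ^ 2 * D0 ^ 2 / (r ^ 2 * η) * (2 * τ) ^ (1 - η))) := by
  have hk := h.hk
  have hR0 : 32 ≤ R := by linarith
  have hD0 : 0 < D0 := by have := (hD v hv).2; linarith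
  set Λ := 144 * k ^ 2 * D0 ^ 2 / (r ^ 2 * η) with hΛ
  have hΛ0 : 0 < Λ := by positivity
  set m := r ^ 2 with hm
  have hm36 : 36 ≤ m := by nlinarith
  have hm0 : 0 < m := by linarith
  set s := 1 - η with hs
  obtain ⟨w0, w1, w2, w3, w4⟩ := hm_facts (X : Set (ℤ × ℤ)) ((D : Set (ℤ × ℤ))ᶜ)
    (fun x hx => by simpa using (hX x (by simpa using hx)).1) X.finite_toSet
  set H : ℂ → ℝ := fun u => ‖deriv f u‖ ^ (0 : ℝ) * (1 - ‖f u‖ ^ 2) ^ s with hH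
  have hHv : ∀ u, H u = (1 - ‖f u‖ ^ 2) ^ s := fun u => by rw [hH]; simp
  have hH0 : ∀ u ∈ E, 0 ≤ H u := fun u hu => by rw [hHv]; exact Real.rpow_nonneg (h.g_pos hu).le _
  have hsup : ∀ y ∈ D, av (fun w => H (pt w)) y ≤ H (pt y) * (1 - η / (4 * k ^ 2) / Metric.infDist (pt y) (Ct C) ^ 2) := by
    intro y hy
    obtain ⟨y1, y2, y3⟩ := hD y hy
    refine h.super y1 y2 hkR y3 le_rfl zero_le_one (by linarith) (by linarith) (fun u => rfl) ?_
    have e1 : 3000000 * k ^ 3 / R ≤ η / (4 * k ^ 2) := by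
      rw [div_le_div_iff₀ (by linarith) (by positivity)]
      nlinarith
    have e2 : η / (4 * k ^ 2) + η / (4 * k ^ 2) ≤ s * (1 - s) / k ^ 2 := by
      rw [show η / (4 * k ^ 2) + η / (4 * k ^ 2) = (η / 2) / k ^ 2 by field_simp; ring]
      gcongr
      rw [hs]; nlinarith
    simp only [ne_eq, OfNat.ofNat_ne_zero, not_false_eq_true, zero_pow, zero_mul, add_zero, mul_zero, zero_add]
    linarith
  set P : ℤ × ℤ → ℝ := fun y => if y ∈ D then phi m v y + Λ * H (pt y) else 0 with hP
  have hphi0 : ∀ y, 0 ≤ phi m v y := fun y => ph_nonneg hm0 _ _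
  have hPle : ∀ y ∈ D, av P y ≤ av (phi m v) y + Λ * av (fun w => H (pt w)) y := by
    intro y hy
    have h1 : av P y ≤ av (fun w => phi m v w + Λ * H (pt w)) y := by
      refine av_mono fun w hw => ?_
      have hwE : pt w ∈ E := h.nbr (hD y hy).1 hw (by linarith [(hD y hy).2.1])
      rw [hP]; simp only
      split_ifs
      · exact le_rfl
      · exact add_nonneg (hphi0 w) (mul_nonneg hΛ0.le (hH0 _ hwE))
    refine h1.trans (le_of_eq ?_)
    unfold av; ring
  have hdec : ∀ y ∈ D, av (fun w => H (pt w)) y ≤ H (pt y) := by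
    intro y hy
    refine (hsup y hy).trans ?_
    have h1 : 0 ≤ η / (4 * k ^ 2) / Metric.infDist (pt y) (Ct C) ^ 2 := by positivity
    nlinarith [hH0 _ (hD y hy).1]
  have hmain : ∀ y ∈ D, av P y ≤ P y := by
    intro y hy
    refine (hPle y hy).trans ?_
    have hPy : P y = phi m v y + Λ * H (pt y) := by rw [hP]; simp [hy]
    rw [hPy]
    by_cases hfar : 4 * m < r2 (y - v)
    · have := mul_le_mul_of_nonneg_left (hdec y hy) hΛ0.le
      linarith [phi_far hm36 v y hfar]
    · push Not at hfar
      obtain ⟨y1, y2, y3⟩ := hD y hy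
      have hd0 : 0 < Metric.infDist (pt y) (Ct C) := by linarith
      have h1 : ‖pt y - pt v‖ ≤ 2 * r := by
        rw [r2_pt] at hfar
        nlinarith [norm_nonneg (pt y - pt v)]
      have hvE := (hD v hv).1
      have h2 := (g_harnack (h.pos hvE) (h.dif.mono (h.ball hvE)) (h.map.mono_left (h.ball hvE)) (z := pt y)
        (by linarith)).2
      rw [hfv] at h2
      norm_num at h2
      have h3 : 1 / 2 ≤ H (pt y) := by
        rw [hHv]
        have hle1 : 1 - ‖f (pt y)‖ ^ 2 ≤ 1 := by nlinarith [sq_nonneg ‖f (pt y)‖]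
        have := Real.rpow_le_rpow_of_exponent_ge (h.g_pos y1) hle1 (show s ≤ 1 by linarith)
        rw [Real.rpow_one] at this
        linarith
      have h4 : η / (4 * k ^ 2) / D0 ^ 2 ≤ η / (4 * k ^ 2) / Metric.infDist (pt y) (Ct C) ^ 2 := by gcongr
      have h5 : Λ * (1 / 2 * (η / (4 * k ^ 2) / D0 ^ 2)) = 18 / m := by
        rw [hΛ]; field_simp; norm_num
      have h6 : Λ * (1 / 2 * (η / (4 * k ^ 2) / D0 ^ 2)) ≤ Λ * (H (pt y) * (η / (4 * k ^ 2) / Metric.infDist (pt y) (Ct C) ^ 2)) := by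
        gcongr
      have h7 := mul_le_mul_of_nonneg_left (hsup y hy) hΛ0.le
      linarith [phi_av hm36 v y]
  have hPv : av P v ≤ P v - 1 / 2 := by
    refine (hPle v hv).trans ?_
    have hPy : P v = phi m v v + Λ * H (pt v) := by rw [hP]; simp [hv]
    have := mul_le_mul_of_nonneg_left (hdec v hv) hΛ0.le
    linarith [phi_ctr hm36 v]
  have hg := green_ineq D X (Finset.disjoint_left.2 fun y hy hx => (hX y hx).1 hy) (fun y => hmSet y X ((D : Set (ℤ × ℤ))ᶜ)) P v
    (1 / 2) hv w0 (fun y hy => w4 y (by simpa using hy)) (fun y hy => w2 y (by simpa using hy))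
    (fun y hy hy2 => w3 y (by simpa using hy) (by simpa using hy2)) (fun y hy => by rw [hP]; simp [hy]) hmain hPv
  have hb : ∀ x ∈ X, av P x ≤ Λ * (2 * τ) ^ s := by
    intro x hx
    obtain ⟨-, x1, x2, x3, x4⟩ := hX x hx
    have hτ : 0 < τ := (h.g_pos x1).trans_le x4
    refine av_le_of fun w hw => ?_
    rw [hP]; simp only
    split_ifs with hwD
    · have hz : phi m v w = 0 := by
        apply ph_zero hm0
        have h1 : r2 (w - v) = ‖pt w - pt v‖ ^ 2 := r2_pt w v
        have h2 := Metric.infDist_le_infDist_add_dist (s := Ct C) (x := pt v) (y := pt w)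
        rw [dist_eq_norm, norm_sub_rev] at h2
        have h3 := infD_nbr (C := C) hw
        have h4 : r ≤ ‖pt w - pt v‖ := by linarith
        have h5 : m ≤ r2 (w - v) := by rw [h1, hm]; gcongr
        simp only [r2, Prod.fst_sub, Prod.snd_sub] at h5
        push_cast at h5
        linarith
      rw [hz, zero_add, hHv]
      have hwE := (hD w hwD).1
      have h2 := (g_harnack (h.pos x1) (h.dif.mono (h.ball x1)) (h.map.mono_left (h.ball x1)) (z := pt w)
        (by rw [nbr_dist hw]; linarith)).1
      have h3 : (1 - ‖f (pt w)‖ ^ 2) ^ s ≤ (2 * τ) ^ s :=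
        Real.rpow_le_rpow (h.g_pos hwE).le (by linarith) (by linarith)
      gcongr
    · have : 0 ≤ (2 * τ) ^ s := Real.rpow_nonneg (by linarith) _
      positivity
  have := Finset.sum_le_sum hb
  rw [Finset.sum_const, nsmul_eq_mul] at this
  linarith

end Core

section Core2

variable {C : Set (ℤ × ℤ)} {E : Set ℂ} {f : ℂ → ℂ} {k D0 : ℝ}

lemma box_nbr {N : ℕ} {y w : ℤ × ℤ} (hy : y ∈ box N) (hyb : y ∉ bdry N) (hw : w ∈ nbrs y) : w ∈ box N := by
  by_contra hc
  apply hyb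
  unfold bdry
  rw [Finset.mem_filter]
  exact ⟨hy, w, hw, hc⟩

lemma core (h : Conf C E f k D0) (hconn : LatticeConnected C) {A : Set (ℤ × ℤ)} (hAC : A ⊆ C) (hAf : A.Finite)
    {N : ℕ} (hN : 1 ≤ N) (hbox : ∀ y ∈ box N, Metric.infDist (pt y) (Ct C) ≤ D0) {v : ℤ × ℤ} (hvb : v ∈ box N)
    (hvn : v ∉ bdry N) (hvE : pt v ∈ E) (hfv : f (pt v) = 0) {M : ℤ} (hM : ∀ a ∈ C, ∃ b ∈ C, M ≤ l1 b a)
    {n J : ℕ} (hnM : 4 * (n : ℤ) * 40 ^ J ≤ M) {R r η p T δv : ℝ} (hRn : R + 1 ≤ n)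
    (hkR : 32 * k ≤ R) (hη0 : 0 < η) (hη1 : η ≤ 1 / 2) (hηR : 12000000 * k ^ 5 ≤ η * R)
    (hr : 6 ≤ r) (hr1 : 8 * r ≤ δv) (hr2 : R + 1 + r ≤ δv) (hδv : δv ≤ Metric.infDist (pt v) (Ct C))
    (hp0 : 0 < p) (hp1 : 200 * k ^ 4 * p ≤ 1) (hpR : 60000 * k ≤ p ^ 2 * R) (hT : 1 ≤ T) :
    hmSet v A (C ∪ ↑(bdry N)) ≤ (19 / 20) ^ J + (k * R * N / (δv * T)) ^ p * (N : ℝ) ^ (200 * k ^ 4 * p ^ 2) +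
      2 * (A.ncard * (2 * (n * 40 ^ J) + 1) ^ 2 * (144 * k ^ 2 * D0 ^ 2 / (r ^ 2 * η) * (2 * (T / N)) ^ (1 - η))) := by
  have hk := h.hk
  have hR0 : 32 ≤ R := by linarith
  have hN' : (1 : ℝ) ≤ N := by exact_mod_cast hN
  have hn1 : 1 ≤ n := by
    have : (1 : ℝ) ≤ n := by linarith
    exact_mod_cast this
  set q := 200 * k ^ 4 * p ^ 2 with hq
  have hk4 : 1 ≤ k ^ 4 := one_le_pow₀ hk
  have hp200 : p ≤ 1 / 200 := by nlinarith
  have hq0 : 0 < q := by positivity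
  have hqp : q ≤ p := by rw [hq]; nlinarith
  set K : Set (ℤ × ℤ) := C ∪ ↑(bdry N) with hK
  obtain ⟨u0, u1, u2, u3, u4⟩ := hm_facts A K (hAC.trans subset_union_left) hAf
  obtain ⟨Q, hQ⟩ : ∃ Q : Set (ℤ × ℤ), ∀ y, y ∈ Q ↔ (y ∉ bdry N ∧ pt y ∈ E ∧ R ≤ Metric.infDist (pt y) (Ct C)) :=
    ⟨{y | y ∉ bdry N ∧ pt y ∈ E ∧ R ≤ Metric.infDist (pt y) (Ct C)}, fun y => Iff.rfl⟩
  set D := (box N).filter (fun y => y ∈ Q) with hD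
  have hDm : ∀ y, y ∈ D ↔ (y ∈ box N ∧ y ∉ bdry N ∧ pt y ∈ E ∧ R ≤ Metric.infDist (pt y) (Ct C)) := by
    intro y; rw [hD, Finset.mem_filter, hQ]
  obtain ⟨G, hG⟩ : ∃ G : Set (ℤ × ℤ), ∀ x, x ∈ G ↔ (x ∉ D ∧ pt x ∈ E ∧ R - 1 ≤ Metric.infDist (pt x) (Ct C) ∧
      Metric.infDist (pt x) (Ct C) < R ∧ 1 - ‖f (pt x)‖ ^ 2 ≤ T / N) :=
    ⟨{x | x ∉ D ∧ pt x ∈ E ∧ R - 1 ≤ Metric.infDist (pt x) (Ct C) ∧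
      Metric.infDist (pt x) (Ct C) < R ∧ 1 - ‖f (pt x)‖ ^ 2 ≤ T / N}, fun y => Iff.rfl⟩
  set X := (hAf.toFinset.biUnion (fun a => bx a (n * 40 ^ J))).filter (fun x => x ∈ G) with hX
  have hvD : v ∈ D := (hDm v).2 ⟨hvb, hvn, hvE, by linarith⟩
  have hXG : ∀ x ∈ X, x ∈ G := fun x hx => (Finset.mem_filter.1 hx).2
  have hw := core_w h D X hkR hη0 hη1 hηR (fun y hy => by
      obtain ⟨y1, y2, y3, y4⟩ := (hDm y).1 hy
      exact ⟨y3, y4, hbox y y1⟩) (fun x hx => (hG x).1 (hXG x hx)) hvD hfv hr (by linarith) (by linarith)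
  obtain ⟨w0, w1, w2, w3, w4⟩ := hm_facts (X : Set (ℤ × ℤ)) ((D : Set (ℤ × ℤ))ᶜ)
    (fun x hx => by simpa using ((hG x).1 (hXG x (by simpa using hx))).1) X.finite_toSet
  have hcard : (X.card : ℝ) ≤ A.ncard * (2 * (n * 40 ^ J) + 1) ^ 2 := by
    have h1 : X.card ≤ A.ncard * (2 * (n * 40 ^ J) + 1) ^ 2 := by
      refine (Finset.card_filter_le _ _).trans (Finset.card_biUnion_le.trans ?_)
      simp only [bx_card, Finset.sum_const, smul_eq_mul]
      rw [Set.ncard_eq_toFinset_card A hAf]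
    exact_mod_cast h1
  set Ψ : ℂ → ℝ := fun u => ‖deriv f u‖ ^ p * (1 - ‖f u‖ ^ 2) ^ q with hΨ
  have hΨ0 : ∀ z ∈ E, 0 ≤ Ψ z := fun z hz =>
    mul_nonneg (Real.rpow_nonneg (norm_nonneg _) _) (Real.rpow_nonneg (h.g_pos hz).le _)
  set m0 := (T / (N * k * R)) ^ p * (1 / (N : ℝ)) ^ q with hm0
  have hm0p : 0 < m0 := by positivity
  have hsup : ∀ y ∈ D, av (fun w => Ψ (pt w)) y ≤ Ψ (pt y) := by
    intro y hy
    obtain ⟨y1, y2, y3, y4⟩ := (hDm y).1 hy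
    have := h.super y3 y4 hkR (hbox y y1) hp0.le (by linarith) hq0 (by linarith) (fun u => rfl) (e := 0) (by
      have e1 : 3000000 * k ^ 3 / R ≤ 50 * k ^ 2 * p ^ 2 := by
        rw [div_le_iff₀ (by linarith)]
        have := mul_le_mul_of_nonneg_left hpR (show 0 ≤ 50 * k ^ 2 by positivity)
        nlinarith
      have e2 : 100 * k ^ 2 * p ^ 2 ≤ q * (1 - q) / k ^ 2 := by
        rw [le_div_iff₀ (by positivity)]
        have : q * (1 / 2) ≤ q * (1 - q) := by gcongr; linarith
        have e3 : 100 * k ^ 2 * p ^ 2 * k ^ 2 = q * (1 / 2) := by rw [hq]; ring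
        linarith
      have e4 : 25 * k ^ 2 * (p ^ 2 + p * q) ≤ 25 * k ^ 2 * (p ^ 2 + p * p) := by gcongr
      nlinarith)
    simpa using this
  have hcmp := maxp D (fun y => hmSet y A K - (19 / 20) ^ J - Ψ (pt y) / m0 - hmSet y (X : Set (ℤ × ℤ)) ((D : Set (ℤ × ℤ))ᶜ))
    (fun y hy => by
      obtain ⟨y1, y2, y3, y4⟩ := (hDm y).1 hy
      have a1 := u4 y (by
        rw [hK]
        rintro (hc | hc)
        · exact h.sub y3 (pt_mem_Ct hc)
        · exact y2 (by simpa using hc))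
      have a2 := w4 y (by simpa using hy)
      have a3 := div_le_div_of_nonneg_right (hsup y hy) hm0p.le
      unfold av at a1 a2 a3 ⊢
      have e : ∀ a b c d m : ℝ, (a + b + c + d) / 4 / m = (a / m + b / m + c / m + d / m) / 4 := by
        intros; ring
      rw [e] at a3
      linarith)
    (fun y hy x hxn hxD => by
      obtain ⟨y1, y2, y3, y4⟩ := (hDm y).1 hy
      have hxE : pt x ∈ E := h.nbr y3 hxn (by linarith)
      have hxC : x ∉ C := fun hc => h.sub hxE (pt_mem_Ct hc)
      have hJ0 : (0 : ℝ) ≤ (19 / 20) ^ J := by positivity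
      have hΨx : 0 ≤ Ψ (pt x) / m0 := div_nonneg (hΨ0 _ hxE) hm0p.le
      have hwx := w0 x
      have hux := u1 x
      by_cases hxb : x ∈ bdry N
      · have := u3 x (by rw [hK]; right; simpa using hxb) (fun hc => hxC (hAC hc))
        linarith
      have hxR : Metric.infDist (pt x) (Ct C) < R := by
        by_contra! hc
        exact hxD ((hDm x).2 ⟨box_nbr y1 y2 hxn, hxb, hxE, hc⟩)
      have hxR1 : R - 1 ≤ Metric.infDist (pt x) (Ct C) := by
        have := infD_nbr (C := C) (nbr_symm hxn)
        linarith
      by_cases hnear : ∃ a ∈ A, ‖pt x - pt a‖ ≤ n * 40 ^ J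
      · by_cases hg : 1 - ‖f (pt x)‖ ^ 2 ≤ T / N
        · obtain ⟨a, ha, hxa⟩ := hnear
          have : x ∈ X := by
            rw [hX, Finset.mem_filter, Finset.mem_biUnion]
            exact ⟨⟨a, by simpa using ha, mem_bx (by push_cast; exact hxa)⟩, (hG x).2 ⟨hxD, hxE, hxR1, hxR, hg⟩⟩
          have := w2 x (by simpa using this)
          linarith
        · push Not at hg
          have h1 := h.low _ hxE (hbox x (box_nbr y1 y2 hxn))
          have h2 : T / (N * k * R) ≤ ‖deriv f (pt x)‖ := by
            rw [div_le_iff₀ (by positivity)]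
            have h3 : k * (Metric.infDist (pt x) (Ct C) * ‖deriv f (pt x)‖) ≤ k * (R * ‖deriv f (pt x)‖) := by gcongr
            have h4 : T / N < k * (R * ‖deriv f (pt x)‖) := by linarith
            rw [div_lt_iff₀ (by linarith)] at h4
            linarith
          have h3 : m0 ≤ Ψ (pt x) := by
            rw [hm0, hΨ]
            simp only
            have h5 : 1 / (N : ℝ) ≤ 1 - ‖f (pt x)‖ ^ 2 := by
              refine le_trans ?_ hg.le
              gcongr
            gcongr
          have := (one_le_div hm0p).2 h3
          linarith
      · push Not at hnear
        obtain ⟨z, hz, hzx⟩ := (Metric.infDist_lt_iff h.ne).1 hxR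
        obtain ⟨c, hc, hzc⟩ := Ct_near hz
        have h1 : ‖pt x - pt c‖ ≤ n := by
          have := norm_sub_le_norm_sub_add_norm_sub (pt x) z (pt c)
          rw [dist_eq_norm] at hzx
          linarith
        have := near_bd (C := C) (K := K) subset_union_left hconn (fun y => hmSet y A K) (fun y hy => (u4 y hy).le) u1 M hM J n x c hn1
          hnM hc h1 (fun y hy hyx => by
            by_cases hyA : y ∈ A
            · have := hnear y hyA
              rw [norm_sub_rev] at hyx
              linarith
            · exact (u3 y hy hyA).le)
        linarith) v hvD
  have hΨv : Ψ (pt v) / m0 ≤ (k * R * N / (δv * T)) ^ p * (N : ℝ) ^ q := by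
    have hδ0 : 0 < δv := by linarith
    have h1 : ‖deriv f (pt v)‖ ≤ 1 / δv := by
      have := schwarz_pick_ball (h.pos hvE) (h.dif.mono (h.ball hvE)) (h.map.mono_left (h.ball hvE))
      rw [hfv] at this
      norm_num at this
      refine this.trans ?_
      rw [one_div]
      gcongr
    have h2 : Ψ (pt v) ≤ (1 / δv) ^ p := by
      rw [hΨ]; simp only [hfv]
      norm_num
      rw [one_div] at h1
      exact Real.rpow_le_rpow (norm_nonneg _) h1 hp0.le
    rw [div_le_iff₀ hm0p]
    refine h2.trans (le_of_eq ?_)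
    rw [hm0, show ∀ a b c d : ℝ, a * b * (c * d) = (a * c) * (b * d) by intros; ring,
      ← Real.mul_rpow (by positivity) (by positivity), ← Real.mul_rpow (by positivity) (by positivity)]
    rw [mul_one_div_cancel (by positivity), Real.one_rpow, mul_one]
    congr 1
    field_simp
  have hfin : 2 * (X.card * (144 * k ^ 2 * D0 ^ 2 / (r ^ 2 * η) * (2 * (T / N)) ^ (1 - η))) ≤
      2 * (A.ncard * (2 * (n * 40 ^ J) + 1) ^ 2 * (144 * k ^ 2 * D0 ^ 2 / (r ^ 2 * η) * (2 * (T / N)) ^ (1 - η))) := by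
    gcongr
  linarith

end Core2

lemma box_abs {M : ℕ} {y : ℤ × ℤ} (h : y ∈ box M) : |2 * y.1| ≤ (M : ℤ) ∧ |2 * y.2| ≤ (M : ℤ) := by
  simp only [box, Finset.mem_product, Finset.mem_Icc] at h
  constructor <;> rw [abs_le] <;> omega

lemma bdry_abs {M : ℕ} {y : ℤ × ℤ} (h : y ∈ bdry M) : (M : ℤ) - 2 ≤ |2 * y.1| ∨ (M : ℤ) - 2 ≤ |2 * y.2| := by
  unfold bdry at h
  rw [Finset.mem_filter] at h
  obtain ⟨h1, u, hu, hub⟩ := h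
  simp only [box, Finset.mem_product, Finset.mem_Icc] at h1 hub
  rcases abs_cases (2 * y.1) with h3 | h3 <;> rcases abs_cases (2 * y.2) with h4 | h4 <;> rw [h3.1, h4.1] <;>
  · rw [mem_nbrs] at hu
    rcases hu with rfl | rfl | rfl | rfl <;> simp only at hub <;> omega

lemma box_of_abs {M : ℕ} {y : ℤ × ℤ} (h1 : |2 * y.1| ≤ (M : ℤ) - 2) (h2 : |2 * y.2| ≤ (M : ℤ) - 2) : y ∈ box M := by
  rw [abs_le] at h1 h2
  simp only [box, Finset.mem_product, Finset.mem_Icc]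
  omega

set_option maxHeartbeats 1000000 in
lemma core2 {α β : ℝ} (hα : 0 < α) (hα1 : α < 1) (hβ0 : 0 < β) (hβ : β < 1) {N : ℕ} (hN : 1 ≤ N) {C A : Set (ℤ × ℤ)}
    (hCb : C ⊆ ↑(boxR (β * N))) (hconn : LatticeConnected C)
    (hdi : ∃ u ∈ C, ∃ v ∈ C, α * N ≤ ((|u.1 - v.1| + |u.2 - v.2| : ℤ) : ℝ)) (hAC : A ⊆ C) {v : ℤ × ℤ}
    (hv : v ∈ bdryR ((1 + β) * N / 2)) {k c : ℝ} (hkd : k = 27648 * 256 / α ^ 2) (hcd : c = (1 - β) / 8)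
    {n J : ℕ} (hnM : 4 * (n : ℝ) * 40 ^ J ≤ α * N / 2) {R η p T : ℝ} (hRn : R + 1 ≤ n)
    (hkR : 32 * k ≤ R) (hη0 : 0 < η) (hη1 : η ≤ 1 / 2) (hηR : 12000000 * k ^ 5 ≤ η * R)
    (hr : 48 ≤ c * N) (hr2 : 2 * (R + 1) ≤ c * N)
    (hp0 : 0 < p) (hp1 : 200 * k ^ 4 * p ≤ 1) (hpR : 60000 * k ≤ p ^ 2 * R) (hT : 1 ≤ T) :
    hmSet v A (C ∪ ↑(bdry N)) ≤ (19 / 20) ^ J + (k * R / (c * T)) ^ p * (N : ℝ) ^ (200 * k ^ 4 * p ^ 2) +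
      2 * (A.ncard * (2 * (n * 40 ^ J) + 1) ^ 2 * (147456 * k ^ 2 / (c ^ 2 * η) * (2 * (T / N)) ^ (1 - η))) := by
  have hN' : (1 : ℝ) ≤ N := by exact_mod_cast hN
  have hc0 : 0 < c := by rw [hcd]; linarith
  obtain ⟨a0, ha0, b0, hb0, hab⟩ := hdi
  change α * N ≤ (l1 a0 b0 : ℝ) at hab
  have hCf : C.Finite := (Finset.finite_toSet _).subset hCb
  have hcl := Ct_closed hCf
  have hne : (Ct C).Nonempty := ⟨_, pt_mem_Ct ha0⟩
  have hCabs : ∀ y ∈ C, |(y.1 : ℝ)| ≤ β * N / 2 ∧ |(y.2 : ℝ)| ≤ β * N / 2 := by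
    intro y hy
    have h1 := box_abs (hCb hy : y ∈ box _)
    have h2 : ((⌊β * N⌋₊ : ℕ) : ℝ) ≤ β * N := Nat.floor_le (by positivity)
    have h3 : |2 * (y.1 : ℝ)| ≤ (⌊β * N⌋₊ : ℕ) := by exact_mod_cast h1.1
    have h4 : |2 * (y.2 : ℝ)| ≤ (⌊β * N⌋₊ : ℕ) := by exact_mod_cast h1.2
    rw [abs_mul, abs_two] at h3 h4
    constructor <;> linarith
  have hMfl : ((⌊(1 + β) * N / 2⌋₊ : ℕ) : ℝ) ≤ (1 + β) * N / 2 := Nat.floor_le (by positivity)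
  have hMfl2 : (1 + β) * N / 2 - 1 < ((⌊(1 + β) * N / 2⌋₊ : ℕ) : ℝ) := Nat.sub_one_lt_floor _
  have hvb : v ∈ box ⌊(1 + β) * N / 2⌋₊ := (Finset.mem_filter.1 (show v ∈ bdry _ from hv)).1
  have hvabs := box_abs hvb
  have hv1 : |2 * (v.1 : ℝ)| ≤ (⌊(1 + β) * N / 2⌋₊ : ℕ) := by exact_mod_cast hvabs.1
  have hv2 : |2 * (v.2 : ℝ)| ≤ (⌊(1 + β) * N / 2⌋₊ : ℕ) := by exact_mod_cast hvabs.2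
  have hcN : c * N = N / 8 - β * N / 8 := by rw [hcd]; ring
  -- v is well inside the big box
  have hvN1 : |2 * v.1| ≤ (N : ℤ) - 4 := by
    have : |2 * (v.1 : ℝ)| ≤ N - 4 := by linarith
    exact_mod_cast this
  have hvN2 : |2 * v.2| ≤ (N : ℤ) - 4 := by
    have : |2 * (v.2 : ℝ)| ≤ N - 4 := by linarith
    exact_mod_cast this
  have hvin : v ∈ box N := box_of_abs (by omega) (by omega)
  have hvnb : v ∉ bdry N := by
    intro hb
    rcases bdry_abs hb with h1 | h1 <;> omega
  -- distance from v to C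
  have hvdC : ∀ y ∈ C, c * N + 1 / 2 ≤ ‖pt v - pt y‖ := by
    intro y hy
    obtain ⟨y1, y2⟩ := hCabs y hy
    rcases bdry_abs (show v ∈ bdry _ from hv) with h1 | h1
    · have h2 : ((⌊(1 + β) * N / 2⌋₊ : ℕ) : ℝ) - 2 ≤ |2 * (v.1 : ℝ)| := by exact_mod_cast h1
      rw [abs_mul, abs_two] at h2
      have h3 := Complex.abs_re_le_norm (pt v - pt y)
      simp only [pt, Complex.sub_re] at h3
      have h4 := abs_sub_abs_le_abs_sub (v.1 : ℝ) y.1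
      simp only [pt]
      linarith
    · have h2 : ((⌊(1 + β) * N / 2⌋₊ : ℕ) : ℝ) - 2 ≤ |2 * (v.2 : ℝ)| := by exact_mod_cast h1
      rw [abs_mul, abs_two] at h2
      have h3 := Complex.abs_im_le_norm (pt v - pt y)
      simp only [pt, Complex.sub_im] at h3
      have h4 := abs_sub_abs_le_abs_sub (v.2 : ℝ) y.2
      simp only [pt]
      linarith
  have hδv : c * N ≤ Metric.infDist (pt v) (Ct C) := by
    refine (Metric.le_infDist hne).2 fun z hz => ?_
    obtain ⟨y, hy, hzy⟩ := Ct_near hz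
    have h1 := hvdC y hy
    have h2 := norm_sub_le_norm_sub_add_norm_sub (pt v) z (pt y)
    rw [dist_eq_norm]
    linarith
  have hvc : pt v ∉ Ct C := (hcl.notMem_iff_infDist_pos hne).2 (by linarith)
  -- diameter
  have habn : α * N / 2 ≤ ‖pt a0 - pt b0‖ := by
    have h1 := l1_sq a0 b0
    rw [r2_pt] at h1
    have h2 := norm_nonneg (pt a0 - pt b0)
    have h3 : 0 < α * N := by positivity
    nlinarith
  have hdiam : ∀ a ∈ Ct C, ∃ b ∈ Ct C, α * N / 4 ≤ ‖a - b‖ := by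
    intro a _
    by_contra! hcon
    have h1 := hcon _ (pt_mem_Ct ha0)
    have h2 := hcon _ (pt_mem_Ct hb0)
    have h3 := norm_sub_le_norm_sub_add_norm_sub (pt a0) a (pt b0)
    rw [norm_sub_rev (pt a0) a] at h3
    linarith
  obtain ⟨E, f, e1, e2, e3, e4, e5, e6, e7⟩ := conformal hCf hconn (pt_mem_Ct ha0) hvc
    (show 0 < α * N / 4 by positivity) hdiam
  have hk1 : 1 ≤ k := by
    rw [hkd, le_div_iff₀ (by positivity)]; nlinarith
  have hconf : Conf C E f k (4 * N) := by
    refine ⟨hcl, hne, e1, e3, e4, e5, hk1, fun z hz hd => ?_⟩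
    set d := Metric.infDist z (Ct C) with hdd
    have hd0 : 0 < d := (hcl.notMem_iff_infDist_pos hne).1 (e1 hz)
    have hbs : Metric.ball z d ⊆ (Ct C)ᶜ := fun _ hy hc => Set.disjoint_left.1 Metric.disjoint_ball_infDist hy hc
    obtain ⟨a, ha, haz⟩ := (Metric.infDist_lt_iff hne).1 (show Metric.infDist z (Ct C) < 2 * d by rw [← hdd]; linarith)
    rw [dist_eq_norm] at haz
    have h1 := e7 z hz d hd0 (α / 16) (by positivity) (by linarith) hbs ⟨a, ha, haz.le⟩
      ((mul_le_mul_of_nonneg_left hd (by positivity)).trans (le_of_eq (by ring)))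
    have hg : 0 < 1 - ‖f z‖ ^ 2 := by
      have h1 := e5 hz
      rw [mem_ball_zero_iff] at h1
      nlinarith [norm_nonneg (f z)]
    rw [div_le_div_iff₀ (by positivity) hg] at h1
    rw [hkd, div_mul_eq_mul_div, le_div_iff₀ (by positivity)]
    have h2 : (1 - ‖f z‖ ^ 2) * α ^ 2 = 256 * ((α / 16) ^ 2 * (1 - ‖f z‖ ^ 2)) := by ring
    rw [h2]
    linarith
  have hMl : ∀ a ∈ C, ∃ b ∈ C, ⌊α * N / 2⌋ ≤ l1 b a := by
    intro a _
    by_contra! hcon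
    have h1 := hcon a0 ha0
    have h2 := hcon b0 hb0
    have h3 := l1_tri a0 a b0
    rw [l1_comm a b0] at h3
    have h4 : ((⌊α * N / 2⌋ : ℤ) : ℝ) ≤ α * N / 2 := Int.floor_le _
    have h5 : (l1 a0 a : ℝ) < ⌊α * N / 2⌋ := by exact_mod_cast h1
    have h6 : (l1 b0 a : ℝ) < ⌊α * N / 2⌋ := by exact_mod_cast h2
    have h7 : (l1 a0 b0 : ℝ) ≤ l1 a0 a + l1 b0 a := by exact_mod_cast h3
    linarith
  have hbx : ∀ y ∈ box N, Metric.infDist (pt y) (Ct C) ≤ 4 * N := by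
    intro y hy
    refine (Metric.infDist_le_dist_of_mem (pt_mem_Ct ha0)).trans ?_
    rw [dist_eq_norm]
    refine (Complex.norm_le_abs_re_add_abs_im _).trans ?_
    simp only [pt, Complex.sub_re, Complex.sub_im]
    obtain ⟨y1, y2⟩ := box_abs hy
    have h3 : |2 * (y.1 : ℝ)| ≤ N := by exact_mod_cast y1
    have h4 : |2 * (y.2 : ℝ)| ≤ N := by exact_mod_cast y2
    rw [abs_mul, abs_two] at h3 h4
    obtain ⟨z1, z2⟩ := hCabs a0 ha0
    have h5 := abs_sub (y.1 : ℝ) a0.1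
    have h6 := abs_sub (y.2 : ℝ) a0.2
    have h7 : β * N ≤ N := by nlinarith
    linarith
  have := core hconf hconn hAC (hCf.subset hAC) hN hbx hvin hvnb e2 e6 hMl (n := n) (J := J)
    (by rw [Int.le_floor]; push_cast; exact hnM) (r := c * N / 8) hRn hkR hη0 hη1 hηR (by linarith) (by linarith)
    (by linarith) hδv hp0 hp1 hpR hT
  refine this.trans (le_of_eq ?_)
  have q1 : k * R * N / (c * N * T) = k * R / (c * T) := by field_simp
  have q2 : 144 * k ^ 2 * (4 * (N : ℝ)) ^ 2 / ((c * N / 8) ^ 2 * η) = 147456 * k ^ 2 / (c ^ 2 * η) := by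
    field_simp; norm_num
  rw [q1, q2]

open Filter in
lemma poly_exp (s : ℝ) {a b : ℝ} (ha : 0 < a) (hb : 0 < b) (K : ℝ) {ε : ℝ} (hε : 0 < ε) :
    ∀ᶠ L : ℝ in atTop, K * L ^ s * Real.exp (-(b * L ^ a)) ≤ ε := by
  have h := ((tendsto_rpow_mul_exp_neg_mul_atTop_nhds_zero (s / a) b hb).comp (tendsto_rpow_atTop ha)).const_mul K
  rw [mul_zero] at h
  filter_upwards [h.eventually (ge_mem_nhds hε), eventually_gt_atTop 0] with L h1 h2
  simp only [Function.comp] at h1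
  rw [← Real.rpow_mul h2.le, mul_div_cancel₀ _ ha.ne'] at h1
  rw [mul_assoc]
  simpa [neg_mul] using h1

lemma term2 {k c c3 x L N : ℝ} (hk : 0 < k) (hc : 0 < c) (hL : 0 < L) (hN : N = Real.exp L) (h3 : 200 * k ^ 4 * c3 = 1 / 8)
    (h30 : 0 < c3) (hb : k / c * L ^ (2 : ℝ) * Real.exp (-(1 / 4 * L ^ x)) ≤ 1) :
    (k * L ^ 2 / (c * Real.exp (1 / 2 * L ^ x))) ^ (c3 * L ^ (x - 1)) * N ^ (200 * k ^ 4 * (c3 * L ^ (x - 1)) ^ 2) ≤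
      Real.exp (-(c3 / 8 * L ^ (2 * x - 1))) := by
  have hp : 0 < c3 * L ^ (x - 1) := by positivity
  have e1 : L * L ^ (x - 1) = L ^ x := by
    nth_rewrite 1 [← Real.rpow_one L]; rw [← Real.rpow_add hL]; ring_nf
  have e2 : L ^ (x - 1) * L ^ x = L ^ (2 * x - 1) := by
    rw [← Real.rpow_add hL]; ring_nf
  have h1 : k * L ^ 2 / (c * Real.exp (1 / 2 * L ^ x)) ≤ Real.exp (-(1 / 4 * L ^ x)) := by
    have : k * L ^ 2 / (c * Real.exp (1 / 2 * L ^ x)) =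
        (k / c * L ^ (2 : ℝ) * Real.exp (-(1 / 4 * L ^ x))) * Real.exp (-(1 / 4 * L ^ x)) := by
      rw [mul_assoc, ← Real.exp_add, show -(1 / 4 * L ^ x) + -(1 / 4 * L ^ x) = -(1 / 2 * L ^ x) by ring, Real.exp_neg,
        Real.rpow_two]
      field_simp
    rw [this]
    exact mul_le_of_le_one_left (Real.exp_pos _).le hb
  have h2 := Real.rpow_le_rpow (by positivity) h1 hp.le
  rw [← Real.exp_mul] at h2
  rw [hN, ← Real.exp_mul]
  refine (mul_le_mul_of_nonneg_right h2 (Real.exp_pos _).le).trans ?_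
  rw [← Real.exp_add]
  refine Real.exp_le_exp.2 (le_of_eq ?_)
  have e3 : L * (200 * k ^ 4 * (c3 * L ^ (x - 1)) ^ 2) = (200 * k ^ 4 * c3) * c3 * (L ^ (x - 1) * (L * L ^ (x - 1))) := by ring
  rw [e3, e1, h3, ← e2]; ring

lemma term3 {x L N : ℝ} (hL : 1 ≤ L) (hN : N = Real.exp L) :
    (2 * (Real.exp (1 / 2 * L ^ x) / N)) ^ (1 - 1 / L) ≤ 6 * (Real.exp (1 / 2 * L ^ x) / N) := by
  have hL0 : 0 < L := by linarith
  have e : 2 * (Real.exp (1 / 2 * L ^ x) / N) = Real.exp (Real.log 2 + 1 / 2 * L ^ x - L) := by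
    rw [hN, Real.exp_sub, Real.exp_add, Real.exp_log (by norm_num)]; ring
  have e2 : 6 * (Real.exp (1 / 2 * L ^ x) / N) = 3 * Real.exp (Real.log 2 + 1 / 2 * L ^ x - L) := by
    rw [← e]; ring
  rw [e2, e, ← Real.exp_mul]
  set y := Real.log 2 + 1 / 2 * L ^ x - L with hy
  have hyL : -L ≤ y := by
    have : 0 ≤ Real.log 2 := Real.log_nonneg (by norm_num)
    have : 0 ≤ L ^ x := by positivity
    rw [hy]; linarith
  have h1 : y * (1 - 1 / L) ≤ 1 + y := by
    have : -1 ≤ y / L := by rw [le_div_iff₀ hL0]; linarith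
    have e3 : y * (1 - 1 / L) = y - y / L := by ring
    linarith
  refine (Real.exp_le_exp.2 h1).trans ?_
  rw [Real.exp_add]
  exact mul_le_mul_of_nonneg_right (by linarith [Real.exp_one_lt_d9]) (Real.exp_pos _).le

open Filter in
set_option maxHeartbeats 1000000 in
theorem stmt6_aux (α β χ : ℝ) (hα : 0 < α) (hαβ : α < β) (hβ : β < 1) (hχ : 1 / 2 < χ) :
    ∀ ε > (0 : ℝ), ∃ N₀ : ℕ, ∀ N : ℕ, N₀ ≤ N →
      ∀ C : Set (ℤ × ℤ), C ⊆ ↑(boxR (β * N)) → LatticeConnected C →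
        (∃ u ∈ C, ∃ v ∈ C, α * N ≤ ((|u.1 - v.1| + |u.2 - v.2| : ℤ) : ℝ)) →
        ∀ A : Set (ℤ × ℤ), A ⊆ C → (A.ncard : ℝ) ≤ (N : ℝ) * Real.exp (-(Real.log N) ^ χ) →
          ∀ v ∈ bdryR ((1 + β) * N / 2),
            hmSet v A (C ∪ ↑(bdry N)) ≤ ε * (Real.log N) ^ (-(10 : ℝ)) := by
  intro ε hε
  obtain ⟨k, hkd⟩ : ∃ k : ℝ, k = 27648 * 256 / α ^ 2 := ⟨_, rfl⟩
  obtain ⟨c, hcd⟩ : ∃ c : ℝ, c = (1 - β) / 8 := ⟨_, rfl⟩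
  have hk : 0 < k := by rw [hkd]; positivity
  have hc : 0 < c := by rw [hcd]; linarith
  obtain ⟨x, hx⟩ : ∃ x : ℝ, x = min χ (3 / 4) := ⟨_, rfl⟩
  have hx1 : 1 / 2 < x := by rw [hx]; exact lt_min hχ (by norm_num)
  have hx2 : x ≤ 3 / 4 := by rw [hx]; exact min_le_right _ _
  have hxχ : x ≤ χ := by rw [hx]; exact min_le_left _ _
  obtain ⟨c3, hc3⟩ : ∃ c3 : ℝ, c3 = 1 / (1600 * k ^ 4) := ⟨_, rfl⟩
  have h30 : 0 < c3 := by rw [hc3]; positivity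
  have h3 : 200 * k ^ 4 * c3 = 1 / 8 := by rw [hc3]; field_simp; norm_num
  have hl : 0 < Real.log (20 / 19) := Real.log_pos (by norm_num)
  obtain ⟨D0, hD0⟩ : ∃ D0 : ℝ, D0 = 11 / Real.log (20 / 19) := ⟨_, rfl⟩
  have hD0p : 0 < D0 := by rw [hD0]; positivity
  obtain ⟨D, hD⟩ : ∃ D : ℝ, D = D0 * Real.log 40 := ⟨_, rfl⟩
  have hDp : 0 < D := by rw [hD]; exact mul_pos hD0p (Real.log_pos (by norm_num))
  have ev : ∀ᶠ L : ℝ in atTop, 1 ≤ L ∧ 2 ≤ L ∧ 3 / ε ≤ L ∧ 32 * k ≤ L ∧ 12000000 * k ^ 5 ≤ L ∧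
      48 / c * L ^ (0 : ℝ) * Real.exp (-(1 * L ^ (1 : ℝ))) ≤ 1 ∧
      4 / c * L ^ (2 : ℝ) * Real.exp (-(1 * L ^ (1 : ℝ))) ≤ 1 ∧
      1280 / α * L ^ (2 + D) * Real.exp (-(1 * L ^ (1 : ℝ))) ≤ 1 ∧
      60000 * k / c3 ^ 2 ≤ L ^ (2 * x) ∧
      k / c * L ^ (2 : ℝ) * Real.exp (-(1 / 4 * L ^ x)) ≤ 1 ∧
      1 * L ^ (10 : ℝ) * Real.exp (-(c3 / 8 * L ^ (2 * x - 1))) ≤ ε / 3 ∧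
      (2 * 321 ^ 2 * (147456 * k ^ 2 / c ^ 2) * 6) * L ^ (15 + 2 * D) * Real.exp (-(1 / 2 * L ^ x)) ≤ ε / 3 :=
    (eventually_ge_atTop _).and <| (eventually_ge_atTop _).and <| (eventually_ge_atTop _).and <|
    (eventually_ge_atTop _).and <| (eventually_ge_atTop _).and <|
    (poly_exp _ one_pos one_pos _ one_pos).and <| (poly_exp _ one_pos one_pos _ one_pos).and <|
    (poly_exp _ one_pos one_pos _ one_pos).and <|
    ((tendsto_rpow_atTop (by linarith)).eventually_ge_atTop _).and <|
    (poly_exp _ (by linarith) (by norm_num) _ one_pos).and <|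
    (poly_exp _ (by linarith) (by positivity) _ (by positivity)).and <|
    poly_exp _ (by linarith) (by norm_num) _ (by positivity)
  obtain ⟨N₀, hN₀⟩ := eventually_atTop.1 ((Real.tendsto_log_atTop.comp tendsto_natCast_atTop_atTop).eventually ev)
  refine ⟨N₀ + 1, fun N hN C hCb hconn hdi A hAC hA v hv => ?_⟩
  have hN1 : 1 ≤ N := by omega
  obtain ⟨hL1, hL2, hL3, hL4, hL5, a1, a2, a3, a4, a5, a6, a7⟩ := hN₀ N (by omega)
  simp only [Function.comp] at hL1 hL2 hL3 hL4 hL5 a1 a2 a3 a4 a5 a6 a7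
  have hNp : (0 : ℝ) < N := by exact_mod_cast hN1
  have hNe : (N : ℝ) = Real.exp (Real.log N) := (Real.exp_log hNp).symm
  set L := Real.log N with hLd
  have hL0 : 0 < L := by linarith
  have hLsq : L ≤ L ^ 2 := le_self_pow₀ hL1 two_ne_zero
  have hinv : Real.exp (-(1 * L ^ (1 : ℝ))) = 1 / N := by
    rw [one_mul, Real.rpow_one, Real.exp_neg, ← hNe, one_div]
  rw [hinv, mul_one_div, div_le_one hNp] at a1 a2 a3
  rw [Real.rpow_zero, mul_one, div_le_iff₀ hc] at a1
  rw [Real.rpow_two, div_mul_eq_mul_div, div_le_iff₀ hc] at a2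
  rw [div_mul_eq_mul_div, div_le_iff₀ hα] at a3
  obtain ⟨J, hJ⟩ : ∃ J : ℕ, J = ⌈D0 * Real.log L⌉₊ := ⟨_, rfl⟩
  have hlogL : 0 ≤ Real.log L := Real.log_nonneg hL1
  have hJ1 : D0 * Real.log L ≤ J := by rw [hJ]; exact Nat.le_ceil _
  have hJ2 : (J : ℝ) ≤ D0 * Real.log L + 1 := by rw [hJ]; exact (Nat.ceil_lt_add_one (by positivity)).le
  have hJa : ((19 / 20 : ℝ)) ^ J ≤ L ^ (-(11 : ℝ)) := by
    rw [← Real.rpow_natCast, Real.rpow_def_of_pos (by norm_num), Real.rpow_def_of_pos hL0]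
    refine Real.exp_le_exp.2 ?_
    have : Real.log (19 / 20) = -Real.log (20 / 19) := by rw [← Real.log_inv]; norm_num
    rw [this]
    have h := mul_le_mul_of_nonneg_left hJ1 hl.le
    have e : Real.log (20 / 19) * (D0 * Real.log L) = 11 * Real.log L := by rw [hD0]; field_simp
    linarith
  have hJb : (40 : ℝ) ^ J ≤ 40 * L ^ D := by
    rw [← Real.rpow_natCast, Real.rpow_def_of_pos (by norm_num), Real.rpow_def_of_pos hL0]
    have : 40 * Real.exp (Real.log L * D) = Real.exp (Real.log 40 + Real.log L * D) := by
      rw [Real.exp_add, Real.exp_log (by norm_num)]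
    rw [this]
    refine Real.exp_le_exp.2 ?_
    have h := mul_le_mul_of_nonneg_left hJ2 (Real.log_nonneg (show (1 : ℝ) ≤ 40 by norm_num))
    rw [hD]
    linarith
  obtain ⟨n, hn⟩ : ∃ n : ℕ, n = ⌈L ^ 2⌉₊ + 1 := ⟨_, rfl⟩
  have hn1 : L ^ 2 + 1 ≤ n := by rw [hn]; push_cast; linarith [Nat.le_ceil (L ^ 2)]
  have hn2 : (n : ℝ) ≤ 4 * L ^ 2 := by
    rw [hn]; push_cast; linarith [(Nat.ceil_lt_add_one (show 0 ≤ L ^ 2 by positivity)).le]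
  have hLD : 0 < L ^ D := by positivity
  have hnJ : (n : ℝ) * 40 ^ J ≤ 160 * L ^ (2 + D) := by
    rw [Real.rpow_add hL0, Real.rpow_two]
    refine (mul_le_mul hn2 hJb (by positivity) (by positivity)).trans (le_of_eq (by ring))
  have hLp : L ^ (x - 1) ≤ 1 := Real.rpow_le_one_of_one_le_of_nonpos hL1 (by linarith)
  have key := core2 hα (by linarith) (by linarith) hβ hN1 hCb hconn hdi hAC hv hkd hcd (n := n) (J := J)
    (by linarith) (R := L ^ 2) (η := 1 / L) (p := c3 * L ^ (x - 1)) (T := Real.exp (1 / 2 * L ^ x)) hn1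
    (by linarith) (by positivity) (by rw [div_le_div_iff₀ hL0 two_pos]; linarith)
    (by rw [div_mul_eq_mul_div, one_mul, pow_two, mul_div_cancel_right₀ _ hL0.ne']; exact hL5)
    (by linarith) (by linarith) (by positivity)
    (by rw [← mul_assoc, h3]; linarith)
    (by
      rw [div_le_iff₀ (by positivity)] at a4
      refine a4.trans (le_of_eq ?_)
      have : L ^ (2 * x) = (L ^ (x - 1)) ^ 2 * L ^ 2 := by
        rw [← Real.rpow_two, ← Real.rpow_two, ← Real.rpow_mul hL0.le, ← Real.rpow_add hL0]; ring_nf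
      rw [this]; ring)
    (Real.one_le_exp (by positivity))
  refine key.trans ?_
  have hL10 : 0 < L ^ (10 : ℝ) := by positivity
  have t1 : ((19 / 20 : ℝ)) ^ J ≤ ε / 3 * L ^ (-(10 : ℝ)) := by
    refine hJa.trans ?_
    rw [show -(11 : ℝ) = -1 + -10 by norm_num, Real.rpow_add hL0]
    refine mul_le_mul_of_nonneg_right ?_ (by positivity)
    rw [Real.rpow_neg_one, inv_le_comm₀ hL0 (by positivity), inv_div]
    exact hL3
  have t2 := term2 (N := (N : ℝ)) hk hc hL0 hNe h3 h30 a5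
  have t2' : Real.exp (-(c3 / 8 * L ^ (2 * x - 1))) ≤ ε / 3 * L ^ (-(10 : ℝ)) := by
    rw [Real.rpow_neg hL0.le, ← div_eq_mul_inv, le_div_iff₀ hL10]
    linarith
  have t3 : 2 * (A.ncard * (2 * ((n : ℝ) * 40 ^ J) + 1) ^ 2 * (147456 * k ^ 2 / (c ^ 2 * (1 / L)) *
      (2 * (Real.exp (1 / 2 * L ^ x) / N)) ^ (1 - 1 / L))) ≤ ε / 3 * L ^ (-(10 : ℝ)) := by
    have b1 : (A.ncard : ℝ) ≤ N * Real.exp (-(L ^ x)) := by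
      refine hA.trans (mul_le_mul_of_nonneg_left (Real.exp_le_exp.2 ?_) hNp.le)
      exact neg_le_neg (Real.rpow_le_rpow_of_exponent_le hL1 hxχ)
    have b2 : (2 * ((n : ℝ) * 40 ^ J) + 1) ^ 2 ≤ (321 * L ^ (2 + D)) ^ 2 := by
      have : 1 ≤ L ^ (2 + D) := Real.one_le_rpow hL1 (by linarith)
      exact pow_le_pow_left₀ (by positivity) (by linarith) 2
    have b3 := term3 (x := x) hL1 hNe
    have b4 : 147456 * k ^ 2 / (c ^ 2 * (1 / L)) = 147456 * k ^ 2 / c ^ 2 * L := by field_simp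
    rw [b4]
    have b5 : 2 * (A.ncard * (2 * ((n : ℝ) * 40 ^ J) + 1) ^ 2 * (147456 * k ^ 2 / c ^ 2 * L *
      (2 * (Real.exp (1 / 2 * L ^ x) / N)) ^ (1 - 1 / L))) ≤
      2 * (N * Real.exp (-(L ^ x)) * (321 * L ^ (2 + D)) ^ 2 * (147456 * k ^ 2 / c ^ 2 * L *
        (6 * (Real.exp (1 / 2 * L ^ x) / N)))) := by gcongr
    refine b5.trans ?_
    rw [Real.rpow_neg hL0.le, ← div_eq_mul_inv, le_div_iff₀ hL10]
    refine le_trans (le_of_eq ?_) a7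
    have c1 : L ^ (15 + 2 * D) = (L ^ (2 + D)) ^ 2 * L * L ^ (10 : ℝ) := by
      rw [← Real.rpow_two, ← Real.rpow_mul hL0.le]
      nth_rewrite 3 [← Real.rpow_one L]
      rw [← Real.rpow_add hL0, ← Real.rpow_add hL0]; ring_nf
    have c2 : Real.exp (-(1 / 2 * L ^ x)) = Real.exp (-(L ^ x)) * Real.exp (1 / 2 * L ^ x) := by
      rw [← Real.exp_add]; ring_nf
    rw [c1, c2]
    field_simp
  linarith

/-- For `0 < α < β < 1`, `χ > 1/2` and any `ε > 0`, for all large `N`: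
for every connected `C ⊆ V_{βN}` of `ℓ¹`-diameter at least `αN`, every `A ⊆ C` with
`|A| ≤ N e^{-(log N)^χ}`, and every `v ∈ ∂V_{(1+β)N/2}`,
`Hm(v, A; C ∪ ∂V_N) ≤ ε (log N)^{-10}`. -/
theorem stmt6 (α β χ : ℝ) (hα : 0 < α) (hαβ : α < β) (hβ : β < 1) (hχ : 1 / 2 < χ) :
    ∀ ε > (0 : ℝ), ∃ N₀ : ℕ, ∀ N : ℕ, N₀ ≤ N →
      ∀ C : Set (ℤ × ℤ), C ⊆ ↑(boxR (β * N)) → LatticeConnected C →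
        (∃ u ∈ C, ∃ v ∈ C, α * N ≤ ((|u.1 - v.1| + |u.2 - v.2| : ℤ) : ℝ)) →
        ∀ A : Set (ℤ × ℤ), A ⊆ C → (A.ncard : ℝ) ≤ (N : ℝ) * Real.exp (-(Real.log N) ^ χ) →
          ∀ v ∈ bdryR ((1 + β) * N / 2),
            hmSet v A (C ∪ ↑(bdry N)) ≤ ε * (Real.log N) ^ (-(10 : ℝ)) := by
  exact stmt6_aux α β χ hα hαβ hβ hχ

end
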